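/- Up to isometry, there exists exactly one Coxeter decomposition of the second type of the hyperbolic simplex H_9^4 with fundamental simplex H_3^4; it has N = 10 tiles, and exactly one of the three ideal vertices of H_9^4 belongs to 8 tiles while each of the other two ideal vertices belongs to exactly one tile. -/

import Mathlib

noncomputable section

namespace CD

open MeasureTheory Set
open scoped ENNReal

/-! ## Coxeter diagrams, encoded as Coxeter matrices.
A Coxeter diagram on `k` nodes is encoded by its Coxeter matrix
`M : Matrix (Fin k) (Fin k) ℕ`: `M i i = 1`, and for `i ≠ j` the entry `M i j = m`
means that the corresponding facets meet at the dihedral angle `π / m`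
(`2` = no edge of the diagram, and `0` encodes the label `∞`, i.e. angle `0`,
consistently with `π / 0 = 0` in Lean). -/

/-- A Coxeter diagram: a number of nodes together with a Coxeter matrix. -/
def CM : Type := Σ k : ℕ, Matrix (Fin k) (Fin k) ℕ

/-- The Coxeter matrix on `k` nodes with the given list of labelled edges
(`(i, j, m)` is an edge between nodes `i` and `j` with label `m`). -/
def cmOfEdges (k : ℕ) (E : List (ℕ × ℕ × ℕ)) : Matrix (Fin k) (Fin k) ℕ :=
  Matrix.of fun i j =>
    if i = j then 1 else
      match E.find? (fun e => (e.1 == (i : ℕ) && e.2.1 == (j : ℕ)) ||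
                              (e.1 == (j : ℕ) && e.2.1 == (i : ℕ))) with
      | some e => e.2.2
      | none => 2

/-- The Coxeter matrix of type `A_k`. -/
def cmA (k : ℕ) : Matrix (Fin k) (Fin k) ℕ :=
  Matrix.of fun i j =>
    if i = j then 1
    else if (i : ℕ) + 1 = (j : ℕ) ∨ (j : ℕ) + 1 = (i : ℕ) then 3 else 2

/-- The Coxeter matrix of type `D_k`, with the conventions `D_2 = A_1 + A_1` and
`D_3 = A_3`. -/
def cmD (k : ℕ) : Matrix (Fin k) (Fin k) ℕ :=
  Matrix.of fun i j =>
    if i = j then 1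
    else if k = 2 then 2
    else if ((i : ℕ) + 1 = (j : ℕ) ∧ (j : ℕ) ≤ k - 2) ∨
            ((j : ℕ) + 1 = (i : ℕ) ∧ (i : ℕ) ≤ k - 2) ∨
            ((i : ℕ) = k - 3 ∧ (j : ℕ) = k - 1) ∨
            ((j : ℕ) = k - 3 ∧ (i : ℕ) = k - 1)
      then 3 else 2

/-- Direct sum (disjoint union) of two Coxeter matrices. -/
def cmSum {a b : ℕ} (M : Matrix (Fin a) (Fin a) ℕ) (N : Matrix (Fin b) (Fin b) ℕ) :
    Matrix (Fin (a + b)) (Fin (a + b)) ℕ :=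
  Matrix.of fun i j =>
    if hi : (i : ℕ) < a then
      if hj : (j : ℕ) < a then M ⟨i, hi⟩ ⟨j, hj⟩ else 2
    else
      if _hj : (j : ℕ) < a then 2
      else N ⟨(i : ℕ) - a, by have := i.isLt; omega⟩ ⟨(j : ℕ) - a, by have := j.isLt; omega⟩

def cmAdd (x y : CM) : CM := ⟨x.1 + y.1, cmSum x.2 y.2⟩

def cmNil : CM := ⟨0, Matrix.of fun _ _ => 1⟩

/-- Disjoint union of a list of Coxeter diagrams. -/
def cmList (l : List CM) : CM := l.foldr cmAdd cmNil

def cA (k : ℕ) : CM := ⟨k, cmA k⟩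
def cD (k : ℕ) : CM := ⟨k, cmD k⟩
def cE6 : CM := ⟨6, cmOfEdges 6 [(0,1,3),(1,2,3),(2,3,3),(3,4,3),(2,5,3)]⟩
def cE7 : CM := ⟨7, cmOfEdges 7 [(0,1,3),(1,2,3),(2,3,3),(3,4,3),(4,5,3),(2,6,3)]⟩
def cE8 : CM := ⟨8, cmOfEdges 8 [(0,1,3),(1,2,3),(2,3,3),(3,4,3),(4,5,3),(5,6,3),(2,7,3)]⟩
def cF4 : CM := ⟨4, cmOfEdges 4 [(0,1,3),(1,2,4),(2,3,3)]⟩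
def cH3 : CM := ⟨3, cmOfEdges 3 [(0,1,5),(1,2,3)]⟩
def cH4 : CM := ⟨4, cmOfEdges 4 [(0,1,5),(1,2,3),(2,3,3)]⟩
/-- `G₂^{(5)} = I₂(5)`. -/
def cG25 : CM := ⟨2, cmOfEdges 2 [(0,1,5)]⟩

/-- The affine (Euclidean) Coxeter matrix `Ã₃` (a 4-cycle). -/
def cmA3t : Matrix (Fin 4) (Fin 4) ℕ := cmOfEdges 4 [(0,1,3),(1,2,3),(2,3,3),(0,3,3)]
/-- The affine Coxeter matrix `D̃₄`. -/
def cmD4t : Matrix (Fin 5) (Fin 5) ℕ := cmOfEdges 5 [(0,1,3),(0,2,3),(0,3,3),(0,4,3)]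
/-- The affine Coxeter matrix `C̃₄`. -/
def cmC4t : Matrix (Fin 5) (Fin 5) ℕ := cmOfEdges 5 [(0,1,4),(1,2,3),(2,3,3),(3,4,4)]
/-- The affine Coxeter matrix `F̃₄`. -/
def cmF4t : Matrix (Fin 5) (Fin 5) ℕ := cmOfEdges 5 [(0,1,3),(1,2,3),(2,3,4),(3,4,3)]
/-- The affine Coxeter matrix `C̃₂` (the Euclidean (2,4,4)-triangle). -/
def cmC2t : Matrix (Fin 3) (Fin 3) ℕ := cmOfEdges 3 [(0,1,4),(1,2,4)]
/-- The affine Coxeter matrix `G̃₂` (the Euclidean (2,3,6)-triangle). -/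
def cmG2t : Matrix (Fin 3) (Fin 3) ℕ := cmOfEdges 3 [(0,1,6),(1,2,3)]

/-- Connectedness of a Coxeter diagram. -/
def cmConnected (c : CM) : Prop :=
  ∀ i j : Fin c.1, Relation.ReflTransGen (fun a b => 3 ≤ c.2 a b ∨ c.2 a b = 0) i j

/-! ## Hyperbolic space `H^n`: the hyperboloid model. -/

/-- The Minkowski bilinear form of signature `(n,1)` on `ℝ^{n+1}`. -/
def mink (n : ℕ) (x y : EuclideanSpace ℝ (Fin (n + 1))) : ℝ :=
  -(x 0 * y 0) + ∑ i : Fin n, x i.succ * y i.succ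

/-- The hyperboloid model of hyperbolic `n`-space:
`{x ∈ ℝ^{n+1} : ⟨x,x⟩ = -1, x₀ > 0}`. -/
def hypSet (n : ℕ) : Set (EuclideanSpace ℝ (Fin (n + 1))) :=
  {x | mink n x x = -1 ∧ 0 < x 0}

/-- The closed half-space of `H^n` with (spacelike unit) outward normal `v`. -/
def hHalf (n : ℕ) (v : EuclideanSpace ℝ (Fin (n + 1))) : Set ↥(hypSet n) :=
  {x | mink n v x.val ≤ 0}

/-- The hyperplane of `H^n` with (spacelike unit) normal `v`. -/
def hWall (n : ℕ) (v : EuclideanSpace ℝ (Fin (n + 1))) : Set ↥(hypSet n) :=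
  {x | mink n v x.val = 0}

/-- Projection of the hyperboloid to the Beltrami–Klein ball. -/
def klein (n : ℕ) (x : ↥(hypSet n)) : Fin n → ℝ := fun i => x.val i.succ / x.val 0

/-- The hyperbolic (Riemannian) volume of a subset of `H^n`, computed in the
Beltrami–Klein model, where the volume element is `(1-|y|²)^{-(n+1)/2} dy`. -/
def hVol (n : ℕ) (S : Set ↥(hypSet n)) : ℝ≥0∞ :=
  ∫⁻ y in klein n '' S,
    ENNReal.ofReal ((1 - ∑ i, y i ^ 2) ^ (-((n : ℝ) + 1) / 2)) ∂(volume)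

/-- An isometry of `H^n`: a bijection preserving the Minkowski product
(equivalently, the hyperbolic distance `arcosh(-⟨x,y⟩)`). -/
def hIsIsom (n : ℕ) (g : ↥(hypSet n) → ↥(hypSet n)) : Prop :=
  Function.Bijective g ∧ ∀ x y, mink n (g x).val (g y).val = mink n x.val y.val

/-- Two subsets of `H^n` are congruent if an isometry carries one onto the other. -/
def hCongr (n : ℕ) (A B : Set ↥(hypSet n)) : Prop :=
  ∃ g, hIsIsom n g ∧ g '' A = B

/-- The ambient reflection of `ℝ^{n+1}` in the hyperplane with spacelike unit normal `v`. -/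
def hReflect (n : ℕ) (v x : EuclideanSpace ℝ (Fin (n + 1))) :
    EuclideanSpace ℝ (Fin (n + 1)) :=
  x - (2 * mink n v x) • v

/-- `S` is a facet ((n-1)-dimensional face) of the polyhedron `P ⊆ H^n`:
`S = P ∩ Π` for a supporting hyperplane `Π` of `P`, and `S` lies in no other
hyperplane (so it is genuinely `(n-1)`-dimensional). -/
def hIsFacet (n : ℕ) (P S : Set ↥(hypSet n)) : Prop :=
  S.Nonempty ∧ ∃ v, mink n v v = 1 ∧ P ⊆ hHalf n v ∧ S = P ∩ hWall n v ∧
    ∀ u, mink n u u = 1 → S ⊆ hWall n u → hWall n u = hWall n v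

/-- A convex polyhedron in `H^n`: an intersection of finitely many closed
half-spaces with nonempty interior and finite volume. -/
def hIsPoly (n : ℕ) (P : Set ↥(hypSet n)) : Prop :=
  ∃ (k : ℕ) (v : Fin k → EuclideanSpace ℝ (Fin (n + 1))),
    (∀ i, mink n (v i) (v i) = 1) ∧ P = ⋂ i, hHalf n (v i) ∧
    (interior P).Nonempty ∧ hVol n P < ⊤

/-- A Coxeter polyhedron in `H^n`: a convex polyhedron all of whose dihedral
angles are of the form `π/k`, `k ≥ 2` (the dihedral angle along a ridge with
outward unit normals `u, v` is `π/k` iff `⟨u,v⟩ = -cos (π/k)`). -/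
def hIsCoxPoly (n : ℕ) (P : Set ↥(hypSet n)) : Prop :=
  ∃ (k : ℕ) (v : Fin k → EuclideanSpace ℝ (Fin (n + 1))),
    (∀ i, mink n (v i) (v i) = 1) ∧ P = ⋂ i, hHalf n (v i) ∧
    (interior P).Nonempty ∧ hVol n P < ⊤ ∧
    ∀ i j, hWall n (v i) ≠ hWall n (v j) →
      (∃ x ∈ P, x ∈ hWall n (v i) ∩ hWall n (v j)) →
      ∃ m : ℕ, 2 ≤ m ∧ mink n (v i) (v j) = -Real.cos (Real.pi / (m : ℝ))

/-- A simplex in `H^n` (possibly with ideal vertices): a convex polyhedron with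
exactly `n+1` facets. -/
def hIsSimplex (n : ℕ) (P : Set ↥(hypSet n)) : Prop :=
  hIsPoly n P ∧ {S | hIsFacet n P S}.ncard = n + 1

/-- A Coxeter decomposition of `P ⊆ H^n`: a decomposition of `P` into finitely
many tiles with pairwise disjoint interiors, each tile a Coxeter polyhedron,
such that any two tiles having a common facet are symmetric with respect to
(the hyperplane of) this facet. -/
def hIsCoxDecomp (n : ℕ) (P : Set ↥(hypSet n)) (𝒯 : Set (Set ↥(hypSet n))) : Prop :=
  𝒯.Finite ∧ 𝒯.Nonempty ∧ (∀ T ∈ 𝒯, hIsCoxPoly n T) ∧ ⋃₀ 𝒯 = P ∧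
  (∀ T₁ ∈ 𝒯, ∀ T₂ ∈ 𝒯, T₁ ≠ T₂ → interior T₁ ∩ interior T₂ = ∅) ∧
  (∀ T₁ ∈ 𝒯, ∀ T₂ ∈ 𝒯, T₁ ≠ T₂ → ∀ S, hIsFacet n T₁ S → hIsFacet n T₂ S →
    ∃ v, mink n v v = 1 ∧ S ⊆ hWall n v ∧
      T₂ = {y | ∃ x ∈ T₁, (y : EuclideanSpace ℝ (Fin (n + 1))) = hReflect n v x.val})

/-- A hyperplane (with unit normal `v`) is a mirror of the decomposition `𝒯` of `P`
if it contains a facet of some tile but no facet of `P`. -/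
def hIsMirror (n : ℕ) (P : Set ↥(hypSet n)) (𝒯 : Set (Set ↥(hypSet n)))
    (v : EuclideanSpace ℝ (Fin (n + 1))) : Prop :=
  mink n v v = 1 ∧ (∃ T ∈ 𝒯, ∃ S, hIsFacet n T S ∧ S ⊆ hWall n v) ∧
  ¬∃ S, hIsFacet n P S ∧ S ⊆ hWall n v

/-- The decomposition `𝒯` of `P` is of the second type: every dihedral angle of `P`
is fundamental, i.e. no mirror contains the intersection of two facets of `P`. -/
def hSecondType (n : ℕ) (P : Set ↥(hypSet n)) (𝒯 : Set (Set ↥(hypSet n))) : Prop :=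
  ∀ α β, hIsFacet n P α → hIsFacet n P β → α ≠ β → (α ∩ β).Nonempty →
    ¬∃ v, hIsMirror n P 𝒯 v ∧ α ∩ β ⊆ hWall n v

/-- Decompositions obtainable by the inductive algorithm (decompositions of the
first type), with fundamental simplex `F`: start from (isometric copies of) `F`,
and repeatedly glue two previously obtained decomposed simplices along a common
facet so that the union is again a simplex and the union of the two
decompositions is a Coxeter decomposition of it. -/
inductive hFirstType (n : ℕ) (F : Set ↥(hypSet n)) :
    Set ↥(hypSet n) → Set (Set ↥(hypSet n)) → Prop
  | base (P : Set ↥(hypSet n)) : hCongr n F P → hIsSimplex n P → hFirstType n F P {P}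
  | congr (P : Set ↥(hypSet n)) (𝒯 : Set (Set ↥(hypSet n)))
      (g : ↥(hypSet n) → ↥(hypSet n)) :
      hIsIsom n g → hFirstType n F P 𝒯 → hFirstType n F (g '' P) ((fun T => g '' T) '' 𝒯)
  | glue (P₁ P₂ : Set ↥(hypSet n)) (𝒯₁ 𝒯₂ : Set (Set ↥(hypSet n))) (S : Set ↥(hypSet n)) :
      hFirstType n F P₁ 𝒯₁ → hFirstType n F P₂ 𝒯₂ →
      hIsFacet n P₁ S → hIsFacet n P₂ S →
      interior P₁ ∩ interior P₂ = ∅ →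
      hIsSimplex n (P₁ ∪ P₂) →
      hIsCoxDecomp n (P₁ ∪ P₂) (𝒯₁ ∪ 𝒯₂) →
      hFirstType n F (P₁ ∪ P₂) (𝒯₁ ∪ 𝒯₂)

/-- A vertex of the simplex `P ⊆ H^n`: a point of `P` lying on at least `n` facets. -/
def hIsVertex (n : ℕ) (P : Set ↥(hypSet n)) (x : ↥(hypSet n)) : Prop :=
  x ∈ P ∧ n ≤ {S | hIsFacet n P S ∧ x ∈ S}.ncard

/-- The cone over `S ⊆ H^n` in `ℝ^{n+1}`. -/
def hCone (n : ℕ) (S : Set ↥(hypSet n)) : Set (EuclideanSpace ℝ (Fin (n + 1))) :=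
  {y | ∃ x ∈ S, ∃ t : ℝ, 0 < t ∧ y = t • (x : EuclideanSpace ℝ (Fin (n + 1)))}

/-- The ideal vertices of `P ⊆ H^n`: lightlike directions (normalized by `w₀ = 1`)
in the closure of the cone over `P`. -/
def hIdealVerts (n : ℕ) (P : Set ↥(hypSet n)) : Set (EuclideanSpace ℝ (Fin (n + 1))) :=
  {w | mink n w w = 0 ∧ w 0 = 1 ∧ w ∈ closure (hCone n P)}

/-- The ideal vertex `w` of `P` has horospherical link of the Euclidean type given
by the (affine) Coxeter matrix `M`: the facets of `P` incident to `w` can be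
indexed so that their unit normals have Gram matrix `-cos (π / M i j)`. -/
def hIdealLink (n : ℕ) (P : Set ↥(hypSet n)) (w : EuclideanSpace ℝ (Fin (n + 1)))
    {k : ℕ} (M : Matrix (Fin k) (Fin k) ℕ) : Prop :=
  ∃ e : Fin k → EuclideanSpace ℝ (Fin (n + 1)),
    (∀ i, mink n (e i) (e i) = 1) ∧
    (∀ i, mink n (e i) w = 0) ∧
    (∀ i j, i ≠ j → mink n (e i) (e j) = -Real.cos (Real.pi / (M i j : ℝ))) ∧
    (∀ i j, i ≠ j → hWall n (e i) ≠ hWall n (e j)) ∧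
    {S | hIsFacet n P S ∧ w ∈ closure (hCone n S)} =
      Set.range fun i => P ∩ hWall n (e i)

/-- The number of tiles of `𝒯` incident to the ideal point `w`. -/
def hTilesAt (n : ℕ) (𝒯 : Set (Set ↥(hypSet n)))
    (w : EuclideanSpace ℝ (Fin (n + 1))) : ℕ :=
  {T | T ∈ 𝒯 ∧ w ∈ closure (hCone n T)}.ncard

/-- An occurrence, in the Coxeter diagram of `P`, of a subdiagram of type `M`:
a set `𝒜` of `k` facets of `P` whose unit normals have Gram matrix
`-cos (π / M i j)`. -/
def hSubOcc (n : ℕ) (P : Set ↥(hypSet n)) {k : ℕ} (M : Matrix (Fin k) (Fin k) ℕ)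
    (𝒜 : Set (Set ↥(hypSet n))) : Prop :=
  ∃ e : Fin k → EuclideanSpace ℝ (Fin (n + 1)),
    (∀ i, mink n (e i) (e i) = 1) ∧
    (∀ i j, i ≠ j → mink n (e i) (e j) = -Real.cos (Real.pi / (M i j : ℝ))) ∧
    (∀ i, hIsFacet n P (P ∩ hWall n (e i))) ∧
    𝒜 = Set.range (fun i => P ∩ hWall n (e i)) ∧ 𝒜.ncard = k

/-- The polyhedron `P ⊆ H^n` is a Coxeter simplex with Coxeter diagram (matrix) `M`. -/
def hOfType (n : ℕ) (P : Set ↥(hypSet n)) {k : ℕ} (M : Matrix (Fin k) (Fin k) ℕ) : Prop :=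
  (∀ i, M i i = 1) ∧ (∀ i j, M i j = M j i) ∧
  ∃ e : Fin k → EuclideanSpace ℝ (Fin (n + 1)),
    (∀ i, mink n (e i) (e i) = 1) ∧
    (∀ i j, i ≠ j → mink n (e i) (e j) = -Real.cos (Real.pi / (M i j : ℝ))) ∧
    P = ⋂ i, hHalf n (e i) ∧ (∀ i, hIsFacet n P (P ∩ hWall n (e i)))

/-- Equivalence of two decompositions of the same polyhedron `P`, up to an
isometry preserving `P`. -/
def hDecompEquiv (n : ℕ) (P : Set ↥(hypSet n)) (𝒯₁ 𝒯₂ : Set (Set ↥(hypSet n))) : Prop :=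
  ∃ g, hIsIsom n g ∧ g '' P = P ∧ (fun T => g '' T) '' 𝒯₁ = 𝒯₂

/-- A Coxeter decomposition of the second type of `P` with fundamental simplex `F`. -/
def hSTDecomp (n : ℕ) (P F : Set ↥(hypSet n)) (𝒯 : Set (Set ↥(hypSet n))) : Prop :=
  hIsCoxDecomp n P 𝒯 ∧ (∀ T ∈ 𝒯, hCongr n F T) ∧ hSecondType n P 𝒯

def hCoxSimplex (n : ℕ) (P : Set ↥(hypSet n)) : Prop := hIsCoxPoly n P ∧ hIsSimplex n P

/-! ## The sphere `S^n ⊂ ℝ^{n+1}`. -/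

/-- The Euclidean dot product on `ℝ^{n+1}`. -/
def sdot (n : ℕ) (x y : EuclideanSpace ℝ (Fin (n + 1))) : ℝ := ∑ i, x i * y i

/-- The unit sphere `S^n ⊂ ℝ^{n+1}`. -/
def sSet (n : ℕ) : Set (EuclideanSpace ℝ (Fin (n + 1))) := {x | sdot n x x = 1}

/-- The closed hemisphere of `S^n` with (unit) outward normal `v`. -/
def sHalf (n : ℕ) (v : EuclideanSpace ℝ (Fin (n + 1))) : Set ↥(sSet n) :=
  {x | sdot n v x.val ≤ 0}

/-- The great hypersphere of `S^n` with (unit) normal `v`. -/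
def sWall (n : ℕ) (v : EuclideanSpace ℝ (Fin (n + 1))) : Set ↥(sSet n) :=
  {x | sdot n v x.val = 0}

/-- The spherical (Riemannian) volume of `S ⊆ S^n`: `(n+1)` times the Lebesgue
measure of the cone over `S` truncated at radius `1`. -/
def sVol (n : ℕ) (S : Set ↥(sSet n)) : ℝ≥0∞ :=
  ((n : ℝ≥0∞) + 1) *
    volume {y : Fin (n + 1) → ℝ | ∃ x ∈ S, ∃ t : ℝ, 0 < t ∧ t ≤ 1 ∧
      y = fun i => t * (x : EuclideanSpace ℝ (Fin (n + 1))) i}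

/-- An isometry of `S^n`: a bijection preserving the dot product (equivalently,
the spherical distance). -/
def sIsIsom (n : ℕ) (g : ↥(sSet n) → ↥(sSet n)) : Prop :=
  Function.Bijective g ∧ ∀ x y, sdot n (g x).val (g y).val = sdot n x.val y.val

def sCongr (n : ℕ) (A B : Set ↥(sSet n)) : Prop := ∃ g, sIsIsom n g ∧ g '' A = B

/-- The ambient reflection of `ℝ^{n+1}` in the hyperplane with unit normal `v`. -/
def sReflect (n : ℕ) (v x : EuclideanSpace ℝ (Fin (n + 1))) :
    EuclideanSpace ℝ (Fin (n + 1)) :=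
  x - (2 * sdot n v x) • v

/-- `S` is a facet of the spherical polyhedron `P`. -/
def sIsFacet (n : ℕ) (P S : Set ↥(sSet n)) : Prop :=
  S.Nonempty ∧ ∃ v, sdot n v v = 1 ∧ P ⊆ sHalf n v ∧ S = P ∩ sWall n v ∧
    ∀ u, sdot n u u = 1 → S ⊆ sWall n u → sWall n u = sWall n v

/-- A convex polyhedron in `S^n`. -/
def sIsPoly (n : ℕ) (P : Set ↥(sSet n)) : Prop :=
  ∃ (k : ℕ) (v : Fin k → EuclideanSpace ℝ (Fin (n + 1))),
    (∀ i, sdot n (v i) (v i) = 1) ∧ P = ⋂ i, sHalf n (v i) ∧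
    (interior P).Nonempty ∧ sVol n P < ⊤

/-- A Coxeter polyhedron in `S^n`. -/
def sIsCoxPoly (n : ℕ) (P : Set ↥(sSet n)) : Prop :=
  ∃ (k : ℕ) (v : Fin k → EuclideanSpace ℝ (Fin (n + 1))),
    (∀ i, sdot n (v i) (v i) = 1) ∧ P = ⋂ i, sHalf n (v i) ∧
    (interior P).Nonempty ∧ sVol n P < ⊤ ∧
    ∀ i j, sWall n (v i) ≠ sWall n (v j) →
      (∃ x ∈ P, x ∈ sWall n (v i) ∩ sWall n (v j)) →
      ∃ m : ℕ, 2 ≤ m ∧ sdot n (v i) (v j) = -Real.cos (Real.pi / (m : ℝ))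

/-- A spherical simplex in `S^n`: the intersection of `S^n` with a simplicial cone,
i.e. a convex spherical polyhedron with exactly `n+1` facets. -/
def sIsSimplex (n : ℕ) (P : Set ↥(sSet n)) : Prop :=
  sIsPoly n P ∧ {S | sIsFacet n P S}.ncard = n + 1

/-- A Coxeter decomposition of `P ⊆ S^n`. -/
def sIsCoxDecomp (n : ℕ) (P : Set ↥(sSet n)) (𝒯 : Set (Set ↥(sSet n))) : Prop :=
  𝒯.Finite ∧ 𝒯.Nonempty ∧ (∀ T ∈ 𝒯, sIsCoxPoly n T) ∧ ⋃₀ 𝒯 = P ∧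
  (∀ T₁ ∈ 𝒯, ∀ T₂ ∈ 𝒯, T₁ ≠ T₂ → interior T₁ ∩ interior T₂ = ∅) ∧
  (∀ T₁ ∈ 𝒯, ∀ T₂ ∈ 𝒯, T₁ ≠ T₂ → ∀ S, sIsFacet n T₁ S → sIsFacet n T₂ S →
    ∃ v, sdot n v v = 1 ∧ S ⊆ sWall n v ∧
      T₂ = {y | ∃ x ∈ T₁, (y : EuclideanSpace ℝ (Fin (n + 1))) = sReflect n v x.val})

/-- Mirrors of a spherical Coxeter decomposition. -/
def sIsMirror (n : ℕ) (P : Set ↥(sSet n)) (𝒯 : Set (Set ↥(sSet n)))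
    (v : EuclideanSpace ℝ (Fin (n + 1))) : Prop :=
  sdot n v v = 1 ∧ (∃ T ∈ 𝒯, ∃ S, sIsFacet n T S ∧ S ⊆ sWall n v) ∧
  ¬∃ S, sIsFacet n P S ∧ S ⊆ sWall n v

/-- Second type: every dihedral angle of `P` is fundamental. -/
def sSecondType (n : ℕ) (P : Set ↥(sSet n)) (𝒯 : Set (Set ↥(sSet n))) : Prop :=
  ∀ α β, sIsFacet n P α → sIsFacet n P β → α ≠ β → (α ∩ β).Nonempty →
    ¬∃ v, sIsMirror n P 𝒯 v ∧ α ∩ β ⊆ sWall n v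

/-- `P ⊆ S^n` is a Coxeter simplex with Coxeter diagram (matrix) `M`. -/
def sOfType (n : ℕ) (P : Set ↥(sSet n)) {k : ℕ} (M : Matrix (Fin k) (Fin k) ℕ) : Prop :=
  (∀ i, M i i = 1) ∧ (∀ i j, M i j = M j i) ∧
  ∃ e : Fin k → EuclideanSpace ℝ (Fin (n + 1)),
    (∀ i, sdot n (e i) (e i) = 1) ∧
    (∀ i j, i ≠ j → sdot n (e i) (e j) = -Real.cos (Real.pi / (M i j : ℝ))) ∧
    P = ⋂ i, sHalf n (e i) ∧ (∀ i, sIsFacet n P (P ∩ sWall n (e i)))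

/-- `P ⊆ S^n` is a Coxeter simplex of the type given by the diagram `c`. -/
def sOfTypeCM (n : ℕ) (P : Set ↥(sSet n)) (c : CM) : Prop := sOfType n P c.2

/-! ## Euclidean space `E^n`. -/

/-- The dot product on `E^n`. -/
def edot (n : ℕ) (x y : EuclideanSpace ℝ (Fin n)) : ℝ := ∑ i, x i * y i

/-- The closed affine half-space `{x : ⟨v,x⟩ ≤ c}` of `E^n`. -/
def eHalf (n : ℕ) (v : EuclideanSpace ℝ (Fin n)) (c : ℝ) : Set (EuclideanSpace ℝ (Fin n)) :=
  {x | edot n v x ≤ c}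

/-- The affine hyperplane `{x : ⟨v,x⟩ = c}` of `E^n`. -/
def eWall (n : ℕ) (v : EuclideanSpace ℝ (Fin n)) (c : ℝ) : Set (EuclideanSpace ℝ (Fin n)) :=
  {x | edot n v x = c}

/-- Reflection of `E^n` in the affine hyperplane `{x : ⟨v,x⟩ = c}` (`v` a unit vector). -/
def eReflect (n : ℕ) (v : EuclideanSpace ℝ (Fin n)) (c : ℝ) (x : EuclideanSpace ℝ (Fin n)) :
    EuclideanSpace ℝ (Fin n) :=
  x - (2 * (edot n v x - c)) • v

/-- An isometry of `E^n`. -/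
def eIsIsom (n : ℕ) (g : EuclideanSpace ℝ (Fin n) → EuclideanSpace ℝ (Fin n)) : Prop :=
  Function.Bijective g ∧ ∀ x y, dist (g x) (g y) = dist x y

def eCongr (n : ℕ) (A B : Set (EuclideanSpace ℝ (Fin n))) : Prop :=
  ∃ g, eIsIsom n g ∧ g '' A = B

/-- A similarity transformation of `E^n` carries `A` onto `B`. -/
def eSimilar (n : ℕ) (A B : Set (EuclideanSpace ℝ (Fin n))) : Prop :=
  ∃ (f : EuclideanSpace ℝ (Fin n) → EuclideanSpace ℝ (Fin n)) (r : ℝ), 0 < r ∧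
    Function.Surjective f ∧ (∀ x y, dist (f x) (f y) = r * dist x y) ∧ f '' A = B

/-- `S` is a facet of the Euclidean polyhedron `P`. -/
def eIsFacet (n : ℕ) (P S : Set (EuclideanSpace ℝ (Fin n))) : Prop :=
  S.Nonempty ∧ ∃ v c, edot n v v = 1 ∧ P ⊆ eHalf n v c ∧ S = P ∩ eWall n v c ∧
    ∀ u d, edot n u u = 1 → S ⊆ eWall n u d → eWall n u d = eWall n v c

/-- A convex polyhedron in `E^n`. -/
def eIsPoly (n : ℕ) (P : Set (EuclideanSpace ℝ (Fin n))) : Prop :=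
  ∃ (k : ℕ) (v : Fin k → EuclideanSpace ℝ (Fin n)) (c : Fin k → ℝ),
    (∀ i, edot n (v i) (v i) = 1) ∧ P = ⋂ i, eHalf n (v i) (c i) ∧
    (interior P).Nonempty ∧ volume P < ⊤

/-- A Coxeter polyhedron in `E^n`. -/
def eIsCoxPoly (n : ℕ) (P : Set (EuclideanSpace ℝ (Fin n))) : Prop :=
  ∃ (k : ℕ) (v : Fin k → EuclideanSpace ℝ (Fin n)) (c : Fin k → ℝ),
    (∀ i, edot n (v i) (v i) = 1) ∧ P = ⋂ i, eHalf n (v i) (c i) ∧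
    (interior P).Nonempty ∧ volume P < ⊤ ∧
    ∀ i j, eWall n (v i) (c i) ≠ eWall n (v j) (c j) →
      (∃ x ∈ P, x ∈ eWall n (v i) (c i) ∩ eWall n (v j) (c j)) →
      ∃ m : ℕ, 2 ≤ m ∧ edot n (v i) (v j) = -Real.cos (Real.pi / (m : ℝ))

/-- A simplex in `E^n`: a convex polyhedron with exactly `n+1` facets. -/
def eIsSimplex (n : ℕ) (P : Set (EuclideanSpace ℝ (Fin n))) : Prop :=
  eIsPoly n P ∧ {S | eIsFacet n P S}.ncard = n + 1

/-- A Coxeter decomposition of `P ⊆ E^n`. -/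
def eIsCoxDecomp (n : ℕ) (P : Set (EuclideanSpace ℝ (Fin n)))
    (𝒯 : Set (Set (EuclideanSpace ℝ (Fin n)))) : Prop :=
  𝒯.Finite ∧ 𝒯.Nonempty ∧ (∀ T ∈ 𝒯, eIsCoxPoly n T) ∧ ⋃₀ 𝒯 = P ∧
  (∀ T₁ ∈ 𝒯, ∀ T₂ ∈ 𝒯, T₁ ≠ T₂ → interior T₁ ∩ interior T₂ = ∅) ∧
  (∀ T₁ ∈ 𝒯, ∀ T₂ ∈ 𝒯, T₁ ≠ T₂ → ∀ S, eIsFacet n T₁ S → eIsFacet n T₂ S →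
    ∃ v c, edot n v v = 1 ∧ S ⊆ eWall n v c ∧ T₂ = eReflect n v c '' T₁)

/-- Mirrors of a Euclidean Coxeter decomposition. -/
def eIsMirror (n : ℕ) (P : Set (EuclideanSpace ℝ (Fin n)))
    (𝒯 : Set (Set (EuclideanSpace ℝ (Fin n))))
    (v : EuclideanSpace ℝ (Fin n)) (c : ℝ) : Prop :=
  edot n v v = 1 ∧ (∃ T ∈ 𝒯, ∃ S, eIsFacet n T S ∧ S ⊆ eWall n v c) ∧
  ¬∃ S, eIsFacet n P S ∧ S ⊆ eWall n v c

/-- Second type: every dihedral angle of `P` is fundamental. -/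
def eSecondType (n : ℕ) (P : Set (EuclideanSpace ℝ (Fin n)))
    (𝒯 : Set (Set (EuclideanSpace ℝ (Fin n)))) : Prop :=
  ∀ α β, eIsFacet n P α → eIsFacet n P β → α ≠ β → (α ∩ β).Nonempty →
    ¬∃ v c, eIsMirror n P 𝒯 v c ∧ α ∩ β ⊆ eWall n v c

/-- `P ⊆ E^n` is a Coxeter simplex with Coxeter diagram (matrix) `M`. -/
def eOfType (n : ℕ) (P : Set (EuclideanSpace ℝ (Fin n))) {k : ℕ}
    (M : Matrix (Fin k) (Fin k) ℕ) : Prop :=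
  (∀ i, M i i = 1) ∧ (∀ i j, M i j = M j i) ∧
  ∃ (e : Fin k → EuclideanSpace ℝ (Fin n)) (c : Fin k → ℝ),
    (∀ i, edot n (e i) (e i) = 1) ∧
    (∀ i j, i ≠ j → edot n (e i) (e j) = -Real.cos (Real.pi / (M i j : ℝ))) ∧
    P = ⋂ i, eHalf n (e i) (c i) ∧ (∀ i, eIsFacet n P (P ∩ eWall n (e i) (c i)))

/-! ## The particular non-compact hyperbolic Coxeter simplices occurring in the
classification, identified by the structural data given in the paper
(dimension, compactness, number and types of ideal vertices, subdiagrams of the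
Coxeter diagram, and (relative) volumes). -/

/-- The Coxeter simplex `H₃⁴ ⊂ H⁴`: non-compact, with exactly one ideal vertex,
whose horospherical link is of Euclidean type `Ã₃`; volume `≈ 0.01370778`. -/
def IsH34 {n : ℕ} (P : Set ↥(hypSet n)) : Prop :=
  n = 4 ∧ hCoxSimplex n P ∧ ¬IsCompact P ∧ (hIdealVerts n P).ncard = 1 ∧
  (∀ w ∈ hIdealVerts n P, hIdealLink n P w cmA3t) ∧
  hVol n P ∈ Set.Ioo (ENNReal.ofReal 0.0137077) (ENNReal.ofReal 0.0137078)

/-- The Coxeter simplex `H₉⁴ ⊂ H⁴`: non-compact, with exactly three ideal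
vertices, each of type `Ã₃`, of volume exactly `10` times that of `H₃⁴`. -/
def IsH94 {n : ℕ} (P : Set ↥(hypSet n)) : Prop :=
  n = 4 ∧ hCoxSimplex n P ∧ ¬IsCompact P ∧ (hIdealVerts n P).ncard = 3 ∧
  (∀ w ∈ hIdealVerts n P, hIdealLink n P w cmA3t) ∧
  ∀ F : Set ↥(hypSet n), IsH34 F → hVol n P = 10 * hVol n F

/-- The Coxeter simplex `H₄⁵ ⊂ H⁵`: non-compact, of volume `≈ 0.0010956247`. -/
def IsH45 {n : ℕ} (P : Set ↥(hypSet n)) : Prop :=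
  n = 5 ∧ hCoxSimplex n P ∧ ¬IsCompact P ∧
  hVol n P ∈ Set.Ioo (ENNReal.ofReal 0.0010956) (ENNReal.ofReal 0.0010957)

/-- The Coxeter simplex `H₅⁵ ⊂ H⁵`: non-compact, of volume `≈ 0.0018260413`,
whose Coxeter diagram contains exactly one parabolic subdiagram of type `C̃₄`
and exactly one of type `F̃₄`. -/
def IsH55 {n : ℕ} (P : Set ↥(hypSet n)) : Prop :=
  n = 5 ∧ hCoxSimplex n P ∧ ¬IsCompact P ∧
  {𝒜 | hSubOcc n P cmC4t 𝒜}.ncard = 1 ∧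
  {𝒜 | hSubOcc n P cmF4t 𝒜}.ncard = 1 ∧
  hVol n P ∈ Set.Ioo (ENNReal.ofReal 0.0018260) (ENNReal.ofReal 0.0018261)

/-- The Coxeter simplex `H₇⁵ ⊂ H⁵`: non-compact, of volume `≈ 0.0036520826`,
with three ideal vertices, whose Coxeter diagram contains no parabolic
subdiagram of type `D̃₄`. -/
def IsH75 {n : ℕ} (P : Set ↥(hypSet n)) : Prop :=
  n = 5 ∧ hCoxSimplex n P ∧ ¬IsCompact P ∧ (hIdealVerts n P).ncard = 3 ∧
  (¬∃ 𝒜, hSubOcc n P cmD4t 𝒜) ∧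
  hVol n P ∈ Set.Ioo (ENNReal.ofReal 0.0036520) (ENNReal.ofReal 0.0036521)

/-- The Coxeter simplex `H₁₁⁵ ⊂ H⁵`: non-compact, with five ideal vertices, one
of which has horospherical link of Euclidean type `D̃₄`; its volume is exactly
`20` times that of `H₄⁵` (and exactly `6` times that of `H₇⁵`). -/
def IsH115 {n : ℕ} (P : Set ↥(hypSet n)) : Prop :=
  n = 5 ∧ hCoxSimplex n P ∧ ¬IsCompact P ∧ (hIdealVerts n P).ncard = 5 ∧
  (∃ w ∈ hIdealVerts n P, hIdealLink n P w cmD4t) ∧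
  (∀ F : Set ↥(hypSet n), IsH45 F → hVol n P = 20 * hVol n F) ∧
  (∀ F : Set ↥(hypSet n), IsH75 F → hVol n P = 6 * hVol n F)

/-- The Coxeter simplex `H₁₂⁵ ⊂ H⁵`: non-compact, whose Coxeter diagram contains
exactly two parabolic subdiagrams of type `C̃₄` and exactly four of type `F̃₄`;
its volume is exactly `16` times that of `H₅⁵`. -/
def IsH125 {n : ℕ} (P : Set ↥(hypSet n)) : Prop :=
  n = 5 ∧ hCoxSimplex n P ∧ ¬IsCompact P ∧
  {𝒜 | hSubOcc n P cmC4t 𝒜}.ncard = 2 ∧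
  {𝒜 | hSubOcc n P cmF4t 𝒜}.ncard = 4 ∧
  ∀ F : Set ↥(hypSet n), IsH55 F → hVol n P = 16 * hVol n F

/-- The Coxeter simplex `H₁⁸ ⊂ H⁸`: the non-compact Coxeter simplex of minimal
volume in `H⁸`, with exactly one ideal vertex. -/
def IsH18 {n : ℕ} (P : Set ↥(hypSet n)) : Prop :=
  n = 8 ∧ hCoxSimplex n P ∧ ¬IsCompact P ∧ (hIdealVerts n P).ncard = 1 ∧
  ∀ Q : Set ↥(hypSet n), hCoxSimplex n Q → ¬IsCompact Q → hVol n P ≤ hVol n Q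

/-- The Coxeter simplex `H₄⁸ ⊂ H⁸`: non-compact, with exactly two ideal
vertices, whose Coxeter diagram contains a subdiagram of type `A₈`; its volume
is exactly `272` times that of `H₁⁸`. -/
def IsH48 {n : ℕ} (P : Set ↥(hypSet n)) : Prop :=
  n = 8 ∧ hCoxSimplex n P ∧ ¬IsCompact P ∧ (hIdealVerts n P).ncard = 2 ∧
  (∃ 𝒜, hSubOcc n P (cmA 8) 𝒜) ∧
  ∀ F : Set ↥(hypSet n), IsH18 F → hVol n P = 272 * hVol n F

/-- The Coxeter simplex `H₁⁹ ⊂ H⁹`: the non-compact Coxeter simplex of minimal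
volume in `H⁹`, with exactly one ideal vertex. -/
def IsH19 {n : ℕ} (P : Set ↥(hypSet n)) : Prop :=
  n = 9 ∧ hCoxSimplex n P ∧ ¬IsCompact P ∧ (hIdealVerts n P).ncard = 1 ∧
  ∀ Q : Set ↥(hypSet n), hCoxSimplex n Q → ¬IsCompact Q → hVol n P ≤ hVol n Q

/-- The Coxeter simplex `H₃⁹ ⊂ H⁹`: non-compact, with exactly three ideal
vertices; its volume is exactly `527` times that of `H₁⁹`. -/
def IsH39 {n : ℕ} (P : Set ↥(hypSet n)) : Prop :=
  n = 9 ∧ hCoxSimplex n P ∧ ¬IsCompact P ∧ (hIdealVerts n P).ncard = 3 ∧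
  ∀ F : Set ↥(hypSet n), IsH19 F → hVol n P = 527 * hVol n F

/-- **(Section 3.2.1 of the paper.)** Up to isometry, there exists exactly one
Coxeter decomposition of the second type of the hyperbolic simplex `H₉⁴` with
fundamental simplex `H₃⁴`; it has `N = 10` tiles, and exactly one of the three
ideal vertices of `H₉⁴` belongs to `8` tiles while each of the other two ideal
vertices belongs to exactly one tile. -/
def gsTable : List (List (List ℤ × List ℤ)) :=
  [[([1, 0, 0, 0, 0], [-8, -8, -8, -8, -4]),
    ([0, 1, 0, 0, 0], [-8, -5, -6, -7, -4]),
    ([0, 0, 1, 0, 0], [-8, -6, -4, -6, -4]),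
    ([0, 0, 0, 1, 0], [-8, -7, -6, -5, -4]),
    ([0, 0, 0, 0, 1], [-4, -4, -4, -4, 0])],
   [([], []),
    ([-1, 1, 0, 0, 0], [0, 3, 2, 1, 0]),
    ([-1, 0, 1, 0, 0], [0, 2, 4, 2, 0]),
    ([-1, 0, 0, 1, 0], [0, 1, 2, 3, 0]),
    ([-1, 0, 0, 0, 2], [0, 0, 0, 0, 4])],
   [([5, -8, 0, 0, 0], [24, 0, 8, 16, 12]),
    ([], []),
    ([0, -6, 5, 0, 0], [8, 0, 16, 12, 4]),
    ([0, -7, 0, 5, 0], [16, 0, 12, 24, 8]),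
    ([0, -4, 0, 0, 5], [12, 0, 4, 8, 16])],
   [([], []),
    ([], []),
    ([-1, -2, 3, 0, 0], [0, 0, 8, 4, 0]),
    ([-2, -1, 0, 3, 0], [0, 0, 4, 8, 0]),
    ([-1, 0, 0, 0, 2], [0, 0, 0, 0, 4])],
   [([1, 0, -2, 0, 0], [8, 4, 0, 4, 4]),
    ([0, 2, -3, 0, 0], [8, 8, 0, 4, 4]),
    ([], []),
    ([0, 0, -3, 2, 0], [8, 4, 0, 8, 4]),
    ([0, 0, -1, 0, 1], [4, 2, 0, 2, 4])],
   [([], []),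
    ([-1, 2, -1, 0, 0], [0, 4, 0, 0, 0]),
    ([], []),
    ([-1, 0, -1, 2, 0], [0, 0, 0, 4, 0]),
    ([-1, 0, 0, 0, 2], [0, 0, 0, 0, 4])],
   [([2, -2, -1, 0, 0], [8, 0, 0, 4, 4]),
    ([], []),
    ([], []),
    ([0, -2, -3, 4, 0], [8, 0, 0, 12, 4]),
    ([0, -2, -1, 0, 4], [8, 0, 0, 4, 12])],
   [([], []),
    ([], []),
    ([], []),
    ([-1, 0, -1, 2, 0], [0, 0, 0, 4, 0]),
    ([-1, 0, 0, 0, 2], [0, 0, 0, 0, 4])],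
   [([5, 0, 0, -8, 0], [24, 16, 8, 0, 12]),
    ([0, 5, 0, -7, 0], [16, 24, 12, 0, 8]),
    ([0, 0, 5, -6, 0], [8, 12, 16, 0, 4]),
    ([], []),
    ([0, 0, 0, -4, 5], [12, 8, 4, 0, 16])],
   [([], []),
    ([-2, 3, 0, -1, 0], [0, 8, 4, 0, 0]),
    ([-1, 0, 3, -2, 0], [0, 4, 8, 0, 0]),
    ([], []),
    ([-1, 0, 0, 0, 2], [0, 0, 0, 0, 4])],
   [([3, -2, 0, -2, 0], [8, 0, 0, 0, 4]),
    ([], []),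
    ([0, -1, 2, -1, 0], [0, 0, 4, 0, 0]),
    ([], []),
    ([0, -1, 0, -1, 3], [4, 0, 0, 0, 8])],
   [([], []),
    ([], []),
    ([0, -1, 2, -1, 0], [0, 0, 4, 0, 0]),
    ([], []),
    ([-1, 0, 0, 0, 2], [0, 0, 0, 0, 4])],
   [([2, 0, -1, -2, 0], [8, 4, 0, 0, 4]),
    ([0, 4, -3, -2, 0], [8, 12, 0, 0, 4]),
    ([], []),
    ([], []),
    ([0, 0, -1, -2, 4], [8, 4, 0, 0, 12])],
   [([], []),
    ([-1, 2, -1, 0, 0], [0, 4, 0, 0, 0]),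
    ([], []),
    ([], []),
    ([-1, 0, 0, 0, 2], [0, 0, 0, 0, 4])],
   [([3, -2, 0, -2, 0], [8, 0, 0, 0, 4]),
    ([], []),
    ([], []),
    ([], []),
    ([0, -1, 0, -1, 3], [4, 0, 0, 0, 8])],
   [([], []),
    ([], []),
    ([], []),
    ([], []),
    ([-1, 0, 0, 0, 2], [0, 0, 0, 0, 4])],
   [([], []),
    ([], []),
    ([], []),
    ([], []),
    ([], [])],
   [([], []),
    ([-1, 1, 0, 0, 0], [0, 3, 2, 1, 0]),
    ([-1, 0, 1, 0, 0], [0, 2, 4, 2, 0]),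
    ([-1, 0, 0, 1, 0], [0, 1, 2, 3, 0]),
    ([], [])],
   [([4, -4, 0, 0, -3], [12, 0, 4, 8, 0]),
    ([], []),
    ([0, -4, 4, 0, -1], [4, 0, 12, 8, 0]),
    ([0, -2, 0, 2, -1], [4, 0, 4, 8, 0]),
    ([], [])],
   [([], []),
    ([], []),
    ([-1, -2, 3, 0, 0], [0, 0, 8, 4, 0]),
    ([-2, -1, 0, 3, 0], [0, 0, 4, 8, 0]),
    ([], [])],
   [([1, 0, -1, 0, -1], [4, 2, 0, 2, 0]),
    ([0, 2, -2, 0, -1], [4, 6, 0, 2, 0]),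
    ([], []),
    ([0, 0, -2, 2, -1], [4, 2, 0, 6, 0]),
    ([], [])],
   [([], []),
    ([-1, 2, -1, 0, 0], [0, 4, 0, 0, 0]),
    ([], []),
    ([-1, 0, -1, 2, 0], [0, 0, 0, 4, 0]),
    ([], [])],
   [([3, -2, -1, 0, -2], [8, 0, 0, 4, 0]),
    ([], []),
    ([], []),
    ([0, -1, -2, 3, -1], [4, 0, 0, 8, 0]),
    ([], [])],
   [([], []),
    ([], []),
    ([], []),
    ([-1, 0, -1, 2, 0], [0, 0, 0, 4, 0]),
    ([], [])],
   [([4, 0, 0, -4, -3], [12, 8, 4, 0, 0]),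
    ([0, 2, 0, -2, -1], [4, 8, 4, 0, 0]),
    ([0, 0, 4, -4, -1], [4, 8, 12, 0, 0]),
    ([], []),
    ([], [])],
   [([], []),
    ([-2, 3, 0, -1, 0], [0, 8, 4, 0, 0]),
    ([-1, 0, 3, -2, 0], [0, 4, 8, 0, 0]),
    ([], []),
    ([], [])],
   [([2, -1, 0, -1, -1], [4, 0, 0, 0, 0]),
    ([], []),
    ([0, -1, 2, -1, 0], [0, 0, 4, 0, 0]),
    ([], []),
    ([], [])],
   [([], []),
    ([], []),
    ([0, -1, 2, -1, 0], [0, 0, 4, 0, 0]),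
    ([], []),
    ([], [])],
   [([3, 0, -1, -2, -2], [8, 4, 0, 0, 0]),
    ([0, 3, -2, -1, -1], [4, 8, 0, 0, 0]),
    ([], []),
    ([], []),
    ([], [])],
   [([], []),
    ([-1, 2, -1, 0, 0], [0, 4, 0, 0, 0]),
    ([], []),
    ([], []),
    ([], [])],
   [([2, -1, 0, -1, -1], [4, 0, 0, 0, 0]),
    ([], []),
    ([], []),
    ([], []),
    ([], [])],
   [([], []),
    ([], []),
    ([], []),
    ([], []),
    ([], [])]]
def sqrtTable : List (ℤ × ℤ × ℤ) :=
  [(4, 360, 360), (5, 321, 322), (8, 254, 255), (9, 240, 240), (12, 207, 208), (20, 160, 161), (24, 146, 147), (25, 144, 144), (32, 127, 128), (40, 113, 114), (48, 103, 104), (64, 90, 90), (128, 63, 64), (192, 51, 52), (240, 46, 47), (256, 45, 45), (320, 40, 41), (360, 37, 38), (384, 36, 37), (480, 32, 33), (576, 30, 30), (640, 28, 29), (768, 25, 26), (960, 23, 24), (1152, 21, 22), (1280, 20, 21), (1920, 16, 17), (2304, 15, 15), (6400, 9, 9), (9600, 7, 8), (14400, 6, 6)]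

/-! ### A certified search for simplicial cones with a prescribed Gram matrix and flag -/

/-- `idot l m` is the dot product of two integer vectors of length five. -/
def idot (l m : List ℤ) : ℤ :=
  l.getD 0 0 * m.getD 0 0 + l.getD 1 0 * m.getD 1 0 + l.getD 2 0 * m.getD 2 0 +
    l.getD 3 0 * m.getD 3 0 + l.getD 4 0 * m.getD 4 0

/-- Twice the Gram matrix of the vertices of the large simplex. -/
def formP : List (List ℤ) :=
  [[-1, -3, -2, -2, -2], [-3, -1, -2, -2, -2], [-2, -2, 0, -2, -2], [-2, -2, -2, 0, -2],
    [-2, -2, -2, -2, 0]]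

/-- Twice the Gram matrix of the vertices of the fundamental simplex. -/
def formF : List (List ℤ) :=
  [[-8, -8, -8, -8, -4], [-8, -5, -6, -7, -4], [-8, -6, -4, -6, -4], [-8, -7, -6, -5, -4],
    [-4, -4, -4, -4, 0]]

/-- The bilinear form of `formP`. -/
def formPz (x y : List ℤ) : ℤ := idot x (formP.map (idot y))

/-- The bit mask of a list of indices. -/
def maskOf : List ℕ → ℕ
  | [] => 0
  | s :: l => maskOf l + 2 ^ s

/-- For a prefix `pre` of an ordering of the vertices and a further vertex `s`, an integer
combination `φ` of these vertices orthogonal to those of `pre`, together with `formF φ`. -/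
def look (pre : List ℕ) (s : ℕ) : List ℤ × List ℤ :=
  (gsTable.getD (maskOf pre) []).getD s ([], [])

/-- Integer bounds for `720 / √m`. -/
def bounds (m : ℤ) : ℤ × ℤ :=
  ((sqrtTable.find? fun t => t.1 == m).map Prod.snd).getD (0, 720)

/-- One level of a flag: a vector `u`, its norm `d` and the values `hv` of given covectors. -/
structure Lvl where
  d : ℤ
  hv : List ℤ
  u : List ℤ

def lvlAt (lv : List Lvl) (l : ℕ) : Lvl := lv.getD l ⟨0, [], []⟩

def flagNorm (lv : List Lvl) (s : ℕ) (pre : List ℕ) : ℤ :=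
  (look pre s).1.getD s 0 * (look pre s).2.getD s 0 * (lvlAt lv pre.length).d

def sgnd (d x : ℤ) : ℤ := if 0 < d then x else -x

def upper (b : ℤ × ℤ) (t : ℤ) : ℤ := if 0 ≤ t then t * b.2 else t * b.1

/-- An upper bound for `720` times the value of the `j`-th covector at the vertex `s`. -/
def ub (lv : List Lvl) (s j : ℕ) : List ℕ → ℤ
  | [] => 0
  | t :: pre =>
    upper (bounds (flagNorm lv t pre))
      (sgnd (lvlAt lv pre.length).d ((look pre t).2.getD s 0) *
        (lvlAt lv pre.length).hv.getD j 0) + ub lv s j pre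

def kill (lv : List Lvl) (nh : ℕ) : List ℕ → Bool
  | [] => false
  | s :: pre => decide (flagNorm lv s pre ≤ 0) ||
      (List.range nh).any fun j => decide (ub lv s j (s :: pre) < 0)

/-- `720` times the `j`-th coordinate of the vertex `s`, provided `exactOK` holds. -/
def exactv (lv : List Lvl) (s j : ℕ) : List ℕ → ℤ
  | [] => 0
  | t :: pre =>
      sgnd (lvlAt lv pre.length).d ((look pre t).2.getD s 0) *
        (bounds (flagNorm lv t pre)).1 * (lvlAt lv pre.length).u.getD j 0 + exactv lv s j pre

def exactOK (lv : List Lvl) : List ℕ → Bool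
  | [] => true
  | t :: pre => decide ((bounds (flagNorm lv t pre)).1 = (bounds (flagNorm lv t pre)).2) && exactOK lv pre

def leafOK (lv : List Lvl) (L : List (List (List ℤ))) (pre : List ℕ) : Bool :=
  exactOK lv pre && L.any fun N => [[0, 1, 2, 3, 4], [0, 3, 2, 1, 4]].any fun ρ =>
    (List.range 5).all fun s => (List.range 5).all fun j =>
      decide (exactv lv s j pre = 720 * (N.getD (ρ.getD s 0) []).getD j 0)

def search (lv : List Lvl) (nh : ℕ) (L : List (List (List ℤ))) : ℕ → List ℕ → Bool
  | 0, pre => leafOK lv L pre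
  | n + 1, pre => (List.range 5).all fun s =>
      pre.contains s || kill lv nh (s :: pre) || search lv nh L n (s :: pre)

def mkLvl (H : List (List ℤ)) (u : List ℤ) : Lvl :=
  ⟨formPz u u, H.map fun h => idot h u, u⟩

/-- Every vertex ordering compatible with the flag `us` and the covectors `H` is that of one of
the matrices in `L`. -/
def flagOK (us H : List (List ℤ)) (L : List (List (List ℤ))) : Bool :=
  search (us.map (mkLvl H)) H.length L 5 []

def lexPosZ : List ℤ → Bool
  | [] => false
  | a :: l => decide (0 < a) || (decide (a = 0) && lexPosZ l)

/-- The flag `us` is orthogonal, of the right signature, lies in the positive orthant, and each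
of its faces is cut out by one of the covectors `H`. -/
def flagValid (us H : List (List ℤ)) : Bool :=
  ((List.range 5).all fun i => (List.range 5).all fun j =>
    if i = j then
      (if i = 0 then decide (formPz (us.getD i []) (us.getD j []) < 0)
        else decide (0 < formPz (us.getD i []) (us.getD j [])))
    else decide (formPz (us.getD i []) (us.getD j []) = 0)) &&
  ((List.range 5).all fun j => lexPosZ ((List.range 5).map fun i => (us.getD i []).getD j 0)) &&
  ((List.range 5).all fun i => decide (i = 0) || H.any fun h =>
    decide (0 < idot h (us.getD i [])) &&
      (List.range i).all fun l => decide (idot h (us.getD l []) = 0)) &&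
  decide (us.length = 5)

/-- The table entry for `pre` and `s` has the required properties. -/
def entryOK (pre : List ℕ) (s : ℕ) : Bool :=
  decide (0 < (look pre s).1.getD s 0) &&
  ((List.range 5).all fun j => decide ((look pre s).1.getD j 0 = 0) || decide (j = s) ||
    pre.contains j) &&
  (pre.all fun j => decide ((look pre s).2.getD j 0 = 0)) &&
  ((List.range 5).all fun j =>
    decide ((look pre s).2.getD j 0 = idot (formF.getD j []) (look pre s).1))

def validTree : ℕ → List ℕ → Bool
  | 0, _ => true
  | n + 1, pre => (List.range 5).all fun s => pre.contains s ||
      (decide (pre = []) && decide (s = 4)) || (entryOK pre s && validTree n (s :: pre))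

set_option maxRecDepth 100000 in
theorem validTree_five : validTree 5 [] = true := by decide +kernel

theorem sqrtTable_bounds (m : ℤ) (hm : 0 < m) :
    0 ≤ (bounds m).1 ∧ 0 ≤ (bounds m).2 ∧ (bounds m).1 ^ 2 * m ≤ 720 ^ 2 ∧
      720 ^ 2 ≤ (bounds m).2 ^ 2 * m := by
  unfold bounds
  cases h : sqrtTable.find? fun t => t.1 == m with
  | none => simp; omega
  | some t =>
    have h1 := List.mem_of_find?_eq_some h
    have h2 : t.1 = m := by simpa using List.find?_some h
    have h3 : ∀ t ∈ sqrtTable, 0 ≤ t.2.1 ∧ 0 ≤ t.2.2 ∧ t.2.1 ^ 2 * t.1 ≤ 720 ^ 2 ∧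
      720 ^ 2 ≤ t.2.2 ^ 2 * t.1 := by decide +kernel
    simpa [h2] using h3 t h1

/-- The reversed list of the first `l` values of `σ`. -/
def preOf (σ : ℕ → ℕ) : ℕ → List ℕ
  | 0 => []
  | l + 1 => σ l :: preOf σ l

@[simp] theorem preOf_length (σ : ℕ → ℕ) (l : ℕ) : (preOf σ l).length = l := by
  induction l with
  | zero => rfl
  | succ l ih => simp [preOf, ih]

theorem mem_preOf {σ : ℕ → ℕ} {l j : ℕ} : j ∈ preOf σ l ↔ ∃ r < l, σ r = j := by
  induction l with
  | zero => simp [preOf]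
  | succ l ih =>
    simp only [preOf, List.mem_cons, ih]
    constructor
    · rintro (h | ⟨r, h1, h2⟩)
      · exact ⟨l, by omega, h.symm⟩
      · exact ⟨r, by omega, h2⟩
    · rintro ⟨r, h1, h2⟩
      rcases Nat.lt_succ_iff_lt_or_eq.1 h1 with h | h
      · exact Or.inr ⟨r, h, h2⟩
      · exact Or.inl (by rw [← h2, h])

theorem entryOK_of_tree {σ : ℕ → ℕ} (h5 : ∀ l < 5, σ l < 5)
    (hinj : ∀ l < 5, ∀ r < l, σ r ≠ σ l) (h4 : σ 0 ≠ 4) :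
    ∀ n l, l + n = 5 → validTree n (preOf σ l) = true →
      ∀ i, l ≤ i → i < 5 → entryOK (preOf σ i) (σ i) = true := by
  intro n
  induction n with
  | zero => intro l hl _ i h1 h2; omega
  | succ n ih =>
    intro l hl hv i h1 h2
    have h := List.all_eq_true.1 hv (σ l) (by simp [h5 l (by omega)])
    have hc : (preOf σ l).contains (σ l) = false := by
      rw [← Bool.not_eq_true, List.contains_iff_mem, mem_preOf]
      rintro ⟨r, hr, hr'⟩
      exact hinj l (by omega) r hr hr'
    have hd : (decide (preOf σ l = []) && decide (σ l = 4)) = false := by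
      cases l with
      | zero => simp [preOf, h4]
      | succ l => simp [preOf]
    rw [hc, hd, Bool.false_or, Bool.false_or, Bool.and_eq_true] at h
    rcases Nat.eq_or_lt_of_le h1 with rfl | h1
    · exact h.1
    · exact ih (l + 1) (by omega) h.2 i h1 h2

theorem leaf_of_search {lv : List Lvl} {nh : ℕ} {L : List (List (List ℤ))} {σ : ℕ → ℕ}
    (h5 : ∀ l < 5, σ l < 5) (hinj : ∀ l < 5, ∀ r < l, σ r ≠ σ l)
    (hk : ∀ l < 5, kill lv nh (preOf σ (l + 1)) = false) :
    ∀ n l, l + n = 5 → search lv nh L n (preOf σ l) = true →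
      leafOK lv L (preOf σ 5) = true := by
  intro n
  induction n with
  | zero => intro l hl hv; obtain rfl : l = 5 := by omega
            exact hv
  | succ n ih =>
    intro l hl hv
    have h := List.all_eq_true.1 hv (σ l) (by simp [h5 l (by omega)])
    have hc : (preOf σ l).contains (σ l) = false := by
      rw [← Bool.not_eq_true, List.contains_iff_mem, mem_preOf]
      rintro ⟨r, hr, hr'⟩
      exact hinj l (by omega) r hr hr'
    have hk' := hk l (by omega)
    rw [preOf] at hk'
    rw [hc, hk', Bool.false_or, Bool.false_or] at h
    exact ih (l + 1) (by omega) h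

section Search

variable {lv : List Lvl} {σ : ℕ → ℕ} {Q : ℕ → ℕ → ℝ} {α : ℕ → ℝ}

theorem bounds_mul {m : ℤ} {a : ℝ} (ha : 0 < a) (ham : a ^ 2 * m = 1) :
    ((bounds m).1 : ℝ) ≤ 720 * a ∧ 720 * a ≤ ((bounds m).2 : ℝ) := by
  have hm : (0 : ℝ) < m := by
    by_contra! h
    nlinarith [sq_nonneg a, mul_nonneg (sq_nonneg a) (neg_nonneg.2 h)]
  obtain ⟨h1, h2, h3, h4⟩ := sqrtTable_bounds m (by exact_mod_cast hm)
  have h1' : (0 : ℝ) ≤ ((bounds m).1 : ℝ) := by exact_mod_cast h1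
  have h2' : (0 : ℝ) ≤ ((bounds m).2 : ℝ) := by exact_mod_cast h2
  have h3' : ((bounds m).1 : ℝ) ^ 2 * m ≤ 720 ^ 2 := by exact_mod_cast h3
  have h4' : (720 : ℝ) ^ 2 ≤ ((bounds m).2 : ℝ) ^ 2 * m := by exact_mod_cast h4
  have h5 : ((720 : ℝ) * a) ^ 2 * m = 720 ^ 2 := by rw [mul_pow, mul_assoc, ham, mul_one]
  constructor
  · refine abs_le_of_sq_le_sq' (le_of_mul_le_mul_right ?_ hm) (by positivity) |>.2
    rw [h5]; exact h3'
  · refine abs_le_of_sq_le_sq' (le_of_mul_le_mul_right ?_ hm) h2' |>.2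
    rw [h5]; exact h4'

theorem ub_ge (hα : ∀ l < 5, 0 < α l)
    (hm : ∀ l < 5, α l ^ 2 * flagNorm lv (σ l) (preOf σ l) = 1)
    (hQ : ∀ l < 5, ∀ j < 5, Q j l =
      (sgnd (lvlAt lv l).d ((look (preOf σ l) (σ l)).2.getD j 0) : ℤ) * α l)
    {s : ℕ} (hs : s < 5) (j : ℕ) : ∀ l ≤ 5,
      720 * ∑ r ∈ Finset.range l, Q s r * ((lvlAt lv r).hv.getD j 0 : ℤ) ≤
        ub lv s j (preOf σ l) := by
  intro l
  induction l with
  | zero => intro _; simp [preOf, ub]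
  | succ l ih =>
    intro hl
    have ih := ih (by omega)
    rw [Finset.sum_range_succ, mul_add, preOf, ub, preOf_length]
    push_cast
    have hb := bounds_mul (hα l (by omega)) (hm l (by omega))
    rw [add_comm]
    refine add_le_add ?_ ih
    rw [hQ l (by omega) s hs]
    generalize (sgnd (lvlAt lv l).d ((look (preOf σ l) (σ l)).2.getD s 0)) = x at *
    generalize (lvlAt lv l).hv.getD j 0 = y at *
    have e : 720 * ((x : ℝ) * α l * (y : ℝ)) = ((x * y : ℤ) : ℝ) * (720 * α l) := by
      push_cast; ring
    rw [e]
    unfold upper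
    split_ifs with h
    · push_cast [Int.cast_mul]
      have : (0 : ℝ) ≤ (x : ℝ) * y := by exact_mod_cast h
      exact mul_le_mul_of_nonneg_left hb.2 this
    · push_cast
      have : (x : ℝ) * y ≤ 0 := by
        have : x * y ≤ 0 := by omega
        exact_mod_cast this
      exact mul_le_mul_of_nonpos_left hb.1 this

theorem exactv_eq (hα : ∀ l < 5, 0 < α l)
    (hm : ∀ l < 5, α l ^ 2 * flagNorm lv (σ l) (preOf σ l) = 1)
    (hQ : ∀ l < 5, ∀ j < 5, Q j l =
      (sgnd (lvlAt lv l).d ((look (preOf σ l) (σ l)).2.getD j 0) : ℤ) * α l)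
    {s : ℕ} (hs : s < 5) (j : ℕ) : ∀ l ≤ 5, exactOK lv (preOf σ l) = true →
      720 * ∑ r ∈ Finset.range l, Q s r * ((lvlAt lv r).u.getD j 0 : ℤ) =
        exactv lv s j (preOf σ l) := by
  intro l
  induction l with
  | zero => intro _ _; simp [preOf, exactv]
  | succ l ih =>
    intro hl he
    rw [preOf, exactOK, Bool.and_eq_true, decide_eq_true_eq] at he
    have ih := ih (by omega) he.2
    rw [Finset.sum_range_succ, mul_add, preOf, exactv, preOf_length, ih]
    push_cast
    have hb := bounds_mul (hα l (by omega)) (hm l (by omega))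
    rw [← he.1] at hb
    have hb : ((bounds (flagNorm lv (σ l) (preOf σ l))).1 : ℝ) = 720 * α l := le_antisymm hb.1 hb.2
    rw [hb, hQ l (by omega) s hs]
    ring

end Search

/-! ### Flags -/

section Flags

open Filter Topology Matrix

/-- The first nonzero entry exists and is positive. -/
def LexPos (c : Fin 5 → ℝ) : Prop := ∃ m, (∀ i < m, c i = 0) ∧ 0 < c m

theorem LexPos.eventually {c : Fin 5 → ℝ} (h : LexPos c) :
    ∀ᶠ ε : ℝ in 𝓝[>] 0, 0 < ∑ i : Fin 5, ε ^ (i : ℕ) * c i := by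
  obtain ⟨m, h0, hm⟩ := h
  have hc : Continuous fun ε : ℝ => ∑ i : Fin 5, ε ^ ((i : ℕ) - (m : ℕ)) * c i := by fun_prop
  have ht := hc.tendsto 0
  have hv : ∑ i : Fin 5, (0 : ℝ) ^ ((i : ℕ) - (m : ℕ)) * c i = c m := by
    rw [Finset.sum_eq_single m]
    · simp
    · intro i _ hi
      rcases lt_or_gt_of_ne hi with h | h
      · simp [h0 i h]
      · have : (i : ℕ) - m ≠ 0 := by have : (m : ℕ) < i := h; omega
        simp [this]
    · simp
  rw [hv] at ht
  have h1 := (ht.eventually (lt_mem_nhds hm)).filter_mono (nhdsWithin_le_nhds (s := Ioi 0))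
  filter_upwards [h1, self_mem_nhdsWithin] with ε h1 h2
  have h2 : 0 < ε := h2
  have : ∑ i : Fin 5, ε ^ (i : ℕ) * c i =
      ε ^ (m : ℕ) * ∑ i : Fin 5, ε ^ ((i : ℕ) - (m : ℕ)) * c i := by
    rw [Finset.mul_sum]
    refine Finset.sum_congr rfl fun i _ => ?_
    rcases lt_or_ge i m with h | h
    · simp [h0 i h]
    · have : (m : ℕ) ≤ i := h
      rw [← mul_assoc, ← pow_add, Nat.add_sub_cancel' this]
  rw [this]
  positivity

theorem lexPos_trichotomy (c : Fin 5 → ℝ) : c = 0 ∨ LexPos c ∨ LexPos (-c) := by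
  by_cases h : c = 0
  · exact Or.inl h
  · have hne : (Finset.univ.filter fun i => c i ≠ 0).Nonempty := by
      obtain ⟨i, hi⟩ := Function.ne_iff.1 h
      exact ⟨i, by simpa using hi⟩
    have h1 := Finset.min'_mem _ hne
    set m := Finset.min' _ hne with hm
    have h2 : ∀ i < m, c i = 0 := by
      intro i hi
      by_contra hc
      exact absurd (Finset.min'_le _ i (by simpa using hc)) (not_le.2 hi)
    have h3 : c m ≠ 0 := by simpa using h1
    rcases lt_or_gt_of_ne h3 with h | h
    · exact Or.inr (Or.inr ⟨m, fun i hi => by simp [h2 i hi], by simpa using h⟩)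
    · exact Or.inr (Or.inl ⟨m, h2, h⟩)

theorem lexPos_of_frequently {c : Fin 5 → ℝ} (hc : c ≠ 0)
    (h : ∃ᶠ ε : ℝ in 𝓝[>] 0, 0 ≤ ∑ i : Fin 5, ε ^ (i : ℕ) * c i) : LexPos c := by
  rcases lexPos_trichotomy c with h0 | h0 | h0
  · exact absurd h0 hc
  · exact h0
  · exfalso
    refine h (h0.eventually.mono fun ε h1 => ?_)
    simp only [Pi.neg_apply, mul_neg, Finset.sum_neg_distrib] at h1
    linarith

/-- The point with parameter `ε` of the curve through the flag `U`. -/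
def germ (U : Matrix (Fin 5) (Fin 5) ℝ) (ε : ℝ) : Fin 5 → ℝ := (fun i : Fin 5 => ε ^ (i : ℕ)) ᵥ* U

theorem germ_apply (U : Matrix (Fin 5) (Fin 5) ℝ) (ε : ℝ) (j : Fin 5) :
    germ U ε j = ∑ i : Fin 5, ε ^ (i : ℕ) * U i j := rfl

/-- The closed cone spanned by the rows of `M`. -/
def coneC (M : Matrix (Fin 5) (Fin 5) ℝ) : Set (Fin 5 → ℝ) := {x | ∃ a, (∀ i, 0 ≤ a i) ∧ x = a ᵥ* M}

/-- The relatively open cone spanned by the rows of `M`. -/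
def coneI (M : Matrix (Fin 5) (Fin 5) ℝ) : Set (Fin 5 → ℝ) := {x | ∃ a, (∀ i, 0 < a i) ∧ x = a ᵥ* M}

/-- If the flag `U` lies in the cone of `M`, then up to order the rows of `M` are adapted
to the flag. -/
theorem exists_adapted_order {U M : Matrix (Fin 5) (Fin 5) ℝ} (hU : IsUnit U.det)
    (hM : IsUnit M.det) (hf : ∃ᶠ ε in 𝓝[>] (0 : ℝ), germ U ε ∈ coneC M)
    (hH : ∀ i : Fin 5, i ≠ 0 → ∃ h : Fin 5 → ℝ, (∀ j, 0 ≤ h ⬝ᵥ M j) ∧ 0 < h ⬝ᵥ U i ∧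
      ∀ l < i, h ⬝ᵥ U l = 0) :
    ∃ σ : Fin 5 → Fin 5, Function.Injective σ ∧
      ∀ l, 0 < (M * U⁻¹) (σ l) l ∧ ∀ r, l < r → (M * U⁻¹) (σ l) r = 0 := by
  set P := U * M⁻¹ with hP
  set Q := M * U⁻¹ with hQ
  have hPQ : P * Q = 1 := by
    rw [hP, hQ, Matrix.mul_assoc, ← Matrix.mul_assoc M⁻¹, Matrix.nonsing_inv_mul _ hM,
      Matrix.one_mul, Matrix.mul_nonsing_inv _ hU]
  have hUP : U = P * M := by
    rw [hP, Matrix.mul_assoc, Matrix.nonsing_inv_mul _ hM, Matrix.mul_one]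
  have hMQ : M = Q * U := by
    rw [hQ, Matrix.mul_assoc, Matrix.nonsing_inv_mul _ hU, Matrix.mul_one]
  have hlex : ∀ j, LexPos fun l => P l j := by
    intro j
    refine lexPos_of_frequently ?_ (hf.mono ?_)
    · intro h0
      have h1 : IsUnit P := IsUnit.of_mul_eq_one _ hPQ
      have h2 : (Matrix.det P) = 0 := Matrix.det_eq_zero_of_column_eq_zero j (fun i => congrFun h0 i)
      rw [Matrix.isUnit_iff_isUnit_det, h2] at h1
      simp at h1
    · rintro ε ⟨a, ha, hx⟩
      have : (fun i : Fin 5 => ε ^ (i : ℕ)) ᵥ* P = a := by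
        rw [hP, ← Matrix.vecMul_vecMul]
        have : (fun i : Fin 5 => ε ^ (i : ℕ)) ᵥ* U = a ᵥ* M := hx
        rw [this, Matrix.vecMul_vecMul, Matrix.mul_nonsing_inv _ hM, Matrix.vecMul_one]
      exact (ha j).trans_eq (congrFun this j).symm
  choose ν hν0' hνp' using hlex
  have hν0 : ∀ j i, i < ν j → P i j = 0 := hν0'
  have hνp : ∀ j, 0 < P (ν j) j := hνp'
  have key : ∀ i : Fin 5, i ≠ 0 → ∃ h : Fin 5 → ℝ, (∀ j, 0 ≤ h ⬝ᵥ M j) ∧ 0 < h ⬝ᵥ U i ∧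
      (∀ l < i, h ⬝ᵥ U l = 0) ∧ ∀ j, ν j < i → h ⬝ᵥ M j = 0 := by
    intro i hi
    obtain ⟨h, h1, h2, h3⟩ := hH i hi
    refine ⟨h, h1, h2, h3, ?_⟩
    have hsum : ∀ l, h ⬝ᵥ U l = ∑ j, P l j * (h ⬝ᵥ M j) := by
      intro l
      have : U l = fun c => ∑ j, P l j * M j c := by
        funext c
        rw [hUP, Matrix.mul_apply]
      rw [this]
      simp only [dotProduct, Finset.mul_sum]
      rw [Finset.sum_comm]
      refine Finset.sum_congr rfl fun _ _ => Finset.sum_congr rfl fun _ _ => by ring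
    have : ∀ n : ℕ, ∀ j, (ν j : ℕ) = n → ν j < i → h ⬝ᵥ M j = 0 := by
      intro n
      induction n using Nat.strong_induction_on with
      | _ n ih =>
        intro j hj hji
        have h4 := hsum (ν j)
        rw [h3 _ hji] at h4
        have h5 := (Finset.sum_eq_zero_iff_of_nonneg (fun j' _ => ?_)).1 h4.symm j (Finset.mem_univ _)
        · exact (mul_eq_zero.1 h5).resolve_left (hνp j).ne'
        · rcases lt_trichotomy (ν j') (ν j) with h6 | h6 | h6
          · rw [ih (ν j') (hj ▸ h6) j' rfl (h6.trans hji), mul_zero]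
          · rw [← h6]; exact mul_nonneg (hνp j').le (h1 j')
          · rw [hν0 j' _ h6, zero_mul]
    exact fun j hj => this _ j rfl hj
  have htri : ∀ j, ∀ n : ℕ, ∀ l : Fin 5, 4 - (l : ℕ) = n → ν j < l → Q j l = 0 := by
    intro j n
    induction n using Nat.strong_induction_on with
    | _ n ih =>
      intro l hl hjl
      obtain ⟨h, -, h2, h3, h4⟩ := key l (by intro h; rw [h] at hjl; exact absurd hjl (Fin.not_lt_zero _))
      have h5 : h ⬝ᵥ M j = ∑ c, Q j c * (h ⬝ᵥ U c) := by
        have : M j = fun c => ∑ i, Q j i * U i c := by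
          funext c
          conv_lhs => rw [hMQ]
          rw [Matrix.mul_apply]
        rw [this]
        simp only [dotProduct, Finset.mul_sum]
        rw [Finset.sum_comm]
        refine Finset.sum_congr rfl fun _ _ => Finset.sum_congr rfl fun _ _ => by ring
      rw [h4 j hjl, Finset.sum_eq_single l] at h5
      · exact (mul_eq_zero.1 h5.symm).resolve_right h2.ne'
      · intro c _ hc
        rcases lt_or_gt_of_ne hc with h6 | h6
        · rw [h3 c h6, mul_zero]
        · have : (l : ℕ) < c := h6
          rw [ih (4 - c) (by omega) c rfl (hjl.trans h6), zero_mul]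
      · simp
  have hsurj : ∀ l, ∃ j, ν j = l ∧ 0 < Q j l := by
    intro l
    have h1 : ∑ j, P l j * Q j l = 1 := by
      rw [← Matrix.mul_apply, hPQ, Matrix.one_apply_eq]
    obtain ⟨j, -, hj⟩ := Finset.exists_lt_of_sum_lt (s := Finset.univ) (f := fun _ : Fin 5 => (0 : ℝ))
      (g := fun j => P l j * Q j l) (by simp [h1])
    have hP0 : P l j ≠ 0 := fun h => by simp [h] at hj
    have hQ0 : Q j l ≠ 0 := fun h => by simp [h] at hj
    have h2 : ν j = l := by
      refine le_antisymm (not_lt.1 fun h => hP0 (hν0 j l h)) (not_lt.1 fun h => hQ0 (htri j _ l rfl h))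
    refine ⟨j, h2, ?_⟩
    have := hνp j
    rw [h2] at this
    exact pos_of_mul_pos_right hj this.le
  choose σ hσ1 hσ2 using hsurj
  refine ⟨σ, fun a b hab => by rw [← hσ1 a, hab, hσ1], fun l => ⟨hσ2 l, fun r hr => ?_⟩⟩
  exact htri _ _ r rfl (by rw [hσ1]; exact hr)

end Flags

section FlagSearch

open Filter Topology Matrix

/-- The real vector with the given integer coordinates. -/
def vec (l : List ℤ) : Fin 5 → ℝ := fun j => (l.getD j 0 : ℤ)

/-- The real matrix with the given integer rows. -/
def mat (us : List (List ℤ)) : Matrix (Fin 5) (Fin 5) ℝ := Matrix.of fun i => vec (us.getD i [])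

theorem mat_apply (us : List (List ℤ)) (i j : Fin 5) :
    mat us i j = ((us.getD i []).getD j 0 : ℤ) := rfl

theorem mat_row (us : List (List ℤ)) (i : Fin 5) : mat us i = vec (us.getD i []) := rfl

theorem vec_dotProduct (x y : List ℤ) : vec x ⬝ᵥ vec y = (idot x y : ℤ) := by
  simp [dotProduct, Fin.sum_univ_five, vec, idot]

theorem mat_formP_mulVec (y : List ℤ) : mat formP *ᵥ vec y = vec (formP.map (idot y)) := by
  funext i
  fin_cases i <;>
  simp [Matrix.mulVec, dotProduct, Fin.sum_univ_five, vec, mat_apply, idot, formP] <;> ring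

theorem vec_formP_vec (x y : List ℤ) :
    vec x ⬝ᵥ (mat formP *ᵥ vec y) = (formPz x y : ℤ) := by
  rw [mat_formP_mulVec, vec_dotProduct, formPz]

theorem mat_formP_conj (us : List (List ℤ)) (i j : Fin 5) :
    (mat us * mat formP * (mat us)ᵀ) i j = (formPz (us.getD i []) (us.getD j []) : ℤ) := by
  rw [← vec_formP_vec, Matrix.mul_assoc, Matrix.mul_apply, dotProduct]
  rfl

theorem mat_formF_mulVec (φ : List ℤ) (i : Fin 5) :
    (mat formF *ᵥ vec φ) i = (idot (formF.getD i []) φ : ℤ) := by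
  rw [← vec_dotProduct]; rfl

theorem lexPosZ_spec : ∀ l : List ℤ, lexPosZ l = true →
    ∃ m : ℕ, m < l.length ∧ (∀ i < m, l.getD i 0 = 0) ∧ 0 < l.getD m 0
  | [], h => by simp [lexPosZ] at h
  | a :: l, h => by
    simp only [lexPosZ, Bool.or_eq_true, Bool.and_eq_true, decide_eq_true_eq] at h
    rcases h with h | ⟨h, h'⟩
    · exact ⟨0, by simp, by simp, by simpa using h⟩
    · obtain ⟨m, h1, h2, h3⟩ := lexPosZ_spec l h'
      refine ⟨m + 1, by simpa using h1, fun i hi => ?_, by simpa using h3⟩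
      cases i with
      | zero => simpa using h
      | succ i => simpa using h2 i (by omega)

theorem lexPos_of_lexPosZ {c : Fin 5 → ℝ} {f : ℕ → ℤ} (hc : ∀ i : Fin 5, c i = f i)
    (h : lexPosZ ((List.range 5).map f) = true) : LexPos c := by
  obtain ⟨m, h1, h2, h3⟩ := lexPosZ_spec _ h
  have h1 : m < 5 := by simpa using h1
  have hg : ∀ i < 5, ((List.range 5).map f).getD i 0 = f i := by
    intro i hi
    simp [List.getD, hi]
  refine ⟨⟨m, h1⟩, fun i hi => ?_, ?_⟩
  · have := h2 i hi
    rw [hg _ i.2] at this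
    rw [hc, this]; simp
  · rw [hg _ h1] at h3
    rw [hc]
    exact_mod_cast h3

theorem flagValid_spec {us H : List (List ℤ)} (h : flagValid us H = true) :
    (∀ i j : Fin 5, i ≠ j → formPz (us.getD i []) (us.getD j []) = 0) ∧
    formPz (us.getD 0 []) (us.getD 0 []) < 0 ∧
    (∀ i : Fin 5, i ≠ 0 → 0 < formPz (us.getD i []) (us.getD i [])) ∧
    (∀ j, LexPos fun i => mat us i j) ∧
    (∀ i : Fin 5, i ≠ 0 → ∃ h ∈ H, 0 < idot h (us.getD i []) ∧
      ∀ l < i, idot h (us.getD l []) = 0) ∧ us.length = 5 := by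
  simp only [flagValid, Bool.and_eq_true, List.all_eq_true, List.mem_range, decide_eq_true_eq,
    Bool.or_eq_true, List.any_eq_true] at h
  obtain ⟨⟨⟨h1, h2⟩, h3⟩, h4⟩ := h
  refine ⟨fun i j hij => ?_, ?_, fun i hi => ?_, fun j => ?_, fun i hi => ?_, h4⟩
  · have := h1 i i.2 j j.2
    rw [if_neg (by simpa [Fin.ext_iff] using hij)] at this
    simpa only [decide_eq_true_eq] using this
  · have := h1 0 (by norm_num) 0 (by norm_num)
    rw [if_pos rfl, if_pos rfl] at this
    simpa only [decide_eq_true_eq] using this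
  · have := h1 i i.2 i i.2
    rw [if_pos rfl, if_neg (fun h : (i : ℕ) = 0 => hi (Fin.ext h))] at this
    simpa only [decide_eq_true_eq] using this
  · exact lexPos_of_lexPosZ (fun i => rfl) (h2 j j.2)
  · rcases h3 i i.2 with h | ⟨h, hh, h5, h6⟩
    · exact absurd (Fin.ext h) hi
    · exact ⟨h, hh, h5, fun l hl => h6 l hl⟩

theorem isUnit_det_of_conj_diagonal {U K : Matrix (Fin 5) (Fin 5) ℝ} {d : Fin 5 → ℝ}
    (hd : ∀ i, d i ≠ 0) (h : U * K * Uᵀ = Matrix.diagonal d) : IsUnit U.det := by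
  have h1 := congrArg Matrix.det h
  rw [Matrix.det_mul, Matrix.det_mul, Matrix.det_diagonal] at h1
  rw [isUnit_iff_ne_zero]
  intro h0
  rw [h0, zero_mul, zero_mul] at h1
  exact Finset.prod_ne_zero_iff.2 (fun i _ => hd i) h1.symm

/-- The entries of a triangular factor of `K` are determined by orthogonal combinations. -/
theorem triangular_factor {Q K : Matrix (Fin 5) (Fin 5) ℝ} {d : Fin 5 → ℝ} (hd : ∀ i, d i ≠ 0)
    (hK : Q * Matrix.diagonal d * Qᵀ = K) {σ : Fin 5 → Fin 5}
    (hσ : ∀ l, 0 < Q (σ l) l ∧ ∀ r, l < r → Q (σ l) r = 0) (l : Fin 5) {φ : Fin 5 → ℝ}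
    (hφ : 0 < φ (σ l)) (hsupp : ∀ j, φ j ≠ 0 → ∃ r ≤ l, σ r = j)
    (horth : ∀ r < l, (K *ᵥ φ) (σ r) = 0) :
    ∃ μ, 0 < μ ∧ (∀ j, (K *ᵥ φ) j = Q j l * (d l * μ)) ∧
      μ ^ 2 * d l = φ (σ l) * (K *ᵥ φ) (σ l) := by
  set F : Fin 5 → ℝ := φ ᵥ* Q with hF
  have hKF : ∀ j, (K *ᵥ φ) j = ∑ r, Q j r * d r * F r := by
    intro j
    have : K *ᵥ φ = (Q * Matrix.diagonal d) *ᵥ F := by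
      rw [← hK, ← Matrix.mulVec_mulVec, Matrix.mulVec_transpose]
    rw [this]
    simp [Matrix.mulVec, dotProduct, Matrix.mul_diagonal]
  have hFl : ∀ r, F r = ∑ j, φ j * Q j r := fun r => rfl
  have h1 : ∀ r, l < r → F r = 0 := by
    intro r hr
    rw [hFl]
    refine Finset.sum_eq_zero fun j _ => ?_
    by_cases hj : φ j = 0
    · simp [hj]
    · obtain ⟨r', hr', rfl⟩ := hsupp j hj
      rw [(hσ r').2 r (lt_of_le_of_lt hr' hr), mul_zero]
  have h2 : F l = φ (σ l) * Q (σ l) l := by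
    rw [hFl, Finset.sum_eq_single (σ l)]
    · intro j _ hj
      by_cases hj0 : φ j = 0
      · simp [hj0]
      · obtain ⟨r', hr', rfl⟩ := hsupp j hj0
        have : r' ≠ l := fun h => hj (by rw [h])
        rw [(hσ r').2 l (lt_of_le_of_ne hr' this), mul_zero]
    · simp
  have h3 : ∀ n : ℕ, ∀ i : Fin 5, (i : ℕ) = n → i < l → F i = 0 := by
    intro n
    induction n using Nat.strong_induction_on with
    | _ n ih =>
      intro i hi hil
      have h4 := horth i hil
      rw [hKF, Finset.sum_eq_single i] at h4
      · exact (mul_eq_zero.1 h4).resolve_left (mul_ne_zero (hσ i).1.ne' (hd i))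
      · intro r _ hr
        rcases lt_or_gt_of_ne hr with h | h
        · rw [ih r (hi ▸ h) r rfl (h.trans hil), mul_zero]
        · rw [(hσ i).2 r h]; ring
      · simp
  have h4 : ∀ j, (K *ᵥ φ) j = Q j l * (d l * F l) := by
    intro j
    rw [hKF, Finset.sum_eq_single l]
    · ring
    · intro r _ hr
      rcases lt_or_gt_of_ne hr with h | h
      · rw [h3 r r rfl h, mul_zero]
      · rw [h1 r h, mul_zero]
    · simp
  refine ⟨F l, by rw [h2]; exact mul_pos hφ (hσ l).1, h4, ?_⟩
  rw [h4, h2]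
  ring

/-- A matrix with Gram matrix `formF` on which the covectors `H` are nonnegative and whose cone
contains the flag `us` is one of those found by the search. -/
theorem tile_of_flag {us H : List (List ℤ)} {L : List (List (List ℤ))}
    (hv : flagValid us H = true) (hs : flagOK us H L = true)
    {M : Matrix (Fin 5) (Fin 5) ℝ} (hM : M * mat formP * Mᵀ = mat formF) (hMu : IsUnit M.det)
    (hH : ∀ h ∈ H, ∀ j, 0 ≤ vec h ⬝ᵥ M j)
    (hf : ∃ᶠ ε in 𝓝[>] (0 : ℝ), germ (mat us) ε ∈ coneC M) :
    ∃ N ∈ L, ∃ ρ ∈ [[0, 1, 2, 3, 4], [0, 3, 2, 1, 4]], ∀ s j : Fin 5,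
      M s j = ((N.getD (ρ.getD s 0) []).getD j 0 : ℤ) := by
  obtain ⟨h1, h2, h3, h4, h5, h6⟩ := flagValid_spec hv
  set U := mat us with hU
  set d : Fin 5 → ℝ := fun i => (formPz (us.getD i []) (us.getD i []) : ℤ) with hd
  have hd0 : d 0 < 0 := by simp only [hd]; exact_mod_cast h2
  have hdp : ∀ i, i ≠ 0 → 0 < d i := fun i hi => by simp only [hd]; exact_mod_cast h3 i hi
  have hdn : ∀ i, d i ≠ 0 := fun i => by
    by_cases hi : i = 0
    · rw [hi]; exact hd0.ne
    · exact (hdp i hi).ne'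
  have hUD : U * mat formP * Uᵀ = Matrix.diagonal d := by
    ext i j
    rw [mat_formP_conj]
    by_cases hij : i = j
    · rw [hij, Matrix.diagonal_apply_eq]
    · rw [Matrix.diagonal_apply_ne _ hij, h1 i j hij]; simp
  have hUu : IsUnit U.det := isUnit_det_of_conj_diagonal hdn hUD
  obtain ⟨σ, hinj, hσ⟩ := exists_adapted_order hUu hMu hf (by
    intro i hi
    obtain ⟨h, hh, h7, h8⟩ := h5 i hi
    refine ⟨vec h, hH h hh, ?_, fun l hl => ?_⟩
    · rw [hU, mat_row, vec_dotProduct]; exact_mod_cast h7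
    · rw [hU, mat_row, vec_dotProduct, h8 l hl]; simp)
  set Q := M * U⁻¹ with hQ
  have hMQ : M = Q * U := by
    rw [hQ, Matrix.mul_assoc, Matrix.nonsing_inv_mul _ hUu, Matrix.mul_one]
  clear_value Q
  have hK : Q * Matrix.diagonal d * Qᵀ = mat formF := by
    rw [← hUD, ← hM, hMQ, Matrix.transpose_mul Q U]
    simp only [Matrix.mul_assoc]
  set σn : ℕ → ℕ := fun l => (σ (Fin.ofNat 5 l) : ℕ) with hσn
  have hof : ∀ l : Fin 5, Fin.ofNat 5 (l : ℕ) = l := by decide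
  have hσv : ∀ l : Fin 5, σn l = σ l := fun l => by simp only [hσn, hof]
  have hσ5 : ∀ l < 5, σn l < 5 := fun l _ => (σ _).2
  have hcast : ∀ l : ℕ, l < 5 → ∃ l' : Fin 5, (l' : ℕ) = l := fun l hl => ⟨⟨l, hl⟩, rfl⟩
  have hσi : ∀ l < 5, ∀ r < l, σn r ≠ σn l := by
    intro l hl r hr h
    obtain ⟨l, rfl⟩ := hcast l hl
    obtain ⟨r, rfl⟩ := hcast r (by omega)
    rw [hσv, hσv] at h
    have := hinj (Fin.ext h)
    rw [this] at hr
    exact lt_irrefl _ hr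
  have h04 : σn 0 ≠ 4 := by
    intro h
    have h7 : σ 0 = 4 := Fin.ext (by rw [← hσv 0]; exact h)
    have h8 := congrFun (congrFun hK 4) 4
    rw [Matrix.mul_apply, Finset.sum_eq_single 0] at h8
    · have h9 := (hσ 0).1
      rw [h7] at h9
      have : (mat formF) 4 4 = 0 := by simp [mat_apply, formF]
      rw [this, Matrix.mul_diagonal, Matrix.transpose_apply] at h8
      exact (mul_ne_zero (mul_ne_zero h9.ne' hd0.ne) h9.ne') h8
    · intro r _ hr
      have := (hσ 0).2 r (Fin.pos_of_ne_zero hr)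
      rw [h7] at this
      rw [Matrix.mul_diagonal, this]; ring
    · simp
  have hent := entryOK_of_tree hσ5 hσi h04 5 0 rfl validTree_five
  set lv := us.map (mkLvl H) with hlv
  have hlvl : ∀ l : Fin 5, lvlAt lv l = mkLvl H (us.getD l []) := by
    intro l
    have : (l : ℕ) < us.length := by rw [h6]; exact l.2
    simp [lvlAt, hlv, List.getD, this]
  have hdl : ∀ l : Fin 5, ((lvlAt lv l).d : ℝ) = d l := fun l => by rw [hlvl]; rfl
  -- the entries of `Q`
  have hα : ∀ l : Fin 5, ∃ a : ℝ, 0 < a ∧ a ^ 2 * flagNorm lv (σn l) (preOf σn l) = 1 ∧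
      ∀ j : Fin 5, Q j l =
        (sgnd (lvlAt lv l).d ((look (preOf σn l) (σn l)).2.getD j 0) : ℤ) * a := by
    intro l
    have he := hent l (Nat.zero_le _) l.2
    simp only [entryOK, Bool.and_eq_true, List.all_eq_true, List.mem_range, decide_eq_true_eq,
      Bool.or_eq_true, List.contains_iff_mem, mem_preOf] at he
    obtain ⟨⟨⟨e1, e2⟩, e3⟩, e4⟩ := he
    set φ := (look (preOf σn l) (σn l)).1 with hφ
    set g := (look (preOf σn l) (σn l)).2 with hg
    have hgv : ∀ j : Fin 5, (mat formF *ᵥ vec φ) j = (g.getD j 0 : ℤ) := by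
      intro j
      rw [mat_formF_mulVec, e4 j j.2]
    obtain ⟨μ, hμ, m1, m2⟩ := triangular_factor (φ := vec φ) hdn hK hσ l
      (by rw [hσv] at e1; simp only [vec]; exact_mod_cast e1)
      (by
        intro j hj
        rcases e2 j j.2 with (h | h) | ⟨r, hr, h⟩
        · exact absurd (by simp only [vec, h, Int.cast_zero]) hj
        · rw [hσv] at h
          exact ⟨l, le_rfl, (Fin.ext h).symm⟩
        · obtain ⟨r, rfl⟩ := hcast r (by omega)
          rw [hσv] at h
          exact ⟨r, le_of_lt hr, Fin.ext h⟩)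
      (by
        intro r hr
        rw [hgv, ← hσv, e3 (σn r) ⟨r, hr, rfl⟩]; simp)
    have hμd : 0 < μ * |d l| := mul_pos hμ (abs_pos.2 (hdn l))
    refine ⟨(μ * |d l|)⁻¹, inv_pos.2 hμd, ?_, ?_⟩
    · have : ((flagNorm lv (σn l) (preOf σn l) : ℤ) : ℝ) = (μ * |d l|) ^ 2 := by
        rw [flagNorm, preOf_length]
        push_cast
        rw [mul_pow, sq_abs, hdl, ← hφ, ← hg]
        have h7 : ((φ.getD (σn l) 0 : ℤ) : ℝ) = vec φ (σ l) := by rw [hσv]; rfl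
        have h8 : ((g.getD (σn l) 0 : ℤ) : ℝ) = (mat formF *ᵥ vec φ) (σ l) := by rw [hσv, hgv]
        rw [h7, h8, ← m2]
        ring
      rw [this, inv_pow, inv_mul_cancel₀ (by positivity)]
    · intro j
      have h7 := m1 j
      rw [hgv] at h7
      have h8 : ((sgnd (lvlAt lv l).d (g.getD j 0) : ℤ) : ℝ) = Q j l * (μ * |d l|) := by
        unfold sgnd
        have h9 := hdl l
        split_ifs with h
        · have : 0 < d l := by rw [← h9]; exact_mod_cast h
          rw [abs_of_pos this, h7]; ring
        · have : d l ≤ 0 := by rw [← h9]; exact_mod_cast not_lt.1 h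
          rw [abs_of_nonpos this]; push_cast; rw [h7]; ring
      rw [h8, mul_assoc, mul_inv_cancel₀ hμd.ne', mul_one]
  choose α hα0 hαm hαQ using hα
  set αn : ℕ → ℝ := fun l => α (Fin.ofNat 5 l) with hαn
  set Qn : ℕ → ℕ → ℝ := fun j l => Q (Fin.ofNat 5 j) (Fin.ofNat 5 l) with hQn
  have hαv : ∀ l : Fin 5, αn l = α l := fun l => by simp only [hαn, hof]
  have hQv : ∀ j l : Fin 5, Qn j l = Q j l := fun j l => by simp only [hQn, hof]
  have A0 : ∀ l < 5, 0 < αn l := fun l _ => hα0 _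
  have A1 : ∀ l < 5, αn l ^ 2 * flagNorm lv (σn l) (preOf σn l) = 1 := by
    intro l hl
    obtain ⟨l, rfl⟩ := hcast l hl
    rw [hαv]; exact hαm l
  have A2 : ∀ l < 5, ∀ j < 5, Qn j l =
      (sgnd (lvlAt lv l).d ((look (preOf σn l) (σn l)).2.getD j 0) : ℤ) * αn l := by
    intro l hl j hj
    obtain ⟨l, rfl⟩ := hcast l hl
    obtain ⟨j, rfl⟩ := hcast j hj
    rw [hαv, hQv]; exact hαQ l j
  have hMe : ∀ (s : Fin 5) (c : Fin 5 → ℝ),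
      c ⬝ᵥ M s = ∑ r ∈ Finset.range 5, Qn s r * (c ⬝ᵥ U (Fin.ofNat 5 r)) := by
    intro s c
    rw [Finset.sum_range]
    have : M s = fun j => ∑ i, Q s i * U i j := by
      funext j
      conv_lhs => rw [hMQ]
      rw [Matrix.mul_apply]
    rw [this]
    simp only [dotProduct, Finset.mul_sum]
    rw [Finset.sum_comm]
    refine Finset.sum_congr rfl fun _ _ => Finset.sum_congr rfl fun _ _ => ?_
    rw [hQv, hof]
    ring
  have hkill : ∀ l < 5, kill lv H.length (preOf σn (l + 1)) = false := by
    intro l hl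
    rw [← Bool.not_eq_true]
    intro h
    simp only [preOf, kill, Bool.or_eq_true, decide_eq_true_eq, List.any_eq_true,
      List.mem_range] at h
    rcases h with h | ⟨j, hj, h⟩
    · have h7 := A1 l hl
      have h8 : ((flagNorm lv (σn l) (preOf σn l) : ℤ) : ℝ) ≤ 0 := by exact_mod_cast h
      nlinarith [sq_nonneg (αn l), mul_nonneg (sq_nonneg (αn l)) (neg_nonneg.2 h8)]
    · have h7 := ub_ge A0 A1 A2 (hσ5 l hl) j (l + 1) (by omega)
      rw [preOf] at h7
      have h8 : ((ub lv (σn l) j (σn l :: preOf σn l) : ℤ) : ℝ) < 0 := by exact_mod_cast h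
      obtain ⟨l, rfl⟩ := hcast l hl
      have h9 := hH H[j] (List.getElem_mem hj) (σ l)
      rw [hMe] at h9
      have hsub : Finset.range (l + 1) ⊆ Finset.range 5 :=
        Finset.range_subset_range.2 (by omega)
      rw [← Finset.sum_subset hsub] at h9
      · refine absurd (h9.trans_eq (Finset.sum_congr rfl fun r hr => ?_)) (not_le.2 (by linarith :
          ∑ r ∈ Finset.range (l + 1), Qn (σn l) r * (((lvlAt lv r).hv.getD j 0 : ℤ) : ℝ) < 0))
        have hr5 : r < 5 := by have := Finset.mem_range.1 hr; omega
        obtain ⟨r, rfl⟩ := hcast r hr5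
        rw [hσv, hlvl, hof, hU, mat_row, vec_dotProduct]
        simp [mkLvl, List.getD, hj]
      · intro r hr hr'
        obtain ⟨r, rfl⟩ := hcast r (Finset.mem_range.1 hr)
        have : l < r := by
          rw [Finset.mem_range] at hr'
          exact Fin.lt_def.2 (by omega)
        rw [hQv, (hσ l).2 r this, zero_mul]
  have hleaf := leaf_of_search hσ5 hσi hkill 5 0 rfl hs
  simp only [leafOK, Bool.and_eq_true, List.any_eq_true, List.all_eq_true, List.mem_range,
    decide_eq_true_eq] at hleaf
  obtain ⟨hex, N, hN, ρ, hρ, hval⟩ := hleaf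
  refine ⟨N, hN, ρ, hρ, fun s j => ?_⟩
  have h7 := exactv_eq A0 A1 A2 s.2 j 5 le_rfl hex
  rw [hval s s.2 j j.2] at h7
  have h8 := hMe s (Pi.single j 1)
  rw [single_dotProduct, one_mul] at h8
  rw [h8]
  push_cast at h7
  refine mul_left_cancel₀ (by norm_num : (720 : ℝ) ≠ 0) (Eq.trans ?_ h7)
  congr 1
  refine Finset.sum_congr rfl fun r hr => ?_
  obtain ⟨r, rfl⟩ := hcast r (Finset.mem_range.1 hr)
  rw [single_dotProduct, one_mul, hlvl, hof, hU, mat_apply]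
  rfl

end FlagSearch

/-! ### Tilings of the cone over the large simplex -/

section Tilings

open Filter Topology Matrix

/-- A family of simplicial cones with Gram matrix `formF` that tiles the positive orthant. -/
structure Tiling {ι : Type*} (M : ι → Matrix (Fin 5) (Fin 5) ℝ) : Prop where
  gram : ∀ t, M t * mat formP * (M t)ᵀ = mat formF
  nonneg : ∀ t i j, 0 ≤ M t i j
  cover : ∀ x : Fin 5 → ℝ, (∀ j, 0 ≤ x j) → x ⬝ᵥ (mat formP *ᵥ x) < 0 → ∃ t, x ∈ coneC (M t)
  disj : ∀ t t', t ≠ t' → Disjoint (coneI (M t)) (coneI (M t'))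

/-- The cone spanned by `N` is one of the cones of the family. -/
def Occurs {ι : Type*} (M : ι → Matrix (Fin 5) (Fin 5) ℝ) (N : List (List ℤ)) : Prop :=
  ∃ t, ∃ ρ : Equiv.Perm (Fin 5), M t = (mat N).submatrix ρ id

theorem vecMul_submatrix_equiv (A : Matrix (Fin 5) (Fin 5) ℝ) (ρ : Equiv.Perm (Fin 5))
    (a : Fin 5 → ℝ) : a ᵥ* A.submatrix ρ id = (a ∘ ρ.symm) ᵥ* A := by
  funext j
  simp only [Matrix.vecMul, dotProduct, Matrix.submatrix_apply, id, Function.comp]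
  exact (Equiv.sum_comp ρ fun i => a (ρ.symm i) * A i j).symm.trans
    (Finset.sum_congr rfl fun i _ => by rw [Equiv.symm_apply_apply]) |>.symm

theorem coneC_submatrix (A : Matrix (Fin 5) (Fin 5) ℝ) (ρ : Equiv.Perm (Fin 5)) :
    coneC (A.submatrix ρ id) = coneC A := by
  ext x
  constructor
  · rintro ⟨a, ha, rfl⟩
    exact ⟨a ∘ ρ.symm, fun i => ha _, vecMul_submatrix_equiv A ρ a⟩
  · rintro ⟨a, ha, rfl⟩
    refine ⟨a ∘ ρ, fun i => ha _, ?_⟩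
    rw [vecMul_submatrix_equiv]
    congr 1
    funext i
    simp

/-- Four times the inverse of `formF`. -/
def invF : List (List ℤ) :=
  [[2, -1, 0, -1, -1], [-1, 2, -1, 0, 0], [0, -1, 2, -1, 0], [-1, 0, -1, 2, 0], [-1, 0, 0, 0, 2]]

theorem invF_mul_formF : mat invF * mat formF = (4 : ℝ) • (1 : Matrix (Fin 5) (Fin 5) ℝ) := by
  ext i j
  fin_cases i <;> fin_cases j <;>
    simp [Matrix.mul_apply, Fin.sum_univ_five, mat_apply, invF, formF] <;> norm_num

theorem isUnit_det_of_gram {M : Matrix (Fin 5) (Fin 5) ℝ}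
    (h : M * mat formP * Mᵀ = mat formF) : IsUnit M.det := by
  have h1 := congrArg Matrix.det invF_mul_formF
  rw [← h, Matrix.det_mul, Matrix.det_mul, Matrix.det_mul, Matrix.det_smul, Matrix.det_one] at h1
  rw [isUnit_iff_ne_zero]
  intro h0
  rw [h0] at h1
  norm_num at h1

theorem coneI_open {M : Matrix (Fin 5) (Fin 5) ℝ} (hM : IsUnit M.det) {y : Fin 5 → ℝ}
    (hy : y ∈ coneI M) (b : Fin 5 → ℝ) : ∀ᶠ δ in 𝓝[>] (0 : ℝ), y + δ • b ∈ coneI M := by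
  obtain ⟨a, ha, rfl⟩ := hy
  have h1 : ∀ i, ∀ᶠ δ in 𝓝[>] (0 : ℝ), 0 < a i + δ * (b ᵥ* M⁻¹) i := by
    intro i
    have hc : Continuous fun δ : ℝ => a i + δ * (b ᵥ* M⁻¹) i := by fun_prop
    have ht := hc.tendsto 0
    simp only [zero_mul, add_zero] at ht
    exact (ht.eventually (lt_mem_nhds (ha i))).filter_mono nhdsWithin_le_nhds
  filter_upwards [Filter.eventually_all.2 h1] with δ hδ
  refine ⟨fun i => a i + δ * (b ᵥ* M⁻¹) i, hδ, ?_⟩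
  have : (fun i => a i + δ * (b ᵥ* M⁻¹) i) = a + δ • (b ᵥ* M⁻¹) := rfl
  rw [this, Matrix.add_vecMul, Matrix.smul_vecMul, Matrix.vecMul_vecMul,
    Matrix.nonsing_inv_mul _ hM, Matrix.vecMul_one]

theorem coneC_add_coneI {M : Matrix (Fin 5) (Fin 5) ℝ} {x b : Fin 5 → ℝ} (hx : x ∈ coneC M)
    (hb : b ∈ coneI M) {δ : ℝ} (hδ : 0 < δ) : x + δ • b ∈ coneI M := by
  obtain ⟨a, ha, rfl⟩ := hx
  obtain ⟨b, hb, rfl⟩ := hb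
  refine ⟨a + δ • b, fun i => ?_, ?_⟩
  · have h1 := ha i
    have h2 := hb i
    have : 0 < a i + δ * b i := by positivity
    exact this
  · rw [Matrix.add_vecMul, Matrix.smul_vecMul]

theorem sum_rows_mem_coneI (M : Matrix (Fin 5) (Fin 5) ℝ) : (1 : Fin 5 → ℝ) ᵥ* M ∈ coneI M :=
  ⟨1, fun _ => one_pos, rfl⟩

theorem row_mem_coneC (M : Matrix (Fin 5) (Fin 5) ℝ) (i : Fin 5) : M i ∈ coneC M := by
  refine ⟨Pi.single i 1, fun j => ?_, ?_⟩
  · by_cases h : j = i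
    · subst h; simp
    · simp [h]
  · rw [Matrix.single_one_vecMul]; rfl

variable {ι : Type*} {M : ι → Matrix (Fin 5) (Fin 5) ℝ}

theorem Tiling.isUnit (hT : Tiling M) (t : ι) : IsUnit (M t).det := isUnit_det_of_gram (hT.gram t)

theorem Tiling.meet (hT : Tiling M) {t t' : ι} {y : Fin 5 → ℝ} (h : y ∈ coneI (M t))
    (h' : y ∈ coneC (M t')) : t = t' := by
  by_contra hne
  obtain ⟨δ, h1, h2⟩ := ((coneI_open (hT.isUnit t) h (1 ᵥ* M t')).and self_mem_nhdsWithin).exists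
  exact (Set.disjoint_left.1 (hT.disj t t' hne)) h1
    (coneC_add_coneI h' (sum_rows_mem_coneI _) h2)

theorem Tiling.exists_frequently [Finite ι] (hT : Tiling M) {us H : List (List ℤ)}
    (hv : flagValid us H = true) :
    ∃ t, ∃ᶠ ε in 𝓝[>] (0 : ℝ), germ (mat us) ε ∈ coneC (M t) := by
  obtain ⟨-, h2, -, h4, -⟩ := flagValid_spec hv
  by_contra hcon
  push Not at hcon
  have h5 : ∀ᶠ ε in 𝓝[>] (0 : ℝ), ∀ t, germ (mat us) ε ∉ coneC (M t) :=
    Filter.eventually_all.2 hcon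
  have h6 : ∀ᶠ ε in 𝓝[>] (0 : ℝ), ∀ j, 0 < germ (mat us) ε j :=
    Filter.eventually_all.2 fun j => (h4 j).eventually
  have h7 : ∀ᶠ ε in 𝓝[>] (0 : ℝ), germ (mat us) ε ⬝ᵥ (mat formP *ᵥ germ (mat us) ε) < 0 := by
    have hc : Continuous fun ε : ℝ => germ (mat us) ε ⬝ᵥ (mat formP *ᵥ germ (mat us) ε) := by
      simp only [germ, Matrix.mulVec, Matrix.vecMul, dotProduct]
      fun_prop
    have ht := hc.tendsto 0
    have h0 : germ (mat us) 0 = vec (us.getD 0 []) := by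
      funext j
      rw [germ_apply, Finset.sum_eq_single 0]
      · simp [mat_apply, vec]
      · intro i _ hi
        have : (i : ℕ) ≠ 0 := fun h => hi (Fin.ext h)
        simp [this]
      · simp
    rw [h0, vec_formP_vec] at ht
    exact (ht.eventually (gt_mem_nhds (by exact_mod_cast h2))).filter_mono nhdsWithin_le_nhds
  obtain ⟨ε, a1, a2, a3⟩ := (h5.and (h6.and h7)).exists
  obtain ⟨t, ht⟩ := hT.cover _ (fun j => (a2 j).le) a3
  exact a1 t ht

/-- The covectors vanishing on the facets of the cone over `M`. -/
theorem walls_mul {M : Matrix (Fin 5) (Fin 5) ℝ} (h : M * mat formP * Mᵀ = mat formF) :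
    M * (mat invF * M * mat formP)ᵀ = (4 : ℝ) • (1 : Matrix (Fin 5) (Fin 5) ℝ) := by
  have h1 : (mat invF * M * mat formP) * Mᵀ = (4 : ℝ) • (1 : Matrix (Fin 5) (Fin 5) ℝ) := by
    rw [← invF_mul_formF, ← h]
    simp only [Matrix.mul_assoc]
  have h2 := congrArg Matrix.transpose h1
  rwa [Matrix.transpose_mul, Matrix.transpose_transpose, Matrix.transpose_smul,
    Matrix.transpose_one] at h2

/-- Four times the facet covectors of a cone with integral generators. -/
def wallsZ (N : List (List ℤ)) : List (List ℤ) :=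
  invF.map fun g => formP.map fun p =>
    idot p ((List.range 5).map fun j => idot g ((List.range 5).map fun i => (N.getD i []).getD j 0))

theorem mat_wallsZ (N : List (List ℤ)) : mat (wallsZ N) = mat invF * mat N * mat formP := by
  have hs : (mat formP)ᵀ = mat formP := by
    ext i j
    fin_cases i <;> fin_cases j <;> simp [mat_apply, formP]
  have hi : ∀ (g : List ℤ) (j : Fin 5),
      ((idot g ((List.range 5).map fun i => (N.getD i []).getD j 0) : ℤ) : ℝ) =
        (vec g ᵥ* mat N) j := by
    intro g j
    simp [idot, Matrix.vecMul, dotProduct, Fin.sum_univ_five, vec, mat_apply]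
  ext i k
  have h1 : mat (wallsZ N) i k = ((mat formP) *ᵥ (vec (invF.getD i []) ᵥ* mat N)) k := by
    have : (wallsZ N).getD i [] = formP.map fun p => idot p ((List.range 5).map fun j =>
        idot (invF.getD i []) ((List.range 5).map fun i => (N.getD i []).getD j 0)) := by
      fin_cases i <;> rfl
    rw [mat_apply, this]
    have h2 : ∀ v : List ℤ, (((formP.map fun p => idot p v).getD k 0 : ℤ) : ℝ) =
        (mat formP *ᵥ vec v) k := by
      intro v
      have : ((formP.map fun p => idot p v).getD k 0) = idot (formP.getD k []) v := by
        fin_cases k <;> rfl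
      rw [this, ← vec_dotProduct]; rfl
    rw [h2]
    congr 1
    funext j
    rw [← hi]
    fin_cases j <;> rfl
  rw [h1, Matrix.mul_apply_eq_vecMul, Matrix.mul_apply_eq_vecMul]
  conv_lhs => rw [← hs, Matrix.mulVec_transpose]
  rfl

end Tilings

section Walls

open Filter Topology Matrix

theorem mem_coneC_iff {M : Matrix (Fin 5) (Fin 5) ℝ} (h : M * mat formP * Mᵀ = mat formF)
    (x : Fin 5 → ℝ) : x ∈ coneC M ↔ ∀ i, 0 ≤ (mat invF * M * mat formP) i ⬝ᵥ x := by
  have h1 := walls_mul h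
  set W := mat invF * M * mat formP
  have h2 : Wᵀ * M = (4 : ℝ) • (1 : Matrix (Fin 5) (Fin 5) ℝ) := by
    have h3 : M * ((1 / 4 : ℝ) • Wᵀ) = 1 := by rw [Matrix.mul_smul, h1, smul_smul]; norm_num
    have h4 := mul_eq_one_comm.1 h3
    rw [Matrix.smul_mul] at h4
    rw [← h4, smul_smul]; norm_num
  constructor
  · rintro ⟨a, ha, rfl⟩ i
    have : W i ⬝ᵥ (a ᵥ* M) = 4 * a i := by
      have : W i ⬝ᵥ (a ᵥ* M) = ((a ᵥ* M) ᵥ* Wᵀ) i := by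
        rw [Matrix.vecMul_transpose]; rfl
      rw [this, Matrix.vecMul_vecMul, h1]
      simp [Matrix.vecMul_smul]
    rw [this]
    have := ha i
    positivity
  · intro hx
    refine ⟨fun i => (1 / 4) * (W i ⬝ᵥ x), fun i => mul_nonneg (by norm_num) (hx i), ?_⟩
    have : (fun i => (1 / 4) * (W i ⬝ᵥ x)) = (1 / 4 : ℝ) • (x ᵥ* Wᵀ) := by
      rw [Matrix.vecMul_transpose]; rfl
    rw [this, Matrix.smul_vecMul, Matrix.vecMul_vecMul, h2]
    simp [Matrix.vecMul_smul, smul_smul]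

/-- The integral matrix `N` has Gram matrix `formF`. -/
def gramOK (N : List (List ℤ)) : Bool :=
  (List.range 5).all fun i => (List.range 5).all fun j =>
    decide (formPz (N.getD i []) (N.getD j []) = (formF.getD i []).getD j 0)

theorem gramOK_spec {N : List (List ℤ)} (h : gramOK N = true) :
    mat N * mat formP * (mat N)ᵀ = mat formF := by
  simp only [gramOK, List.all_eq_true, List.mem_range, decide_eq_true_eq] at h
  ext i j
  rw [mat_formP_conj, h i i.2 j j.2]
  rfl

/-- The covector `c` is nonpositive on the cone over `N` and positive along the flag `us`. -/
def outsideOK (N us : List (List ℤ)) (c : List ℤ) : Bool :=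
  ((List.range 5).all fun k => decide (idot c (N.getD k []) ≤ 0)) &&
  lexPosZ ((List.range 5).map fun l => idot c (us.getD l []))

theorem dotProduct_germ (c : Fin 5 → ℝ) (U : Matrix (Fin 5) (Fin 5) ℝ) (ε : ℝ) :
    c ⬝ᵥ germ U ε = ∑ l : Fin 5, ε ^ (l : ℕ) * (c ⬝ᵥ U l) := by
  simp only [dotProduct, germ_apply, Finset.mul_sum]
  rw [Finset.sum_comm]
  exact Finset.sum_congr rfl fun _ _ => Finset.sum_congr rfl fun _ _ => by ring

theorem eventually_notMem_coneC {N us : List (List ℤ)} {c : List ℤ}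
    (h : outsideOK N us c = true) :
    ∀ᶠ ε in 𝓝[>] (0 : ℝ), germ (mat us) ε ∉ coneC (mat N) := by
  simp only [outsideOK, Bool.and_eq_true, List.all_eq_true, List.mem_range,
    decide_eq_true_eq] at h
  obtain ⟨h1, h2⟩ := h
  have h3 : LexPos fun l => vec c ⬝ᵥ mat us l :=
    lexPos_of_lexPosZ (fun l => by rw [mat_row, vec_dotProduct]) h2
  filter_upwards [h3.eventually] with ε hε
  rintro ⟨a, ha, hx⟩
  rw [← dotProduct_germ, hx] at hε
  have : vec c ⬝ᵥ (a ᵥ* mat N) = ∑ k, a k * (vec c ⬝ᵥ mat N k) := by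
    simp only [dotProduct, Matrix.vecMul, Finset.mul_sum]
    rw [Finset.sum_comm]
    exact Finset.sum_congr rfl fun _ _ => Finset.sum_congr rfl fun _ _ => by ring
  rw [this] at hε
  refine absurd hε (not_lt.2 (Finset.sum_nonpos fun k _ => ?_))
  refine mul_nonpos_of_nonneg_of_nonpos (ha k) ?_
  rw [mat_row, vec_dotProduct]
  exact_mod_cast h1 k k.2

variable {ι : Type*} {M : ι → Matrix (Fin 5) (Fin 5) ℝ}

theorem exists_interior_neg (A : Matrix (Fin 5) (Fin 5) ℝ) (c : Fin 5 → ℝ) {i : Fin 5}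
    (h : c ⬝ᵥ A i < 0) : ∃ y ∈ coneI A, c ⬝ᵥ y < 0 := by
  have hc : Continuous fun δ : ℝ => c ⬝ᵥ (A i + δ • (1 ᵥ* A)) := by
    simp only [dotProduct_add, dotProduct_smul]
    fun_prop
  have ht := hc.tendsto 0
  simp only [zero_smul, add_zero] at ht
  obtain ⟨δ, h1, h2⟩ := (((ht.eventually (gt_mem_nhds h)).filter_mono
    (nhdsWithin_le_nhds (s := Ioi 0))).and self_mem_nhdsWithin).exists
  exact ⟨_, coneC_add_coneI (row_mem_coneC A i) (sum_rows_mem_coneI A) h2, h1⟩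

/-- If a known tile contains the part of the positive orthant cut off by `c`, then the tile
containing a flag on the other side lies entirely on that side. -/
theorem Tiling.nonneg_of_cutoff (hT : Tiling M) {N us : List (List ℤ)} {c : List ℤ}
    (hN : Occurs M N) (hsub : ∀ x : Fin 5 → ℝ, (∀ j, 0 ≤ x j) → vec c ⬝ᵥ x < 0 → x ∈ coneC (mat N))
    (hout : outsideOK N us c = true) (t : ι)
    (hf : ∃ᶠ ε in 𝓝[>] (0 : ℝ), germ (mat us) ε ∈ coneC (M t)) (i : Fin 5) :
    0 ≤ vec c ⬝ᵥ M t i := by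
  obtain ⟨t₀, ρ, h₀⟩ := hN
  have hC : coneC (M t₀) = coneC (mat N) := by rw [h₀, coneC_submatrix]
  by_contra hlt
  obtain ⟨y, hy, hy'⟩ := exists_interior_neg _ _ (not_le.1 hlt)
  have h1 : ∀ j, 0 ≤ y j := by
    obtain ⟨a, ha, rfl⟩ := hy
    intro j
    show 0 ≤ ∑ k, a k * M t k j
    exact Finset.sum_nonneg fun k _ => mul_nonneg (ha k).le (hT.nonneg t k j)
  have h2 : t = t₀ := hT.meet hy (hC ▸ hsub y h1 hy')
  obtain ⟨ε, h3, h4⟩ := (hf.and_eventually (eventually_notMem_coneC hout)).exists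
  exact h4 (hC ▸ h2 ▸ h3)

/-- The flag `us` leaves the cone over `N` through the wall `i₀` (with outward covector `c`)
at its step `j`, staying in the relative interior of that wall before. -/
def crossOK (N us : List (List ℤ)) (c : List ℤ) (i₀ j : ℕ) (q : ℤ) : Bool :=
  gramOK N && outsideOK N us c && decide (0 < q) &&
  decide ((wallsZ N).getD i₀ [] = c.map fun x => -(q * x)) &&
  ((List.range j).all fun l => decide (idot c (us.getD l []) = 0)) &&
  ((List.range 5).all fun i => decide (i = i₀) || (List.range j).any fun m =>
    decide (0 < idot ((wallsZ N).getD i []) (us.getD m [])) &&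
      (List.range m).all fun l => decide (idot ((wallsZ N).getD i []) (us.getD l []) = 0))

/-- A tile containing a flag which leaves a known tile through a wall lies on the other side
of this wall. -/
theorem Tiling.nonneg_of_cross (hT : Tiling M) {N us : List (List ℤ)} {c : List ℤ} {i₀ j : Fin 5}
    {q : ℤ} (hN : Occurs M N) (hc : crossOK N us c i₀ j q = true) (t : ι)
    (hf : ∃ᶠ ε in 𝓝[>] (0 : ℝ), germ (mat us) ε ∈ coneC (M t)) (i : Fin 5) :
    0 ≤ vec c ⬝ᵥ M t i := by
  simp only [crossOK, Bool.and_eq_true, List.all_eq_true, List.mem_range, decide_eq_true_eq,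
    Bool.or_eq_true, List.any_eq_true] at hc
  obtain ⟨⟨⟨⟨⟨h1, h2⟩, h3⟩, h4⟩, h5⟩, h6⟩ := hc
  obtain ⟨t₀, ρ, h₀⟩ := hN
  have hC : coneC (M t₀) = coneC (mat N) := by rw [h₀, coneC_submatrix]
  by_contra hlt
  obtain ⟨x, hx, hx'⟩ := exists_interior_neg _ _ (not_le.1 hlt)
  set U := mat us with hU
  obtain ⟨C, hC0, hC1⟩ : ∃ C : ℝ, 0 < C ∧ vec c ⬝ᵥ (U j + C • x) < 0 := by
    refine ⟨(|vec c ⬝ᵥ U j| + 1) / (-(vec c ⬝ᵥ x)), by have := neg_pos.2 hx'; positivity, ?_⟩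
    rw [dotProduct_add, dotProduct_smul, smul_eq_mul]
    have : (|vec c ⬝ᵥ U j| + 1) / (-(vec c ⬝ᵥ x)) * (vec c ⬝ᵥ x) = -(|vec c ⬝ᵥ U j| + 1) := by
      have hne := hx'.ne
      field_simp
    rw [this]
    linarith [le_abs_self (vec c ⬝ᵥ U j)]
  set U' := Matrix.updateRow U j (U j + C • x) with hU'
  have hne : ∀ l, l < j → U' l = vec (us.getD l []) := fun l hl => by
    rw [hU', Matrix.updateRow_ne (ne_of_lt hl)]; rfl
  have hw : ∀ v, vec ((wallsZ N).getD i₀ []) ⬝ᵥ v = -(q * (vec c ⬝ᵥ v)) := by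
    intro v
    rw [h4]
    have : (vec (c.map fun x => -(q * x))) = (-(q : ℝ)) • vec c := by
      funext n
      simp only [vec, Pi.smul_apply, smul_eq_mul]
      rw [List.getD_eq_getElem?_getD, List.getD_eq_getElem?_getD, List.getElem?_map]
      generalize getElem? c (n : ℕ) = o
      cases o <;> simp
    rw [this, smul_dotProduct, smul_eq_mul, neg_mul]
  have hlex : ∀ k : Fin 5, LexPos fun l => vec ((wallsZ N).getD k []) ⬝ᵥ U' l := by
    intro k
    rcases h6 k k.2 with h | ⟨m, hm, h7, h8⟩
    · have : k = i₀ := Fin.ext h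
      subst this
      refine ⟨j, fun l hl => ?_, ?_⟩
      · show vec ((wallsZ N).getD k []) ⬝ᵥ U' l = 0
        rw [hw, hne l hl, vec_dotProduct, h5 l hl]; simp
      · have hq : (0 : ℝ) < q := by exact_mod_cast h3
        have : U' j = U j + C • x := by rw [hU', Matrix.updateRow_self]
        show 0 < vec ((wallsZ N).getD k []) ⬝ᵥ U' j
        rw [hw, this]
        nlinarith
    · have hm5 : m < 5 := hm.trans j.2
      refine ⟨⟨m, hm5⟩, fun l hl => ?_, ?_⟩
      · show vec ((wallsZ N).getD k []) ⬝ᵥ U' l = 0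
        rw [hne l (lt_trans hl hm), vec_dotProduct, h8 l hl]; simp
      · show 0 < vec ((wallsZ N).getD k []) ⬝ᵥ U' ⟨m, hm5⟩
        rw [hne ⟨m, hm5⟩ hm, vec_dotProduct]
        exact_mod_cast h7
  have hgerm : ∀ ε, germ U' ε = germ U ε + (ε ^ (j : ℕ) * C) • x := by
    intro ε
    funext n
    simp only [germ_apply, Pi.add_apply, Pi.smul_apply, smul_eq_mul]
    rw [← Finset.add_sum_erase _ _ (Finset.mem_univ j),
      ← Finset.add_sum_erase _ (fun i : Fin 5 => ε ^ (i : ℕ) * U i n) (Finset.mem_univ j)]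
    have : ∑ i ∈ Finset.univ.erase j, ε ^ (i : ℕ) * U' i n =
        ∑ i ∈ Finset.univ.erase j, ε ^ (i : ℕ) * U i n :=
      Finset.sum_congr rfl fun i hi => by rw [hU', Matrix.updateRow_ne (Finset.ne_of_mem_erase hi)]
    rw [this, hU', Matrix.updateRow_self]
    simp only [Pi.add_apply, Pi.smul_apply, smul_eq_mul]
    ring
  have hev : ∀ᶠ ε in 𝓝[>] (0 : ℝ), germ U' ε ∈ coneC (mat N) := by
    filter_upwards [Filter.eventually_all.2 fun k => (hlex k).eventually] with ε hε
    rw [mem_coneC_iff (gramOK_spec h1), ← mat_wallsZ]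
    intro k
    rw [dotProduct_germ]
    exact (hε k).le
  obtain ⟨ε, ⟨⟨h7, h8⟩, h9⟩, h10⟩ := (((hf.and_eventually
    (eventually_notMem_coneC h2)).and_eventually hev).and_eventually self_mem_nhdsWithin).exists
  have h10 : 0 < ε := h10
  have h11 : germ U' ε ∈ coneI (M t) := by
    rw [hgerm]
    exact coneC_add_coneI h7 hx (by positivity)
  have h12 : t = t₀ := hT.meet h11 (hC ▸ h9)
  exact h8 (hC ▸ h12 ▸ h7)

/-- The covectors bounding the orthant. -/
def coordZ : List (List ℤ) :=
  [[1, 0, 0, 0, 0], [0, 1, 0, 0, 0], [0, 0, 1, 0, 0], [0, 0, 0, 1, 0], [0, 0, 0, 0, 1]]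

theorem Tiling.nonneg_coordZ (hT : Tiling M) (t : ι) : ∀ h ∈ coordZ, ∀ i, 0 ≤ vec h ⬝ᵥ M t i := by
  have h1 : ∀ n : Fin 5, vec (coordZ.getD n []) = Pi.single n 1 := by
    intro n
    funext k
    fin_cases n <;> fin_cases k <;> simp [vec, coordZ]
  intro h hh i
  obtain ⟨n, rfl⟩ : ∃ n : Fin 5, h = coordZ.getD n [] := by
    simp only [coordZ, List.mem_cons, List.not_mem_nil, or_false] at hh
    rcases hh with rfl | rfl | rfl | rfl | rfl
    exacts [⟨0, rfl⟩, ⟨1, rfl⟩, ⟨2, rfl⟩, ⟨3, rfl⟩, ⟨4, rfl⟩]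
  rw [h1, single_dotProduct, one_mul]
  exact hT.nonneg t i n

/-- The tile containing a flag is one of those found by the search. -/
theorem Tiling.occurs_of_flag [Finite ι] (hT : Tiling M) {us E : List (List ℤ)}
    {L : List (List (List ℤ))} (hv : flagValid us (coordZ ++ E) = true)
    (hs : flagOK us (coordZ ++ E) L = true)
    (hE : ∀ t, (∃ᶠ ε in 𝓝[>] (0 : ℝ), germ (mat us) ε ∈ coneC (M t)) →
      ∀ h ∈ E, ∀ i, 0 ≤ vec h ⬝ᵥ M t i) : ∃ N ∈ L, Occurs M N := by
  obtain ⟨t, ht⟩ := hT.exists_frequently hv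
  obtain ⟨N, hN, ρ, hρ, h⟩ := tile_of_flag hv hs (hT.gram t) (hT.isUnit t) (by
    intro h hh
    rcases List.mem_append.1 hh with h1 | h1
    · exact hT.nonneg_coordZ t h h1
    · exact hE t ht h h1) ht
  refine ⟨N, hN, t, ?_⟩
  simp only [List.mem_cons, List.not_mem_nil, or_false] at hρ
  rcases hρ with rfl | rfl
  · refine ⟨1, ?_⟩
    ext s j
    rw [h]
    fin_cases s <;> rfl
  · refine ⟨Equiv.swap 1 3, ?_⟩
    ext s j
    rw [h]
    fin_cases s <;> rfl

end Walls

section Uniqueness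

open Filter Topology Matrix

/-- The ten cones of the decomposition of the large simplex. -/
def stdTile : ℕ → List (List ℤ)
  | 0 => [[1, 1, 0, 0, 0], [1, 0, 0, 1, 0], [2, 0, 0, 0, 0], [1, 0, 0, 0, 1], [0, 0, 1, 0, 0]]
  | 1 => [[1, 1, 0, 0, 0], [0, 1, 0, 1, 0], [0, 2, 0, 0, 0], [0, 1, 0, 0, 1], [0, 0, 1, 0, 0]]
  | 2 => [[1, 1, 0, 0, 0], [1, 0, 0, 1, 0], [0, 0, 0, 1, 1], [1, 0, 0, 0, 1], [0, 0, 1, 0, 0]]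
  | 3 => [[1, 1, 0, 0, 0], [0, 1, 0, 1, 0], [0, 0, 0, 1, 1], [0, 1, 0, 0, 1], [0, 0, 1, 0, 0]]
  | 4 => [[1, 1, 0, 0, 0], [1, 0, 0, 1, 0], [0, 0, 0, 1, 1], [0, 1, 0, 1, 0], [0, 0, 1, 0, 0]]
  | 5 => [[1, 1, 0, 0, 0], [1, 0, 0, 0, 1], [0, 0, 0, 1, 1], [0, 1, 0, 0, 1], [0, 0, 1, 0, 0]]
  | 6 => [[0, 0, 1, 2, 0], [1, 0, 0, 1, 0], [0, 0, 0, 1, 1], [0, 1, 0, 1, 0], [0, 0, 1, 0, 0]]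
  | 7 => [[0, 0, 1, 0, 2], [1, 0, 0, 0, 1], [0, 0, 0, 1, 1], [0, 1, 0, 0, 1], [0, 0, 1, 0, 0]]
  | 8 => [[0, 0, 1, 2, 0], [1, 0, 0, 1, 0], [0, 0, 0, 1, 1], [0, 1, 0, 1, 0], [0, 0, 0, 2, 0]]
  | 9 => [[0, 0, 1, 0, 2], [1, 0, 0, 0, 1], [0, 0, 0, 1, 1], [0, 1, 0, 0, 1], [0, 0, 0, 0, 2]]
  | _ => []

/-- Exchange two of the coordinates `2`, `3`, `4`. -/
def leafPerm : ℕ → Equiv.Perm (Fin 5)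
  | 3 => Equiv.swap 2 3
  | 4 => Equiv.swap 2 4
  | _ => 1

theorem leafPerm_involutive (k : ℕ) : leafPerm k * leafPerm k = 1 := by
  unfold leafPerm; split <;> simp

theorem leafPerm_formP (k : ℕ) :
    (mat formP).submatrix (leafPerm k) (leafPerm k) = mat formP := by
  unfold leafPerm
  split
  · ext i j
    fin_cases i <;> fin_cases j <;> simp [mat_apply, formP, Equiv.swap_apply_def]
  · ext i j
    fin_cases i <;> fin_cases j <;> simp [mat_apply, formP, Equiv.swap_apply_def]
  · rfl

/-- Permute the entries of the rows by `leafPerm k`. -/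
def leafSwap (k : ℕ) (N : List (List ℤ)) : List (List ℤ) :=
  N.map fun r => (List.finRange 5).map fun j => r.getD (leafPerm k j) 0

theorem mat_leafSwap (k n : ℕ) (hn : n < 10) :
    mat (leafSwap k (stdTile n)) = (mat (stdTile n)).submatrix id (leafPerm k) := by
  ext i j
  have h5 : (i : ℕ) < (stdTile n).length := by
    interval_cases n <;> exact i.2
  simp only [mat_apply, leafSwap, Matrix.submatrix_apply, id, List.getD_eq_getElem?_getD,
    List.getElem?_map, List.getElem?_eq_getElem h5, Option.map_some, Option.getD_some]
  have : (List.finRange 5)[(j : ℕ)]? = some j := by fin_cases j <;> rfl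
  rw [this]
  rfl

variable {ι : Type*} {M : ι → Matrix (Fin 5) (Fin 5) ℝ}

theorem vecMul_submatrix_right (A : Matrix (Fin 5) (Fin 5) ℝ) (π : Fin 5 → Fin 5) (a : Fin 5 → ℝ) :
    a ᵥ* A.submatrix id π = (a ᵥ* A) ∘ π := rfl

theorem Tiling.submatrix (hT : Tiling M) {π : Equiv.Perm (Fin 5)}
    (hπ : (mat formP).submatrix π π = mat formP) : Tiling fun t => (M t).submatrix id π where
  gram t := by
    rw [← hT.gram t, Matrix.transpose_submatrix]
    conv_lhs => rw [← hπ]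
    rw [Matrix.submatrix_mul_equiv, Matrix.submatrix_mul_equiv, Matrix.submatrix_id_id]
  nonneg t i j := hT.nonneg t i (π j)
  cover x hx hq := by
    have h1 : (x ∘ π.symm) ⬝ᵥ (mat formP *ᵥ (x ∘ π.symm)) = x ⬝ᵥ (mat formP *ᵥ x) := by
      have h2 : mat formP *ᵥ x = (mat formP *ᵥ (x ∘ π.symm)) ∘ π := by
        conv_lhs => rw [← hπ, Matrix.submatrix_mulVec_equiv]
      rw [h2]
      simp only [dotProduct, Function.comp]
      exact ((Equiv.sum_comp π _).symm).trans (Finset.sum_congr rfl fun i _ => by simp)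
    obtain ⟨t, a, ha, h⟩ := hT.cover (x ∘ π.symm) (fun j => hx _) (h1.trans_lt hq)
    refine ⟨t, a, ha, ?_⟩
    rw [vecMul_submatrix_right, ← h]
    funext j
    simp
  disj t t' h := by
    rw [Set.disjoint_left]
    rintro x ⟨a, ha, h1⟩ ⟨b, hb, h2⟩
    refine Set.disjoint_left.1 (hT.disj t t' h) ⟨a, ha, rfl⟩ ⟨b, hb, ?_⟩
    rw [vecMul_submatrix_right] at h1 h2
    exact π.surjective.injective_comp_right (h1.symm.trans h2)

theorem Occurs.submatrix_leafPerm {k n : ℕ} (hn : n < 10)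
    (h : Occurs M (leafSwap k (stdTile n))) :
    Occurs (fun t => (M t).submatrix id (leafPerm k)) (stdTile n) := by
  obtain ⟨t, ρ, h⟩ := h
  refine ⟨t, ρ, ?_⟩
  show (M t).submatrix id (leafPerm k) = _
  rw [h, mat_leafSwap k n hn, Matrix.submatrix_submatrix, Matrix.submatrix_submatrix]
  congr 1
  funext j
  have := congrArg (fun p : Equiv.Perm (Fin 5) => p j) (leafPerm_involutive k)
  simpa using this

theorem mem_coneC_mat {N : List (List ℤ)} {x : Fin 5 → ℝ} (a : Fin 5 → ℝ) (ha : ∀ i, 0 ≤ a i)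
    (h : ∀ j, x j = ∑ i, a i * mat N i j) : x ∈ coneC (mat N) := ⟨a, ha, funext h⟩

theorem cutoff_zero (x : Fin 5 → ℝ) (hx : ∀ j, 0 ≤ x j)
    (hc : vec [-1, 1, 0, 1, 1] ⬝ᵥ x < 0) : x ∈ coneC (mat (stdTile 0)) := by
  have h0 := hx 0
  have h1 := hx 1
  have h2 := hx 2
  have h3 := hx 3
  have h4 := hx 4
  simp [dotProduct, Fin.sum_univ_five, vec] at hc
  refine mem_coneC_mat ![x 1, x 3, (x 0 - x 1 - x 3 - x 4) / 2, x 4, x 2] ?_ ?_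
  · intro i
    fin_cases i <;> simp <;> linarith
  · intro j
    fin_cases j <;> simp [Fin.sum_univ_five, mat_apply, stdTile]
    all_goals ring

theorem cutoff_one (x : Fin 5 → ℝ) (hx : ∀ j, 0 ≤ x j)
    (hc : vec [1, -1, 0, 1, 1] ⬝ᵥ x < 0) : x ∈ coneC (mat (stdTile 1)) := by
  have h0 := hx 0
  have h1 := hx 1
  have h2 := hx 2
  have h3 := hx 3
  have h4 := hx 4
  simp [dotProduct, Fin.sum_univ_five, vec] at hc
  refine mem_coneC_mat ![x 0, x 3, (x 1 - x 0 - x 3 - x 4) / 2, x 4, x 2] ?_ ?_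
  · intro i
    fin_cases i <;> simp <;> linarith
  · intro j
    fin_cases j <;> simp [Fin.sum_univ_five, mat_apply, stdTile]
    all_goals ring

theorem cutoff_three (x : Fin 5 → ℝ) (hx : ∀ j, 0 ≤ x j)
    (hc : vec [1, -1, 1, 0, 1] ⬝ᵥ x < 0) : x ∈ coneC (mat (leafSwap 3 (stdTile 1))) := by
  have h0 := hx 0
  have h1 := hx 1
  have h2 := hx 2
  have h3 := hx 3
  have h4 := hx 4
  simp [dotProduct, Fin.sum_univ_five, vec] at hc
  refine mem_coneC_mat ![x 0, x 2, (x 1 - x 0 - x 2 - x 4) / 2, x 4, x 3] ?_ ?_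
  · intro i
    fin_cases i <;> simp <;> linarith
  · intro j
    fin_cases j <;> simp [Fin.sum_univ_five, mat_apply, stdTile, leafSwap, leafPerm,
      List.finRange_succ, Equiv.swap_apply_def]
    all_goals ring

theorem cutoff_four (x : Fin 5 → ℝ) (hx : ∀ j, 0 ≤ x j)
    (hc : vec [1, -1, 1, 1, 0] ⬝ᵥ x < 0) : x ∈ coneC (mat (leafSwap 4 (stdTile 1))) := by
  have h0 := hx 0
  have h1 := hx 1
  have h2 := hx 2
  have h3 := hx 3
  have h4 := hx 4
  simp [dotProduct, Fin.sum_univ_five, vec] at hc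
  refine mem_coneC_mat ![x 0, x 3, (x 1 - x 0 - x 2 - x 3) / 2, x 2, x 4] ?_ ?_
  · intro i
    fin_cases i <;> simp <;> linarith
  · intro j
    fin_cases j <;> simp [Fin.sum_univ_five, mat_apply, stdTile, leafSwap, leafPerm,
      List.finRange_succ, Equiv.swap_apply_def]
    all_goals ring

set_option maxRecDepth 100000 in
theorem Tiling.occurs_zero [Finite ι] (hT : Tiling M) :
    ∃ k, Occurs M (leafSwap k (stdTile 0)) := by
  obtain ⟨N, hN, h⟩ := hT.occurs_of_flag
    (us := [[1, 0, 0, 0, 0], [-3, 1, 0, 0, 0], [-1, -1, 0, 2, 0], [-1, -1, 0, 0, 2], [-1, -1, 2, 0, 0]]) (E := [])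
    (L := [leafSwap 2 (stdTile 0), leafSwap 3 (stdTile 0), leafSwap 4 (stdTile 0)])
    (by decide +kernel) (by decide +kernel) (by simp)
  simp only [List.mem_cons, List.not_mem_nil, or_false] at hN
  rcases hN with rfl | rfl | rfl
  exacts [⟨2, h⟩, ⟨3, h⟩, ⟨4, h⟩]

set_option maxRecDepth 100000 in
theorem Tiling.occurs_one [Finite ι] (hT : Tiling M) (h₀ : Occurs M (stdTile 0)) :
    Occurs M (stdTile 1) := by
  obtain ⟨N, hN, h⟩ := hT.occurs_of_flag
    (us := [[0, 1, 0, 0, 0], [1, -3, 0, 0, 0], [-1, -1, 0, 2, 0], [-1, -1, 0, 0, 2], [-1, -1, 2, 0, 0]]) (E := [])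
    (L := [stdTile 1, leafSwap 3 (stdTile 1), leafSwap 4 (stdTile 1)])
    (by decide +kernel) (by decide +kernel) (by simp)
  simp only [List.mem_cons, List.not_mem_nil, or_false] at hN
  rcases hN with rfl | rfl | rfl
  · exact h
  · obtain ⟨N, hN, -⟩ := hT.occurs_of_flag
      (us := [[0, 1, 1, 0, 0], [5, -3, -8, 0, 0], [1, -3, 2, 0, 0], [-1, -1, 0, 0, 2], [-1, -1, 0, 2, 0]])
      (E := [[-1, 1, 0, 1, 1], [1, -1, 1, 0, 1]]) (L := [])
      (by decide +kernel) (by decide +kernel) (fun t hf => by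
        simp only [List.forall_mem_cons, List.not_mem_nil, false_imp_iff, implies_true, and_true]
        exact ⟨hT.nonneg_of_cutoff h₀ cutoff_zero (by decide +kernel) t hf,
          hT.nonneg_of_cutoff h cutoff_three (by decide +kernel) t hf⟩)
    simp at hN
  · obtain ⟨N, hN, -⟩ := hT.occurs_of_flag
      (us := [[0, 1, 1, 0, 0], [5, -3, -8, 0, 0], [1, -3, 2, 0, 0], [-1, -1, 0, 2, 0], [-1, -1, 0, 0, 2]])
      (E := [[-1, 1, 0, 1, 1], [1, -1, 1, 1, 0]]) (L := [])
      (by decide +kernel) (by decide +kernel) (fun t hf => by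
        simp only [List.forall_mem_cons, List.not_mem_nil, false_imp_iff, implies_true, and_true]
        exact ⟨hT.nonneg_of_cutoff h₀ cutoff_zero (by decide +kernel) t hf,
          hT.nonneg_of_cutoff h cutoff_four (by decide +kernel) t hf⟩)
    simp at hN

set_option maxRecDepth 100000 in
theorem Tiling.occurs_two [Finite ι] (hT : Tiling M) (h₀ : Occurs M (stdTile 0))
    (h₁ : Occurs M (stdTile 1)) : Occurs M (stdTile 2) := by
  obtain ⟨N, hN, h⟩ := hT.occurs_of_flag
    (us := [[1, 1, 0, 0, 0], [0, -1, 0, 1, 0], [0, -2, 0, -1, 3], [-2, 0, 0, 1, 1], [-1, -1, 2, 0, 0]])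
    (E := [[-1, 1, 0, 1, 1], [1, -1, 0, 1, 1]]) (L := [stdTile 2])
    (by decide +kernel) (by decide +kernel) (fun t hf => by
      simp only [List.forall_mem_cons, List.not_mem_nil, false_imp_iff, implies_true, and_true]
      exact ⟨hT.nonneg_of_cutoff h₀ cutoff_zero (by decide +kernel) t hf,
        hT.nonneg_of_cutoff h₁ cutoff_one (by decide +kernel) t hf⟩)
  rwa [List.mem_singleton.1 hN] at h

set_option maxRecDepth 100000 in
theorem Tiling.occurs_three [Finite ι] (hT : Tiling M) (h₀ : Occurs M (stdTile 0))
    (h₁ : Occurs M (stdTile 1)) : Occurs M (stdTile 3) := by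
  obtain ⟨N, hN, h⟩ := hT.occurs_of_flag
    (us := [[1, 1, 0, 0, 0], [-1, 0, 0, 1, 0], [-2, 0, 0, -1, 3], [0, -2, 0, 1, 1], [-1, -1, 2, 0, 0]])
    (E := [[-1, 1, 0, 1, 1], [1, -1, 0, 1, 1]]) (L := [stdTile 3])
    (by decide +kernel) (by decide +kernel) (fun t hf => by
      simp only [List.forall_mem_cons, List.not_mem_nil, false_imp_iff, implies_true, and_true]
      exact ⟨hT.nonneg_of_cutoff h₀ cutoff_zero (by decide +kernel) t hf,
        hT.nonneg_of_cutoff h₁ cutoff_one (by decide +kernel) t hf⟩)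
  rwa [List.mem_singleton.1 hN] at h

set_option maxRecDepth 100000 in
theorem Tiling.occurs_five [Finite ι] (hT : Tiling M) (h₀ : Occurs M (stdTile 0))
    (h₁ : Occurs M (stdTile 1)) (h₂ : Occurs M (stdTile 2)) : Occurs M (stdTile 5) := by
  obtain ⟨N, hN, h⟩ := hT.occurs_of_flag
    (us := [[1, 0, 0, 0, 1], [-6, 0, 0, 5, -1], [0, 2, 0, -1, -3], [-1, -1, 2, 0, 0], [-1, 1, 0, -1, 1]])
    (E := [[-1, 1, 0, 1, 1], [1, -1, 0, 1, 1], [-1, 1, 0, -1, 1]]) (L := [stdTile 5])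
    (by decide +kernel) (by decide +kernel) (fun t hf => by
      simp only [List.forall_mem_cons, List.not_mem_nil, false_imp_iff, implies_true, and_true]
      exact ⟨hT.nonneg_of_cutoff h₀ cutoff_zero (by decide +kernel) t hf,
        hT.nonneg_of_cutoff h₁ cutoff_one (by decide +kernel) t hf,
        hT.nonneg_of_cross h₂ (i₀ := 1) (j := 4) (q := 2) (by decide +kernel) t hf⟩)
  rwa [List.mem_singleton.1 hN] at h

set_option maxRecDepth 100000 in
theorem Tiling.occurs_four [Finite ι] (hT : Tiling M) (h₀ : Occurs M (stdTile 0))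
    (h₁ : Occurs M (stdTile 1)) (h₂ : Occurs M (stdTile 2)) : Occurs M (stdTile 4) := by
  obtain ⟨N, hN, h⟩ := hT.occurs_of_flag
    (us := [[1, 0, 0, 1, 0], [-6, 0, 0, -1, 5], [0, 2, 0, -3, -1], [-1, -1, 2, 0, 0], [-1, 1, 0, 1, -1]])
    (E := [[-1, 1, 0, 1, 1], [1, -1, 0, 1, 1], [-1, 1, 0, 1, -1]]) (L := [stdTile 4])
    (by decide +kernel) (by decide +kernel) (fun t hf => by
      simp only [List.forall_mem_cons, List.not_mem_nil, false_imp_iff, implies_true, and_true]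
      exact ⟨hT.nonneg_of_cutoff h₀ cutoff_zero (by decide +kernel) t hf,
        hT.nonneg_of_cutoff h₁ cutoff_one (by decide +kernel) t hf,
        hT.nonneg_of_cross h₂ (i₀ := 3) (j := 4) (q := 2) (by decide +kernel) t hf⟩)
  rwa [List.mem_singleton.1 hN] at h

set_option maxRecDepth 100000 in
theorem Tiling.occurs_seven [Finite ι] (hT : Tiling M) (h₀ : Occurs M (stdTile 0))
    (h₁ : Occurs M (stdTile 1)) (h₂ : Occurs M (stdTile 5)) : Occurs M (stdTile 7) := by
  obtain ⟨N, hN, h⟩ := hT.occurs_of_flag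
    (us := [[1, 0, 0, 0, 1], [-6, 0, 0, 5, -1], [-2, 4, 0, -3, -1], [-1, -1, 3, 0, -2], [-1, -1, 1, 0, 2]])
    (E := [[-1, 1, 0, 1, 1], [1, -1, 0, 1, 1], [-1, -1, 0, -1, 1]]) (L := [stdTile 7])
    (by decide +kernel) (by decide +kernel) (fun t hf => by
      simp only [List.forall_mem_cons, List.not_mem_nil, false_imp_iff, implies_true, and_true]
      exact ⟨hT.nonneg_of_cutoff h₀ cutoff_zero (by decide +kernel) t hf,
        hT.nonneg_of_cutoff h₁ cutoff_one (by decide +kernel) t hf,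
        hT.nonneg_of_cross h₂ (i₀ := 0) (j := 4) (q := 2) (by decide +kernel) t hf⟩)
  rwa [List.mem_singleton.1 hN] at h

set_option maxRecDepth 100000 in
theorem Tiling.occurs_six [Finite ι] (hT : Tiling M) (h₀ : Occurs M (stdTile 0))
    (h₁ : Occurs M (stdTile 1)) (h₂ : Occurs M (stdTile 4)) : Occurs M (stdTile 6) := by
  obtain ⟨N, hN, h⟩ := hT.occurs_of_flag
    (us := [[1, 0, 0, 1, 0], [-6, 0, 0, -1, 5], [-2, 4, 0, -1, -3], [-1, -1, 3, -2, 0], [-1, -1, 1, 2, 0]])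
    (E := [[-1, 1, 0, 1, 1], [1, -1, 0, 1, 1], [-1, -1, 0, 1, -1]]) (L := [stdTile 6])
    (by decide +kernel) (by decide +kernel) (fun t hf => by
      simp only [List.forall_mem_cons, List.not_mem_nil, false_imp_iff, implies_true, and_true]
      exact ⟨hT.nonneg_of_cutoff h₀ cutoff_zero (by decide +kernel) t hf,
        hT.nonneg_of_cutoff h₁ cutoff_one (by decide +kernel) t hf,
        hT.nonneg_of_cross h₂ (i₀ := 0) (j := 4) (q := 2) (by decide +kernel) t hf⟩)
  rwa [List.mem_singleton.1 hN] at h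

set_option maxRecDepth 100000 in
theorem Tiling.occurs_nine [Finite ι] (hT : Tiling M) (h₀ : Occurs M (stdTile 0))
    (h₁ : Occurs M (stdTile 1)) (h₂ : Occurs M (stdTile 7)) : Occurs M (stdTile 9) := by
  obtain ⟨N, hN, h⟩ := hT.occurs_of_flag
    (us := [[0, 0, 1, 0, 2], [1, 0, -1, 0, -1], [-2, 0, -1, 3, -1], [0, 2, -1, -1, -1], [0, 0, -1, 0, 2]])
    (E := [[-1, 1, 0, 1, 1], [1, -1, 0, 1, 1], [-1, -1, -2, -1, 1]]) (L := [stdTile 9])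
    (by decide +kernel) (by decide +kernel) (fun t hf => by
      simp only [List.forall_mem_cons, List.not_mem_nil, false_imp_iff, implies_true, and_true]
      exact ⟨hT.nonneg_of_cutoff h₀ cutoff_zero (by decide +kernel) t hf,
        hT.nonneg_of_cutoff h₁ cutoff_one (by decide +kernel) t hf,
        hT.nonneg_of_cross h₂ (i₀ := 4) (j := 4) (q := 2) (by decide +kernel) t hf⟩)
  rwa [List.mem_singleton.1 hN] at h

set_option maxRecDepth 100000 in
theorem Tiling.occurs_eight [Finite ι] (hT : Tiling M) (h₀ : Occurs M (stdTile 0))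
    (h₁ : Occurs M (stdTile 1)) (h₂ : Occurs M (stdTile 6)) : Occurs M (stdTile 8) := by
  obtain ⟨N, hN, h⟩ := hT.occurs_of_flag
    (us := [[0, 0, 1, 2, 0], [1, 0, -1, -1, 0], [-2, 0, -1, -1, 3], [0, 2, -1, -1, -1], [0, 0, -1, 2, 0]])
    (E := [[-1, 1, 0, 1, 1], [1, -1, 0, 1, 1], [-1, -1, -2, 1, -1]]) (L := [stdTile 8])
    (by decide +kernel) (by decide +kernel) (fun t hf => by
      simp only [List.forall_mem_cons, List.not_mem_nil, false_imp_iff, implies_true, and_true]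
      exact ⟨hT.nonneg_of_cutoff h₀ cutoff_zero (by decide +kernel) t hf,
        hT.nonneg_of_cutoff h₁ cutoff_one (by decide +kernel) t hf,
        hT.nonneg_of_cross h₂ (i₀ := 4) (j := 4) (q := 2) (by decide +kernel) t hf⟩)
  rwa [List.mem_singleton.1 hN] at h

/-- Up to a permutation of the last three coordinates, the ten standard cones occur in every
tiling. -/
theorem Tiling.exists_leafPerm [Finite ι] (hT : Tiling M) :
    ∃ k, ∀ n < 10, Occurs (fun t => (M t).submatrix id (leafPerm k)) (stdTile n) := by
  obtain ⟨k, hk⟩ := hT.occurs_zero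
  have h0 := hk.submatrix_leafPerm (by norm_num)
  have hT' := hT.submatrix (leafPerm_formP k)
  have h1 := hT'.occurs_one h0
  have h2 := hT'.occurs_two h0 h1
  have h4 := hT'.occurs_four h0 h1 h2
  have h5 := hT'.occurs_five h0 h1 h2
  have h6 := hT'.occurs_six h0 h1 h4
  have h7 := hT'.occurs_seven h0 h1 h5
  refine ⟨k, fun n hn => ?_⟩
  interval_cases n
  exacts [h0, h1, h2, hT'.occurs_three h0 h1, h4, h5, h6, h7, hT'.occurs_eight h0 h1 h6,
    hT'.occurs_nine h0 h1 h7]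

end Uniqueness

section Standard

open Filter Topology Matrix

/-- The ten standard cones, as real matrices. -/
def stdM (n : Fin 10) : Matrix (Fin 5) (Fin 5) ℝ := mat (stdTile n)

theorem stdM_gram (n : Fin 10) : stdM n * mat formP * (stdM n)ᵀ = mat formF := by
  refine gramOK_spec ?_
  revert n
  decide +kernel

theorem stdM_nonneg (n : Fin 10) (i j : Fin 5) : 0 ≤ stdM n i j := by
  have : ∀ (n : Fin 10) (i j : Fin 5), 0 ≤ ((stdTile n).getD i []).getD j 0 := by decide +kernel
  rw [stdM, mat_apply]
  exact_mod_cast this n i j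

theorem stdM_walls (n : Fin 10) : mat (wallsZ (stdTile n)) = mat invF * stdM n * mat formP :=
  mat_wallsZ _

theorem mem_coneC_stdM_iff (n : Fin 10) (x : Fin 5 → ℝ) :
    x ∈ coneC (stdM n) ↔ ∀ i, 0 ≤ mat (wallsZ (stdTile n)) i ⬝ᵥ x := by
  rw [stdM_walls]
  exact mem_coneC_iff (stdM_gram n) x

theorem wall_dotProduct_vecMul (n : Fin 10) (a : Fin 5 → ℝ) (i : Fin 5) :
    mat (wallsZ (stdTile n)) i ⬝ᵥ (a ᵥ* stdM n) = 4 * a i := by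
  have : mat (wallsZ (stdTile n)) i ⬝ᵥ (a ᵥ* stdM n) =
      ((a ᵥ* stdM n) ᵥ* (mat (wallsZ (stdTile n)))ᵀ) i := by
    rw [Matrix.vecMul_transpose]; rfl
  rw [this, Matrix.vecMul_vecMul, stdM_walls, walls_mul (stdM_gram n)]
  simp [Matrix.vecMul_smul]

theorem stdM_disjoint {n m : Fin 10} (h : n ≠ m) : Disjoint (coneI (stdM n)) (coneI (stdM m)) := by
  have h1 : ∀ n m : Fin 10, n ≠ m → ∃ i : Fin 5, ∀ k : Fin 5,
      idot ((wallsZ (stdTile n)).getD i []) ((stdTile m).getD k []) ≤ 0 := by decide +kernel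
  obtain ⟨i, hi⟩ := h1 n m h
  rw [Set.disjoint_left]
  rintro x ⟨a, ha, rfl⟩ ⟨b, hb, hx⟩
  have h2 := wall_dotProduct_vecMul n a i
  have h3 : mat (wallsZ (stdTile n)) i ⬝ᵥ (b ᵥ* stdM m) =
      ∑ k, b k * (mat (wallsZ (stdTile n)) i ⬝ᵥ stdM m k) := by
    simp only [dotProduct, Matrix.vecMul, Finset.mul_sum]
    rw [Finset.sum_comm]
    exact Finset.sum_congr rfl fun _ _ => Finset.sum_congr rfl fun _ _ => by ring
  rw [hx, h3] at h2
  have h4 : ∑ k, b k * (mat (wallsZ (stdTile n)) i ⬝ᵥ stdM m k) ≤ 0 := by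
    refine Finset.sum_nonpos fun k _ => mul_nonpos_of_nonneg_of_nonpos (hb k).le ?_
    rw [mat_row, stdM, mat_row, vec_dotProduct]
    exact_mod_cast hi k
  linarith [ha i]

theorem covered_of_coeff {x : Fin 5 → ℝ} (n : Fin 10) (a : Fin 5 → ℝ) (ha : ∀ i, 0 ≤ a i)
    (h : ∀ j, x j = ∑ i, a i * mat (stdTile n) i j) : ∃ n, x ∈ coneC (stdM n) :=
  ⟨n, mem_coneC_mat a ha h⟩

theorem stdM_cover (x : Fin 5 → ℝ) (hx : ∀ j, 0 ≤ x j) : ∃ n, x ∈ coneC (stdM n) := by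
  have h0 := hx 0
  have h1 := hx 1
  have h2 := hx 2
  have h3 := hx 3
  have h4 := hx 4
  rcases le_total 0 (x 0 - x 1 + x 3 - x 4) with h | h
  · rcases le_total 0 (x 0 - x 1 - x 3 + x 4) with h | h
    · rcases le_total 0 (x 0 - x 1 - x 3 - x 4) with h | h
      · refine covered_of_coeff 0 ![x 1, x 3, (x 0 - x 1 - x 3 - x 4) / 2, x 4, x 2]
          (fun i => ?_) fun j => ?_
        · fin_cases i <;> simp <;> linarith
        · fin_cases j <;> simp [Fin.sum_univ_five, mat_apply, stdTile] <;> ring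
      · refine covered_of_coeff 2 ![x 1, (x 0 - x 1 + x 3 - x 4) / 2, (-x 0 + x 1 + x 3 + x 4) / 2, (x 0 - x 1 - x 3 + x 4) / 2, x 2]
          (fun i => ?_) fun j => ?_
        · fin_cases i <;> simp <;> linarith
        · fin_cases j <;> simp [Fin.sum_univ_five, mat_apply, stdTile] <;> ring
    · rcases le_total 0 (x 0 + x 1 - x 3 + x 4) with h | h
      · refine covered_of_coeff 4 ![(x 0 + x 1 - x 3 + x 4) / 2, (x 0 - x 1 + x 3 - x 4) / 2, x 4, (-x 0 + x 1 + x 3 - x 4) / 2, x 2]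
          (fun i => ?_) fun j => ?_
        · fin_cases i <;> simp <;> linarith
        · fin_cases j <;> simp [Fin.sum_univ_five, mat_apply, stdTile] <;> ring
      · rcases le_total 0 (x 0 + x 1 + 2 * x 2 - x 3 + x 4) with h | h
        · refine covered_of_coeff 6 ![(-x 0 - x 1 + x 3 - x 4) / 2, x 0, x 4, x 1, (x 0 + x 1 + 2 * x 2 - x 3 + x 4) / 2]
            (fun i => ?_) fun j => ?_
          · fin_cases i <;> simp <;> linarith
          · fin_cases j <;> simp [Fin.sum_univ_five, mat_apply, stdTile] <;> ring
        · refine covered_of_coeff 8 ![x 2, x 0, x 4, x 1, (-x 0 - x 1 - 2 * x 2 + x 3 - x 4) / 2]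
            (fun i => ?_) fun j => ?_
          · fin_cases i <;> simp <;> linarith
          · fin_cases j <;> simp [Fin.sum_univ_five, mat_apply, stdTile] <;> ring
  · rcases le_total 0 (x 0 - x 1 - x 3 + x 4) with h | h
    · rcases le_total 0 (x 0 + x 1 + x 3 - x 4) with h | h
      · refine covered_of_coeff 5 ![(x 0 + x 1 + x 3 - x 4) / 2, (x 0 - x 1 - x 3 + x 4) / 2, x 3, (-x 0 + x 1 - x 3 + x 4) / 2, x 2]
          (fun i => ?_) fun j => ?_
        · fin_cases i <;> simp <;> linarith
        · fin_cases j <;> simp [Fin.sum_univ_five, mat_apply, stdTile] <;> ring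
      · rcases le_total 0 (x 0 + x 1 + 2 * x 2 + x 3 - x 4) with h | h
        · refine covered_of_coeff 7 ![(-x 0 - x 1 - x 3 + x 4) / 2, x 0, x 3, x 1, (x 0 + x 1 + 2 * x 2 + x 3 - x 4) / 2]
            (fun i => ?_) fun j => ?_
          · fin_cases i <;> simp <;> linarith
          · fin_cases j <;> simp [Fin.sum_univ_five, mat_apply, stdTile] <;> ring
        · refine covered_of_coeff 9 ![x 2, x 0, x 3, x 1, (-x 0 - x 1 - 2 * x 2 - x 3 + x 4) / 2]
            (fun i => ?_) fun j => ?_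
          · fin_cases i <;> simp <;> linarith
          · fin_cases j <;> simp [Fin.sum_univ_five, mat_apply, stdTile] <;> ring
    · rcases le_total 0 (-x 0 + x 1 - x 3 - x 4) with h | h
      · refine covered_of_coeff 1 ![x 0, x 3, (-x 0 + x 1 - x 3 - x 4) / 2, x 4, x 2]
          (fun i => ?_) fun j => ?_
        · fin_cases i <;> simp <;> linarith
        · fin_cases j <;> simp [Fin.sum_univ_five, mat_apply, stdTile] <;> ring
      · refine covered_of_coeff 3 ![x 0, (-x 0 + x 1 + x 3 - x 4) / 2, (x 0 - x 1 + x 3 + x 4) / 2, (-x 0 + x 1 - x 3 + x 4) / 2, x 2]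
          (fun i => ?_) fun j => ?_
        · fin_cases i <;> simp <;> linarith
        · fin_cases j <;> simp [Fin.sum_univ_five, mat_apply, stdTile] <;> ring

/-- A wall of a standard cone containing three of the vertices of the large simplex contains
four of them. -/
theorem stdM_wall_zero (n : Fin 10) (c i j : Fin 5)
    (h : ∀ l, l ≠ i → l ≠ j → mat (wallsZ (stdTile n)) c l = 0) :
    ∃ m, ∀ l, l ≠ m → mat (wallsZ (stdTile n)) c l = 0 := by
  have key : ∀ (n : Fin 10) (c i j : Fin 5),
      (∀ l : Fin 5, l ≠ i → l ≠ j → ((wallsZ (stdTile n)).getD c []).getD l 0 = 0) →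
      ∃ m : Fin 5, ∀ l : Fin 5, l ≠ m → ((wallsZ (stdTile n)).getD c []).getD l 0 = 0 := by
    decide +kernel
  simp only [mat_apply, Int.cast_eq_zero] at h ⊢
  exact key n c i j h

/-- The matrix of the reflected simplicial cone. -/
def reflectRow (i : Fin 5) (A : Matrix (Fin 5) (Fin 5) ℝ) : Matrix (Fin 5) (Fin 5) ℝ :=
  A.updateRow i (A i - (mat invF * A) i)

/-- Integral version of `reflectRow`. -/
def reflectRowZ (i : ℕ) (N : List (List ℤ)) : List (List ℤ) :=
  (List.range 5).map fun j => if j = i then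
    (List.range 5).map fun k => (N.getD i []).getD k 0 -
      idot (invF.getD i []) ((List.range 5).map fun l => (N.getD l []).getD k 0)
    else N.getD j []

theorem mat_reflectRowZ (i : Fin 5) (N : List (List ℤ)) :
    mat (reflectRowZ i N) = reflectRow i (mat N) := by
  ext j k
  rw [reflectRow, Matrix.updateRow_apply, mat_apply, reflectRowZ]
  have h1 : ∀ f : ℕ → List ℤ, ((List.range 5).map f).getD j [] = f j := by
    intro f; fin_cases j <;> rfl
  have h2 : ∀ f : ℕ → ℤ, ((List.range 5).map f).getD k 0 = f k := by
    intro f; fin_cases k <;> rfl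
  rw [h1]
  by_cases h : j = i
  · subst h
    simp only [if_true, h2, Pi.sub_apply]
    simp [idot, Matrix.mul_apply, Fin.sum_univ_five, mat_apply]
  · have : (j : ℕ) ≠ i := fun e => h (Fin.ext e)
    simp only [h, this, if_false]
    rfl

/-- Two standard cones sharing the barycenter of a facet are mirror images of each other. -/
theorem stdM_reflect {n m : Fin 10} (h : n ≠ m) (i : Fin 5)
    (hb : (fun l => if l = i then 0 else 1) ᵥ* stdM n ∈ coneC (stdM m)) :
    ∃ ρ : Equiv.Perm (Fin 5), reflectRow i (stdM n) = (stdM m).submatrix ρ id := by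
  have key : ∀ n m : Fin 10, n ≠ m → ∀ i : Fin 5,
      (∀ k : Fin 5, 0 ≤ idot ((wallsZ (stdTile m)).getD k []) ((List.range 5).map fun j =>
        idot ((List.range 5).map fun l => if l = (i : ℕ) then 0 else 1)
          ((List.range 5).map fun l => ((stdTile n).getD l []).getD j 0))) →
      ∃ b : Bool, ∀ r j : Fin 5, ((reflectRowZ i (stdTile n)).getD r []).getD j 0 =
        ((stdTile m).getD (cond b (Equiv.swap (1 : Fin 5) 3 r) r : Fin 5) []).getD j 0 := by
    decide +kernel
  rw [mem_coneC_stdM_iff] at hb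
  have h1 : (fun l : Fin 5 => if l = i then (0 : ℝ) else 1) ᵥ* stdM n =
      vec ((List.range 5).map fun j =>
        idot ((List.range 5).map fun l => if l = (i : ℕ) then 0 else 1)
          ((List.range 5).map fun l => ((stdTile n).getD l []).getD j 0)) := by
    funext j
    have h2 : ∀ f : ℕ → ℤ, ((List.range 5).map f).getD j 0 = f j := by
      intro f; fin_cases j <;> rfl
    rw [vec, h2]
    simp only [Matrix.vecMul, dotProduct, Fin.sum_univ_five, stdM, mat_apply, idot]
    fin_cases i <;> simp [List.range_succ]
  rw [h1] at hb
  obtain ⟨b, hb⟩ := key n m h i fun k => by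
    have := hb k
    rw [mat_row, vec_dotProduct] at this
    exact_mod_cast this
  refine ⟨if b then Equiv.swap 1 3 else 1, ?_⟩
  rw [stdM, ← mat_reflectRowZ]
  ext r j
  rw [mat_apply, hb r j]
  cases b <;> rfl

/-- A tiling in which all standard cones occur consists of the standard cones. -/
theorem Tiling.eq_std {ι : Type*} {M : ι → Matrix (Fin 5) (Fin 5) ℝ} (hT : Tiling M)
    (h : ∀ n < 10, Occurs M (stdTile n)) (t : ι) :
    ∃ n : Fin 10, ∃ ρ : Equiv.Perm (Fin 5), M t = (stdM n).submatrix ρ id := by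
  obtain ⟨n, hn⟩ := stdM_cover ((1 : Fin 5 → ℝ) ᵥ* M t) fun j => by
    show 0 ≤ ∑ k, 1 * M t k j
    exact Finset.sum_nonneg fun k _ => mul_nonneg zero_le_one (hT.nonneg t k j)
  obtain ⟨t₀, ρ, h₀⟩ := h n n.2
  refine ⟨n, ρ, ?_⟩
  have : t = t₀ := hT.meet (sum_rows_mem_coneI _) (by rw [h₀, coneC_submatrix]; exact hn)
  rw [this, h₀]
  rfl

end Standard

section Minkowski

open Filter Topology

/-- The Minkowski form as a bilinear map. -/
def mB : EuclideanSpace ℝ (Fin (4 + 1)) →ₗ[ℝ] EuclideanSpace ℝ (Fin (4 + 1)) →ₗ[ℝ] ℝ :=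
  LinearMap.mk₂ ℝ (mink 4)
    (fun x y z => by simp only [mink, PiLp.add_apply, add_mul, Finset.sum_add_distrib]; ring)
    (fun c x y => by
      simp only [mink, PiLp.smul_apply, smul_eq_mul, mul_add, Finset.mul_sum, mul_assoc]; ring)
    (fun x y z => by simp only [mink, PiLp.add_apply, mul_add, Finset.sum_add_distrib]; ring)
    (fun c x y => by
      simp only [mink, PiLp.smul_apply, smul_eq_mul, mul_add, Finset.mul_sum]
      congr 1
      · ring
      · exact Finset.sum_congr rfl fun _ _ => by ring)

theorem mink_eq_mB (x y : EuclideanSpace ℝ (Fin (4 + 1))) : mink 4 x y = mB x y := rfl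

theorem mB_apply (x y : EuclideanSpace ℝ (Fin (4 + 1))) :
    mB x y = -(x 0 * y 0) + ∑ i : Fin 4, x i.succ * y i.succ := rfl

theorem mB_comm (x y : EuclideanSpace ℝ (Fin (4 + 1))) : mB x y = mB y x := by
  simp only [mB_apply, mul_comm]

theorem continuous_mB_self : Continuous fun x : EuclideanSpace ℝ (Fin (4 + 1)) => mB x x := by
  simp only [mB_apply]
  fun_prop

theorem continuous_mB_right (v : EuclideanSpace ℝ (Fin (4 + 1))) : Continuous fun x => mB v x := by
  simp only [mB_apply]
  fun_prop

theorem eq_zero_of_forall_mB {x : EuclideanSpace ℝ (Fin (4 + 1))} (h : ∀ y, mB x y = 0) :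
    x = 0 := by
  ext i
  have := h (EuclideanSpace.single i 1)
  rw [mB_apply] at this
  refine Fin.cases ?_ (fun j => ?_) i
  · have := h (EuclideanSpace.single 0 1)
    simpa [mB_apply] using this
  · have := h (EuclideanSpace.single j.succ 1)
    simpa [mB_apply, Finset.sum_ite_eq, PiLp.single_apply] using this

theorem sq_sum_le (x y : EuclideanSpace ℝ (Fin (4 + 1))) :
    (∑ i : Fin 4, x i.succ * y i.succ) ^ 2 ≤
      (∑ i : Fin 4, x i.succ * x i.succ) * ∑ i : Fin 4, y i.succ * y i.succ := by
  have := Finset.sum_mul_sq_le_sq_mul_sq Finset.univ (fun i : Fin 4 => x i.succ)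
    (fun i : Fin 4 => y i.succ)
  simpa only [sq] using this

theorem sum_sq_nonneg (x : EuclideanSpace ℝ (Fin (4 + 1))) :
    0 ≤ ∑ i : Fin 4, x i.succ * x i.succ := Finset.sum_nonneg fun _ _ => mul_self_nonneg _

theorem mB_nonpos {x y : EuclideanSpace ℝ (Fin (4 + 1))} (hx : mB x x ≤ 0) (hx0 : 0 < x 0)
    (hy : mB y y ≤ 0) (hy0 : 0 < y 0) : mB x y ≤ 0 := by
  rw [mB_apply] at *
  have h1 := sq_sum_le x y
  have h2 := sum_sq_nonneg x
  have h3 := sum_sq_nonneg y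
  have h4 : (∑ i : Fin 4, x i.succ * y i.succ) ^ 2 ≤ (x 0 * y 0) ^ 2 := by
    refine h1.trans ?_
    rw [mul_pow]
    exact mul_le_mul (by linarith) (by linarith) h3 (by positivity)
  have h5 := abs_le_of_sq_le_sq h4 (by positivity)
  linarith [(abs_le.1 h5).2]

theorem mB_neg {x y : EuclideanSpace ℝ (Fin (4 + 1))} (hx : mB x x < 0) (hx0 : 0 < x 0)
    (hy : mB y y ≤ 0) (hy0 : 0 < y 0) : mB x y < 0 := by
  rw [mB_apply] at *
  have h1 := sq_sum_le x y
  have h2 := sum_sq_nonneg x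
  have h3 := sum_sq_nonneg y
  have h4 : (∑ i : Fin 4, x i.succ * y i.succ) ^ 2 < (x 0 * y 0) ^ 2 := by
    refine h1.trans_lt ?_
    rw [mul_pow]
    refine (mul_le_mul_of_nonneg_left (by linarith) h2).trans_lt
      (mul_lt_mul_of_pos_right (by linarith : _ < x 0 ^ 2) (by positivity : (0 : ℝ) < y 0 ^ 2))
  have h5 := abs_lt_of_sq_lt_sq h4 (by positivity)
  linarith [(abs_lt.1 h5).2]

theorem mB_self_pos_of_orthogonal {x y : EuclideanSpace ℝ (Fin (4 + 1))} (hx : mB x x < 0)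
    (h : mB x y = 0) (hy : y ≠ 0) : 0 < mB y y := by
  by_contra hcon
  push Not at hcon
  apply hy
  rw [mB_apply] at *
  have h1 := sq_sum_le x y
  have h2 := sum_sq_nonneg x
  have h3 := sum_sq_nonneg y
  have h4 : ∑ i : Fin 4, x i.succ * y i.succ = x 0 * y 0 := by linarith
  rw [h4] at h1
  have h5 : y 0 = 0 := by
    by_contra h0
    have h6 : 0 < y 0 * y 0 := mul_self_pos.2 h0
    nlinarith
  have h6 : ∑ i : Fin 4, y i.succ * y i.succ = 0 := by
    rw [h5] at hcon
    linarith
  rw [Finset.sum_eq_zero_iff_of_nonneg fun _ _ => mul_self_nonneg _] at h6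
  ext i
  refine Fin.cases h5 (fun j => ?_) i
  simpa using h6 j (Finset.mem_univ j)

theorem zero_coord_ne {x : EuclideanSpace ℝ (Fin (4 + 1))} (hx : mB x x ≤ 0) (hx0 : x ≠ 0) :
    x 0 ≠ 0 := by
  intro h
  apply hx0
  rw [mB_apply, h] at hx
  have h6 : ∑ i : Fin 4, x i.succ * x i.succ = 0 :=
    le_antisymm (by linarith) (sum_sq_nonneg x)
  rw [Finset.sum_eq_zero_iff_of_nonneg fun _ _ => mul_self_nonneg _] at h6
  ext i
  refine Fin.cases h (fun j => ?_) i
  simpa using h6 j (Finset.mem_univ j)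

theorem mB_hyp (x : hypSet 4) : mB x.1 x.1 = -1 := x.2.1

theorem hyp_pos (x : hypSet 4) : 0 < x.1 0 := x.2.2

theorem mB_hyp_neg {y : EuclideanSpace ℝ (Fin (4 + 1))} (x : hypSet 4) (hy : mB y y ≤ 0)
    (hy0 : 0 < y 0) : mB y x.1 < 0 := by
  rw [mB_comm]
  exact mB_neg (by rw [mB_hyp]; norm_num) (hyp_pos x) hy hy0

theorem pos_of_mB_hyp_neg {y : EuclideanSpace ℝ (Fin (4 + 1))} (x : hypSet 4) (hy : mB y y ≤ 0)
    (h : mB y x.1 < 0) : 0 < y 0 := by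
  by_contra hcon
  have h0 : y ≠ 0 := by rintro rfl; simp at h
  have h1 := zero_coord_ne hy h0
  have h2 : mB (-y) x.1 < 0 := mB_hyp_neg x (by simpa using hy) (by
    have := lt_of_le_of_ne (not_lt.1 hcon) h1
    simpa using this)
  simp at h2
  linarith

theorem mem_hHalf {v : EuclideanSpace ℝ (Fin (4 + 1))} {x : hypSet 4} :
    x ∈ hHalf 4 v ↔ mB v x.1 ≤ 0 := Iff.rfl

theorem mem_hWall {v : EuclideanSpace ℝ (Fin (4 + 1))} {x : hypSet 4} :
    x ∈ hWall 4 v ↔ mB v x.1 = 0 := Iff.rfl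

theorem exists_smul_mem_hypSet {y : EuclideanSpace ℝ (Fin (4 + 1))} (hy : mB y y < 0)
    (hy0 : 0 < y 0) : ∃ s : ℝ, 0 < s ∧ s • y ∈ hypSet 4 := by
  have h : 0 < Real.sqrt (-mB y y) := Real.sqrt_pos.2 (by linarith)
  refine ⟨(Real.sqrt (-mB y y))⁻¹, by positivity, ?_, ?_⟩
  · rw [mink_eq_mB, map_smul, map_smul, LinearMap.smul_apply, smul_eq_mul, smul_eq_mul]
    have h2 : Real.sqrt (-mB y y) * Real.sqrt (-mB y y) = -mB y y :=
      Real.mul_self_sqrt (by linarith)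
    field_simp
    linarith
  · simp only [PiLp.smul_apply, smul_eq_mul]
    positivity

/-- Neighbourhoods in the hyperboloid contain points in all nearby directions. -/
theorem eventually_exists_mem {x : hypSet 4} {U : Set (hypSet 4)} (hU : U ∈ 𝓝 x)
    (d : EuclideanSpace ℝ (Fin (4 + 1))) :
    ∀ᶠ s in 𝓝 (0 : ℝ), ∃ y ∈ U, ∃ c : ℝ, 0 < c ∧ y.1 = c • (x.1 + s • d) := by
  rw [mem_nhds_subtype] at hU
  obtain ⟨W, hW, hWU⟩ := hU
  have hc1 : Continuous fun s : ℝ => mB (x.1 + s • d) (x.1 + s • d) :=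
    continuous_mB_self.comp (by fun_prop)
  have h1 : ∀ᶠ s in 𝓝 (0 : ℝ), mB (x.1 + s • d) (x.1 + s • d) < 0 := by
    have := hc1.tendsto 0
    simp only [zero_smul, add_zero, mB_hyp] at this
    exact this.eventually (gt_mem_nhds (by norm_num))
  have h2 : ∀ᶠ s in 𝓝 (0 : ℝ), 0 < (x.1 + s • d) 0 := by
    have hc : Continuous fun s : ℝ => (x.1 + s • d) 0 := by
      simp only [PiLp.add_apply, PiLp.smul_apply]
      fun_prop
    have := hc.tendsto 0
    simp only [zero_smul, add_zero] at this
    exact this.eventually (lt_mem_nhds (hyp_pos x))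
  have h3 : ContinuousAt (fun s : ℝ => (Real.sqrt (-mB (x.1 + s • d) (x.1 + s • d)))⁻¹ •
      (x.1 + s • d)) 0 := by
    have h5 : ContinuousAt (fun s : ℝ => (Real.sqrt (-mB (x.1 + s • d) (x.1 + s • d)))⁻¹) 0 :=
      ContinuousAt.inv₀ (Real.continuous_sqrt.comp hc1.neg).continuousAt (by simp [mB_hyp])
    exact h5.smul (by fun_prop : Continuous fun s : ℝ => x.1 + s • d).continuousAt
  have h4 : ∀ᶠ s in 𝓝 (0 : ℝ), (Real.sqrt (-mB (x.1 + s • d) (x.1 + s • d)))⁻¹ •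
      (x.1 + s • d) ∈ W := by
    refine h3.eventually ?_
    simpa [mB_hyp] using hW
  filter_upwards [h1, h2, h4] with s a1 a2 a4
  have h : 0 < Real.sqrt (-mB (x.1 + s • d) (x.1 + s • d)) := Real.sqrt_pos.2 (by linarith)
  refine ⟨⟨_, ?_, ?_⟩, hWU a4, _, inv_pos.2 h, rfl⟩
  · rw [mink_eq_mB, map_smul, map_smul, LinearMap.smul_apply, smul_eq_mul, smul_eq_mul]
    have h2 : Real.sqrt (-mB (x.1 + s • d) (x.1 + s • d)) *
      Real.sqrt (-mB (x.1 + s • d) (x.1 + s • d)) = -mB (x.1 + s • d) (x.1 + s • d) :=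
      Real.mul_self_sqrt (by linarith)
    field_simp
    linarith
  · show 0 < (_ • (x.1 + s • d)) 0
    rw [PiLp.smul_apply, smul_eq_mul]
    positivity

theorem mB_neg_of_mem_interior {v : EuclideanSpace ℝ (Fin (4 + 1))} (hv : mB v v = 1)
    {x : hypSet 4} (hx : x ∈ interior (hHalf 4 v)) : mB v x.1 < 0 := by
  have h := (eventually_exists_mem (mem_interior_iff_mem_nhds.1 hx) v).filter_mono
    (nhdsWithin_le_nhds (s := Ioi 0))
  obtain ⟨s, ⟨y, hy, c, hc, hyc⟩, hs⟩ := (h.and self_mem_nhdsWithin).exists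
  have hs : 0 < s := hs
  rw [mem_hHalf, hyc, map_smul, map_add, map_smul, hv, smul_eq_mul, smul_eq_mul, mul_one] at hy
  have : mB v x.1 + s ≤ 0 := nonpos_of_mul_nonpos_right hy hc
  linarith

theorem isOpen_setOf_mB_neg (v : EuclideanSpace ℝ (Fin (4 + 1))) :
    IsOpen {x : hypSet 4 | mB v x.1 < 0} :=
  isOpen_lt ((continuous_mB_right v).comp continuous_subtype_val) continuous_const

/-- A functional vanishing on the orthogonal complement of a unit vector is a multiple of it. -/
theorem eq_smul_of_forall_orthogonal {u v : EuclideanSpace ℝ (Fin (4 + 1))} (hv : mB v v = 1)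
    (key : ∀ d, mB v d = 0 → mB u d = 0) : u = (mB u v) • v := by
  rw [← sub_eq_zero]
  refine eq_zero_of_forall_mB fun y => ?_
  have := key (y - (mB v y) • v) (by rw [map_sub, map_smul, hv]; simp)
  rw [map_sub, map_smul, smul_eq_mul] at this
  rw [map_sub, LinearMap.sub_apply, map_smul, LinearMap.smul_apply, smul_eq_mul]
  linarith

/-- The unit normal of a hyperplane is unique up to sign. -/
theorem eq_or_eq_neg_of_hWall_eq {u v : EuclideanSpace ℝ (Fin (4 + 1))} (hu : mB u u = 1)
    (hv : mB v v = 1) (h : hWall 4 u = hWall 4 v) : u = v ∨ u = -v := by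
  -- a point of the hyperplane of `v`
  obtain ⟨x, hx⟩ : ∃ x : hypSet 4, mB v x.1 = 0 := by
    set e : EuclideanSpace ℝ (Fin (4 + 1)) := EuclideanSpace.single 0 1 with he
    have hee : mB e e = -1 := by simp [mB_apply, he]
    set y := e - (mB v e) • v with hy
    have h1 : mB v y = 0 := by rw [hy, map_sub, map_smul, hv]; simp
    have h2 : mB y y < 0 := by
      have : mB y y = mB e y := by
        calc mB y y = mB (e - (mB v e) • v) y := by rw [← hy]
          _ = mB e y := by
            rw [LinearMap.map_sub₂, LinearMap.map_smul₂, h1, smul_zero, sub_zero]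
      rw [this, hy, map_sub, map_smul, hee, mB_comm e v, smul_eq_mul]
      nlinarith [mul_self_nonneg (mB v e)]
    have h3 : y ≠ 0 := by rintro h; rw [h] at h2; simp at h2
    rcases lt_or_gt_of_ne (zero_coord_ne h2.le h3) with h4 | h4
    · obtain ⟨s, -, h5⟩ := exists_smul_mem_hypSet (y := -y) (by simpa using h2) (by simpa using h4)
      exact ⟨⟨_, h5⟩, by simp [h1]⟩
    · obtain ⟨s, -, h5⟩ := exists_smul_mem_hypSet h2 h4
      exact ⟨⟨_, h5⟩, by simp [h1]⟩
  have hux : mB u x.1 = 0 := by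
    have : x ∈ hWall 4 v := hx
    rwa [← h] at this
  have key : ∀ d, mB v d = 0 → mB u d = 0 := by
    intro d hd
    have h1 := (eventually_exists_mem (x := x) univ_mem d).filter_mono
      (nhdsWithin_le_nhds (s := Ioi 0))
    obtain ⟨s, ⟨y, -, c, hc, hyc⟩, hs⟩ := (h1.and self_mem_nhdsWithin).exists
    have hs : 0 < s := hs
    have h2 : y ∈ hWall 4 v := by
      rw [mem_hWall, hyc, map_smul, map_add, map_smul, hx, hd]; simp
    rw [← h, mem_hWall, hyc, map_smul, map_add, map_smul, hux, zero_add, smul_eq_mul,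
      smul_eq_mul] at h2
    rcases mul_eq_zero.1 h2 with h3 | h3
    · exact absurd h3 hc.ne'
    · exact (mul_eq_zero.1 h3).resolve_left hs.ne'
  have h3 : u = (mB u v) • v := eq_smul_of_forall_orthogonal hv key
  have h4 : mB u v * mB u v = 1 := by
    have := hu
    nth_rewrite 1 [h3] at this
    rwa [map_smul, LinearMap.smul_apply, smul_eq_mul, mB_comm v u] at this
  rcases mul_self_eq_one_iff.1 h4 with h5 | h5
  · left; rw [h3, h5, one_smul]
  · right; rw [h3, h5, neg_one_smul]

end Minkowski

section Frames

open Filter Topology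

/-- Vectors of Minkowski space. -/
abbrev V5 : Type := EuclideanSpace ℝ (Fin (4 + 1))

/-- `G` is the Gram matrix of the normals and `K` the Gram matrix of the dual vertex vectors of a
simplex. -/
structure SimplexData (G K : Matrix (Fin 5) (Fin 5) ℝ) : Prop where
  mul_eq : G * K = 1
  symm : ∀ i j, G i j = G j i
  diag : ∀ i, G i i = 1
  neg : ∀ i j, i ≠ j → K i j < 0
  nonpos : ∀ i, K i i ≤ 0

theorem SimplexData.le {G K : Matrix (Fin 5) (Fin 5) ℝ} (h : SimplexData G K) (i j : Fin 5) :
    K i j ≤ 0 := by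
  by_cases hij : i = j
  · exact hij ▸ h.nonpos i
  · exact (h.neg i j hij).le

/-- Linear combinations of the vertex vectors. -/
def lc (k : Fin 5 → V5) (a : Fin 5 → ℝ) : V5 := ∑ i, a i • k i

/-- Outward normals in terms of the vertex vectors. -/
def nrm (G : Matrix (Fin 5) (Fin 5) ℝ) (k : Fin 5 → V5) (i : Fin 5) : V5 := lc k fun j => -G i j

theorem lc_add (k : Fin 5 → V5) (a b : Fin 5 → ℝ) : lc k (a + b) = lc k a + lc k b := by
  simp [lc, add_smul, Finset.sum_add_distrib]

theorem lc_smul (k : Fin 5 → V5) (c : ℝ) (a : Fin 5 → ℝ) : lc k (c • a) = c • lc k a := by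
  simp [lc, Finset.smul_sum, mul_smul]

theorem lc_single (k : Fin 5 → V5) (i : Fin 5) (c : ℝ) : lc k (Pi.single i c) = c • k i := by
  simp [lc, Pi.single_apply, ite_smul]

theorem mB_lc (u : V5) (k : Fin 5 → V5) (a : Fin 5 → ℝ) :
    mB u (lc k a) = ∑ i, a i * mB u (k i) := by
  simp [lc, map_sum]

theorem lc_coord (k : Fin 5 → V5) (a : Fin 5 → ℝ) (l : Fin (4 + 1)) :
    lc k a l = ∑ i, a i * k i l := by
  simp [lc]

theorem continuous_lc (k : Fin 5 → V5) : Continuous (lc k) := by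
  unfold lc
  fun_prop

theorem exists_pos_of_ne_zero {a : Fin 5 → ℝ} (ha : ∀ i, 0 ≤ a i) (h : a ≠ 0) : ∃ i, 0 < a i := by
  by_contra hc
  push Not at hc
  exact h (funext fun i => le_antisymm (hc i) (ha i))

theorem pos_of_mB_neg {x y : V5} (hx : mB x x ≤ 0) (hx0 : 0 < x 0) (hy : mB y y < 0)
    (h : mB x y < 0) : 0 < y 0 := by
  have h1 : y ≠ 0 := by rintro rfl; simp at hy
  by_contra hcon
  have h2 := mB_neg (x := -y) (y := x) (by simpa using hy) (by
    have := lt_of_le_of_ne (not_lt.1 hcon) (zero_coord_ne hy.le h1)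
    simpa using this) hx hx0
  rw [map_neg, LinearMap.neg_apply, mB_comm] at h2
  linarith

section Gram

variable {G K : Matrix (Fin 5) (Fin 5) ℝ} {k : Fin 5 → V5}

theorem mB_lc_lc (hk : ∀ i j, mB (k i) (k j) = K i j) (a b : Fin 5 → ℝ) :
    mB (lc k a) (lc k b) = ∑ i, ∑ j, a i * b j * K i j := by
  rw [mB_lc, Finset.sum_comm]
  refine Finset.sum_congr rfl fun j _ => ?_
  rw [mB_comm, mB_lc, Finset.mul_sum]
  refine Finset.sum_congr rfl fun i _ => ?_
  rw [mB_comm, hk]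
  ring

theorem mB_nrm (hS : SimplexData G K) (hk : ∀ i j, mB (k i) (k j) = K i j) (i j : Fin 5) :
    mB (nrm G k i) (k j) = if i = j then -1 else 0 := by
  have h : (G * K) i j = (1 : Matrix (Fin 5) (Fin 5) ℝ) i j := by rw [hS.mul_eq]
  rw [Matrix.mul_apply, Matrix.one_apply] at h
  rw [mB_comm, nrm, mB_lc]
  simp only [mB_comm (k j), hk, neg_mul, Finset.sum_neg_distrib, h]
  split_ifs <;> simp

theorem mB_nrm_lc (hS : SimplexData G K) (hk : ∀ i j, mB (k i) (k j) = K i j) (i : Fin 5)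
    (a : Fin 5 → ℝ) : mB (nrm G k i) (lc k a) = -a i := by
  rw [mB_lc]
  simp [mB_nrm hS hk]

theorem mB_nrm_nrm (hS : SimplexData G K) (hk : ∀ i j, mB (k i) (k j) = K i j) (i j : Fin 5) :
    mB (nrm G k i) (nrm G k j) = G i j := by
  conv_lhs => arg 2; rw [nrm]
  rw [mB_nrm_lc hS hk, neg_neg, hS.symm]

theorem mB_nrm_self (hS : SimplexData G K) (hk : ∀ i j, mB (k i) (k j) = K i j) (i : Fin 5) :
    mB (nrm G k i) (nrm G k i) = 1 := by
  rw [mB_nrm_nrm hS hk, hS.diag]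

theorem lc_injective (hS : SimplexData G K) (hk : ∀ i j, mB (k i) (k j) = K i j) :
    Function.Injective (lc k) := by
  intro a b h
  funext i
  have := congrArg (mB (nrm G k i)) h
  rw [mB_nrm_lc hS hk, mB_nrm_lc hS hk] at this
  linarith

theorem eq_lc (hS : SimplexData G K) (hk : ∀ i j, mB (k i) (k j) = K i j) (x : V5) :
    x = lc k fun i => -mB (nrm G k i) x := by
  have hli : LinearIndependent ℝ k := by
    rw [Fintype.linearIndependent_iff]
    intro a ha i
    have : lc k a = lc k 0 := by
      rw [show lc k a = ∑ i, a i • k i from rfl, ha]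
      simp [lc]
    exact congrFun (lc_injective hS hk this) i
  have hspan := hli.span_eq_top_of_card_eq_finrank' (by simp)
  have hx : x ∈ Submodule.span ℝ (Set.range k) := by rw [hspan]; trivial
  rw [Submodule.mem_span_range_iff_exists_fun] at hx
  obtain ⟨a, ha⟩ := hx
  have ha : x = lc k a := ha.symm
  rw [ha]
  congr 1
  funext i
  rw [mB_nrm_lc hS hk, neg_neg]

theorem eq_smul_nrm (hS : SimplexData G K) (hk : ∀ i j, mB (k i) (k j) = K i j) {u : V5}
    {i : Fin 5} (h : ∀ l, l ≠ i → mB u (k l) = 0) : u = (-mB u (k i)) • nrm G k i := by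
  rw [← sub_eq_zero]
  refine eq_zero_of_forall_mB fun y => ?_
  rw [eq_lc hS hk y, LinearMap.map_sub₂, LinearMap.map_smul₂, mB_nrm_lc hS hk, mB_lc,
    Finset.sum_eq_single i (fun l _ hl => by rw [h l hl, mul_zero]) (by simp)]
  simp only [smul_eq_mul]
  ring

theorem lc_pos (hp : ∀ i, 0 < k i 0) {a : Fin 5 → ℝ} (ha : ∀ i, 0 ≤ a i) {i : Fin 5}
    (hi : 0 < a i) : 0 < lc k a 0 := by
  rw [lc_coord]
  exact Finset.sum_pos' (fun j _ => mul_nonneg (ha j) (hp j).le)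
    ⟨i, Finset.mem_univ i, mul_pos hi (hp i)⟩

theorem mB_lc_self_neg (hS : SimplexData G K) (hk : ∀ i j, mB (k i) (k j) = K i j)
    {a : Fin 5 → ℝ} (ha : ∀ i, 0 ≤ a i) {i j : Fin 5} (hij : i ≠ j) (hi : 0 < a i)
    (hj : 0 < a j) : mB (lc k a) (lc k a) < 0 := by
  have h1 : ∀ p q, a p * a q * K p q ≤ 0 := fun p q =>
    mul_nonpos_of_nonneg_of_nonpos (mul_nonneg (ha p) (ha q)) (hS.le p q)
  rw [mB_lc_lc hk]
  refine Finset.sum_neg' (fun p _ => Finset.sum_nonpos fun q _ => h1 p q)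
    ⟨i, Finset.mem_univ i, Finset.sum_neg' (fun q _ => h1 i q) ⟨j, Finset.mem_univ j, ?_⟩⟩
  exact mul_neg_of_pos_of_neg (mul_pos hi hj) (hS.neg i j hij)

/-- Normalizing a timelike nonnegative combination. -/
theorem exists_hyp_of_neg (hp : ∀ i, 0 < k i 0) {a : Fin 5 → ℝ} (ha : ∀ i, 0 ≤ a i)
    (h : mB (lc k a) (lc k a) < 0) : ∃ s : ℝ, 0 < s ∧ ∃ x : hypSet 4, x.1 = lc k (s • a) := by
  obtain ⟨i, hi⟩ := exists_pos_of_ne_zero ha (by rintro rfl; simp [lc] at h)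
  obtain ⟨s, hs, hx⟩ := exists_smul_mem_hypSet h (lc_pos hp ha hi)
  exact ⟨s, hs, ⟨_, hx⟩, (lc_smul k s a).symm⟩

/-- A functional vanishing on a face (with at least two vertices) vanishes on its vertices. -/
theorem mB_eq_zero_of_face (hS : SimplexData G K) (hk : ∀ i j, mB (k i) (k j) = K i j)
    (hp : ∀ i, 0 < k i 0) (N : Set (Fin 5)) {p q : Fin 5} (hpq : p ≠ q) (hpN : p ∉ N)
    (hqN : q ∉ N) {u : V5}
    (hu : ∀ x : hypSet 4, (∃ a, (∀ i, 0 ≤ a i) ∧ (∀ i ∈ N, a i = 0) ∧ x.1 = lc k a) →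
      mB u x.1 = 0) {l : Fin 5} (hl : l ∉ N) : mB u (k l) = 0 := by
  classical
  have key : ∀ a : Fin 5 → ℝ, (∀ i, 0 ≤ a i) → (∀ i ∈ N, a i = 0) → 0 < a p → 0 < a q →
      mB u (lc k a) = 0 := by
    intro a ha haN hap haq
    obtain ⟨s, hs, x, hx⟩ := exists_hyp_of_neg hp ha (mB_lc_self_neg hS hk ha hpq hap haq)
    have h1 := hu x ⟨s • a, fun i => mul_nonneg hs.le (ha i),
      fun i hi => by simp [haN i hi], hx⟩
    rw [hx, lc_smul, map_smul, smul_eq_mul] at h1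
    exact (mul_eq_zero.1 h1).resolve_left hs.ne'
  have h1 := key (fun i => if i ∈ N then 0 else 1) (fun i => by split_ifs <;> norm_num)
    (fun i hi => by simp [hi]) (by simp [hpN]) (by simp [hqN])
  have hs0 : ∀ i, 0 ≤ (Pi.single l 1 : Fin 5 → ℝ) i := fun i => by
    by_cases h : i = l
    · subst h; simp
    · simp [h]
  have h2 := key ((fun i => if i ∈ N then 0 else 1) + Pi.single l 1)
    (fun i => add_nonneg (by dsimp only; split_ifs <;> norm_num) (hs0 i))
    (fun i hi => by
      have : i ≠ l := by rintro rfl; exact hl hi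
      simp [hi, this])
    (add_pos_of_pos_of_nonneg (by simp [hpN]) (hs0 p))
    (add_pos_of_pos_of_nonneg (by simp [hqN]) (hs0 q))
  rw [lc_add, map_add, h1, lc_single, one_smul, zero_add] at h2
  exact h2

/-- The closure of the cone over a face (with at least two vertices). -/
theorem mem_closure_hCone_face (hS : SimplexData G K) (hk : ∀ i j, mB (k i) (k j) = K i j)
    (hp : ∀ i, 0 < k i 0) (N : Set (Fin 5)) {p q : Fin 5} (hpq : p ≠ q) (hpN : p ∉ N)
    (hqN : q ∉ N) {S : Set (hypSet 4)}
    (hmem : ∀ x : hypSet 4, x ∈ S ↔ ∃ a, (∀ i, 0 ≤ a i) ∧ (∀ i ∈ N, a i = 0) ∧ x.1 = lc k a)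
    (w : V5) : w ∈ closure (hCone 4 S) ↔ ∃ a, (∀ i, 0 ≤ a i) ∧ (∀ i ∈ N, a i = 0) ∧
      w = lc k a := by
  classical
  constructor
  · intro hw
    have hc : IsClosed {w : V5 | ∀ i, mB (nrm G k i) w ≤ 0 ∧ (i ∈ N → mB (nrm G k i) w = 0)} := by
      simp only [ofPred_forall, ofPred_and]
      exact isClosed_iInter fun i => (isClosed_le (continuous_mB_right _) continuous_const).inter
        (isClosed_iInter fun _ => isClosed_eq (continuous_mB_right _) continuous_const)
    have hw' := closure_minimal (t := {w : V5 | ∀ i, mB (nrm G k i) w ≤ 0 ∧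
      (i ∈ N → mB (nrm G k i) w = 0)}) ?_ hc hw
    · refine ⟨_, fun i => ?_, fun i hi => ?_, eq_lc hS hk w⟩
      · have := (hw' i).1
        simpa using this
      · rw [(hw' i).2 hi, neg_zero]
    · rintro _ ⟨x, hx, t, ht, rfl⟩ i
      obtain ⟨a, ha, haN, hxa⟩ := (hmem x).1 hx
      rw [hxa, map_smul, mB_nrm_lc hS hk, smul_eq_mul]
      refine ⟨mul_nonpos_of_nonneg_of_nonpos ht.le (neg_nonpos.2 (ha i)), fun hi => ?_⟩
      rw [haN i hi, neg_zero, mul_zero]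
  · rintro ⟨a, ha, haN, rfl⟩
    have hlim : Tendsto (fun ε : ℝ => lc k (a + ε • fun i => if i ∈ N then 0 else 1)) (𝓝[>] 0)
        (𝓝 (lc k a)) := by
      have hcont : Continuous fun ε : ℝ => lc k (a + ε • fun i => if i ∈ N then 0 else 1) :=
        (continuous_lc k).comp (by fun_prop)
      have := hcont.tendsto 0
      rw [zero_smul, add_zero] at this
      exact this.mono_left nhdsWithin_le_nhds
    refine mem_closure_of_tendsto hlim ?_
    filter_upwards [self_mem_nhdsWithin] with ε (hε : 0 < ε)
    set b : Fin 5 → ℝ := a + ε • fun i => if i ∈ N then 0 else 1 with hb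
    have hb0 : ∀ i, 0 ≤ b i := fun i => by
      simp only [hb, Pi.add_apply, Pi.smul_apply, smul_eq_mul]
      refine add_nonneg (ha i) (mul_nonneg hε.le ?_)
      split_ifs <;> norm_num
    have hbN : ∀ i ∈ N, b i = 0 := fun i hi => by simp [hb, haN i hi, hi]
    have hbpos : ∀ i ∉ N, 0 < b i := fun i hi => by
      simp only [hb, Pi.add_apply, Pi.smul_apply, smul_eq_mul, if_neg hi, mul_one]
      linarith [ha i]
    obtain ⟨s, hs, x, hx⟩ := exists_hyp_of_neg hp hb0
      (mB_lc_self_neg hS hk hb0 hpq (hbpos p hpN) (hbpos q hqN))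
    refine ⟨x, (hmem x).2 ⟨s • b, fun i => mul_nonneg hs.le (hb0 i), fun i hi => ?_, hx⟩, s⁻¹,
      inv_pos.2 hs, ?_⟩
    · simp [hbN i hi]
    · rw [hx, lc_smul, smul_smul, inv_mul_cancel₀ hs.ne', one_smul]

end Gram

end Frames

section FrameStructure

open Filter Topology

/-- `T` is the simplex with vertex vectors `k`, whose Gram matrix is `K`. -/
structure Frame (K : Matrix (Fin 5) (Fin 5) ℝ) (T : Set (hypSet 4)) (k : Fin 5 → V5) : Prop where
  gram : ∀ i j, mB (k i) (k j) = K i j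
  pos : ∀ i, 0 < k i 0
  mem : ∀ x : hypSet 4, x ∈ T ↔ ∃ a, (∀ i, 0 ≤ a i) ∧ x.1 = lc k a

variable {G K : Matrix (Fin 5) (Fin 5) ℝ} {T : Set (hypSet 4)} {k : Fin 5 → V5}

/-- The simplex spanned by the vectors `k`. -/
def spanned (k : Fin 5 → V5) : Set (hypSet 4) := {x | ∃ a, (∀ i, 0 ≤ a i) ∧ x.1 = lc k a}

theorem frame_spanned (hg : ∀ i j, mB (k i) (k j) = K i j) (hp : ∀ i, 0 < k i 0) :
    Frame K (spanned k) k := ⟨hg, hp, fun _ => Iff.rfl⟩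

theorem Frame.eq_spanned (hT : Frame K T k) : T = spanned k := by
  ext x; exact hT.mem x

theorem Frame.mem_iff (hS : SimplexData G K) (hT : Frame K T k) (x : hypSet 4) :
    x ∈ T ↔ ∀ i, mB (nrm G k i) x.1 ≤ 0 := by
  rw [hT.mem]
  constructor
  · rintro ⟨a, ha, hx⟩ i
    rw [hx, mB_nrm_lc hS hT.gram]
    exact neg_nonpos.2 (ha i)
  · intro h
    exact ⟨_, fun i => neg_nonneg.2 (h i), eq_lc hS hT.gram x.1⟩

theorem Frame.eq_iInter (hS : SimplexData G K) (hT : Frame K T k) :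
    T = ⋂ i, hHalf 4 (nrm G k i) := by
  ext x
  rw [hT.mem_iff hS, mem_iInter]
  rfl

theorem Frame.mem_facet (hS : SimplexData G K) (hT : Frame K T k) (i : Fin 5) (x : hypSet 4) :
    x ∈ T ∩ hWall 4 (nrm G k i) ↔
      ∃ a, (∀ j, 0 ≤ a j) ∧ (∀ j ∈ ({i} : Set (Fin 5)), a j = 0) ∧ x.1 = lc k a := by
  rw [mem_inter_iff, hT.mem, mem_hWall]
  constructor
  · rintro ⟨⟨a, ha, hx⟩, h⟩
    refine ⟨a, ha, ?_, hx⟩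
    rintro _ rfl
    rw [hx, mB_nrm_lc hS hT.gram] at h
    linarith
  · rintro ⟨a, ha, h, hx⟩
    refine ⟨⟨a, ha, hx⟩, ?_⟩
    rw [hx, mB_nrm_lc hS hT.gram, h i rfl, neg_zero]

theorem exists_two_ne (i : Fin 5) : ∃ p q : Fin 5, p ≠ q ∧ p ∉ ({i} : Set (Fin 5)) ∧
    q ∉ ({i} : Set (Fin 5)) := by
  simp only [mem_singleton_iff]
  revert i
  decide

theorem Frame.mB_eq_zero_of_facet (hS : SimplexData G K) (hT : Frame K T k) {i : Fin 5} {u : V5}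
    (hu : T ∩ hWall 4 (nrm G k i) ⊆ hWall 4 u) {l : Fin 5} (hl : l ≠ i) : mB u (k l) = 0 := by
  obtain ⟨p, q, hpq, hp, hq⟩ := exists_two_ne i
  exact mB_eq_zero_of_face hS hT.gram hT.pos {i} hpq hp hq
    (fun x hx => hu ((hT.mem_facet hS i x).2 hx)) hl

theorem hWall_eq_of_eq_smul {u v : V5} (hu : mB u u = 1) {c : ℝ} (h : u = c • v) :
    hWall 4 u = hWall 4 v := by
  have hc : c ≠ 0 := by rintro rfl; simp [h] at hu
  ext x
  rw [mem_hWall, mem_hWall, h, LinearMap.map_smul₂, smul_eq_mul, mul_eq_zero]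
  exact or_iff_right hc

/-- A positive combination of all vertices, normalized. -/
theorem Frame.exists_interior (hS : SimplexData G K) (hT : Frame K T k) :
    ∃ x ∈ T, ∃ a, (∀ i, 0 < a i) ∧ x.1 = lc k a := by
  obtain ⟨s, hs, x, hx⟩ := exists_hyp_of_neg (k := k) hT.pos (a := fun _ => 1)
    (fun _ => zero_le_one) (mB_lc_self_neg hS hT.gram (fun _ => zero_le_one)
      (by decide : (0 : Fin 5) ≠ 1) one_pos one_pos)
  exact ⟨x, (hT.mem x).2 ⟨_, fun i => by simpa using hs.le, hx⟩, _, fun i => by simpa using hs, hx⟩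

theorem Frame.exists_facet_point (hS : SimplexData G K) (hT : Frame K T k) (i : Fin 5) :
    ∃ x ∈ T ∩ hWall 4 (nrm G k i), ∃ s : ℝ, 0 < s ∧
      x.1 = lc k (s • fun j => if j = i then 0 else 1) := by
  obtain ⟨p, q, hpq, hp, hq⟩ := exists_two_ne i
  have h0 : ∀ j, (0 : ℝ) ≤ (fun j => if j = i then 0 else 1) j := fun j => by
    dsimp only; split_ifs <;> norm_num
  obtain ⟨s, hs, x, hx⟩ := exists_hyp_of_neg (k := k) hT.pos h0
    (mB_lc_self_neg hS hT.gram h0 hpq (by simp [show p ≠ i from hp]) (by simp [show q ≠ i from hq]))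
  exact ⟨x, (hT.mem_facet hS i x).2 ⟨_, fun j => mul_nonneg hs.le (h0 j),
    by rintro _ rfl; simp, hx⟩, s, hs, hx⟩

theorem Frame.isFacet (hS : SimplexData G K) (hT : Frame K T k) (i : Fin 5) :
    hIsFacet 4 T (T ∩ hWall 4 (nrm G k i)) := by
  obtain ⟨x, hx, -⟩ := hT.exists_facet_point hS i
  refine ⟨⟨x, hx⟩, nrm G k i, mB_nrm_self hS hT.gram i,
    fun x hx => (hT.mem_iff hS x).1 hx i, rfl, fun u hu hsub => ?_⟩
  exact hWall_eq_of_eq_smul hu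
    (eq_smul_nrm hS hT.gram fun l hl => hT.mB_eq_zero_of_facet hS hsub hl)

theorem Frame.isFacet_iff (hS : SimplexData G K) (hT : Frame K T k) (S : Set (hypSet 4)) :
    hIsFacet 4 T S ↔ ∃ i, S = T ∩ hWall 4 (nrm G k i) := by
  constructor
  · rintro ⟨⟨x, hx⟩, v, hv, hTv, hSv, hun⟩
    have hv0 : v ≠ 0 := by
      rintro rfl
      rw [mink_eq_mB, map_zero] at hv
      exact zero_ne_one hv
    have hc : ∀ j, mB v (k j) ≤ 0 := by
      intro j
      by_contra hcon
      push Not at hcon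
      set C := ∑ i, mB v (k i) with hC
      have hpos : 0 < mB v (k j) / (1 + |C|) := by positivity
      set ε := mB v (k j) / (1 + |C|) with hε
      have ha : ∀ i, 0 < ((Pi.single j 1 : Fin 5 → ℝ) + ε • 1) i := fun i => by
        by_cases h : i = j
        · subst h; simp; linarith
        · simp [h, hpos]
      obtain ⟨s, hs, y, hy⟩ := exists_hyp_of_neg (k := k) hT.pos (fun i => (ha i).le)
        (mB_lc_self_neg hS hT.gram (fun i => (ha i).le) (by decide : (0 : Fin 5) ≠ 1) (ha 0) (ha 1))
      have h1 : mB v y.1 ≤ 0 := hTv ((hT.mem y).2 ⟨_, fun i => mul_nonneg hs.le (ha i).le, hy⟩)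
      rw [hy, lc_smul, map_smul, lc_add, lc_smul, lc_single, map_add, map_smul, map_smul, mB_lc,
        smul_eq_mul, smul_eq_mul, smul_eq_mul, one_mul] at h1
      simp only [Pi.one_apply, one_mul] at h1
      have h2 := nonpos_of_mul_nonpos_right h1 hs
      rw [← hC] at h2
      have h3 : ε * (1 + |C|) = mB v (k j) := by rw [hε]; field_simp
      have h4 : ε * (-|C|) ≤ ε * C := mul_le_mul_of_nonneg_left (neg_abs_le C) hpos.le
      nlinarith
    obtain ⟨i, hi⟩ : ∃ i, mB v (k i) ≠ 0 := by
      by_contra hcon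
      push Not at hcon
      refine hv0 (eq_zero_of_forall_mB fun y => ?_)
      rw [eq_lc hS hT.gram y, mB_lc]
      simp [hcon]
    have hsub : S ⊆ hWall 4 (nrm G k i) := by
      intro y hy
      rw [hSv] at hy
      obtain ⟨a, ha, hya⟩ := (hT.mem y).1 hy.1
      have h1 : mB v y.1 = 0 := hy.2
      rw [hya, mB_lc, Finset.sum_eq_zero_iff_of_nonpos fun j _ =>
        mul_nonpos_of_nonneg_of_nonpos (ha j) (hc j)] at h1
      have h2 := (mul_eq_zero.1 (h1 i (Finset.mem_univ i))).resolve_right hi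
      rw [mem_hWall, hya, mB_nrm_lc hS hT.gram, h2, neg_zero]
    exact ⟨i, by rw [hSv, hun _ (mB_nrm_self hS hT.gram i) hsub]⟩
  · rintro ⟨i, rfl⟩
    exact hT.isFacet hS i

theorem Frame.facet_injective (hS : SimplexData G K) (hT : Frame K T k) {i j : Fin 5}
    (h : T ∩ hWall 4 (nrm G k i) = T ∩ hWall 4 (nrm G k j)) : i = j := by
  by_contra hij
  have := hT.mB_eq_zero_of_facet hS (i := i) (u := nrm G k j) (h ▸ inter_subset_right)
    (l := j) (Ne.symm hij)
  rw [mB_nrm hS hT.gram, if_pos rfl] at this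
  norm_num at this

theorem Frame.mem_interior (hS : SimplexData G K) (hT : Frame K T k) (x : hypSet 4) :
    x ∈ interior T ↔ ∀ i, mB (nrm G k i) x.1 < 0 := by
  constructor
  · intro hx i
    refine mB_neg_of_mem_interior (mB_nrm_self hS hT.gram i) (interior_mono ?_ hx)
    exact fun y hy => (hT.mem_iff hS y).1 hy i
  · intro h
    have ho : IsOpen (⋂ i, {x : hypSet 4 | mB (nrm G k i) x.1 < 0}) :=
      isOpen_iInter_of_finite fun i => isOpen_setOf_mB_neg _
    refine _root_.mem_interior.2 ⟨_, fun y hy => ?_, ho, mem_iInter.2 h⟩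
    exact (hT.mem_iff hS y).2 fun i => (mem_iInter.1 hy i : mB (nrm G k i) y.1 < 0).le

theorem Frame.mem_interior_of_eq (hS : SimplexData G K) (hT : Frame K T k) {x : hypSet 4}
    {a : Fin 5 → ℝ} (hx : x.1 = lc k a) : x ∈ interior T ↔ ∀ i, 0 < a i := by
  rw [hT.mem_interior hS]
  simp only [hx, mB_nrm_lc hS hT.gram, neg_lt_zero]

theorem Frame.mem_closure_hCone (hS : SimplexData G K) (hT : Frame K T k) (w : V5) :
    w ∈ closure (hCone 4 T) ↔ ∃ a, (∀ i, 0 ≤ a i) ∧ w = lc k a := by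
  rw [mem_closure_hCone_face hS hT.gram hT.pos ∅ (by decide : (0 : Fin 5) ≠ 1) (by simp) (by simp)
    (by simpa using hT.mem)]
  simp

theorem Frame.mem_closure_hCone_facet (hS : SimplexData G K) (hT : Frame K T k) (i : Fin 5)
    (w : V5) : w ∈ closure (hCone 4 (T ∩ hWall 4 (nrm G k i))) ↔
      ∃ a, (∀ j, 0 ≤ a j) ∧ a i = 0 ∧ w = lc k a := by
  obtain ⟨p, q, hpq, hp, hq⟩ := exists_two_ne i
  rw [mem_closure_hCone_face hS hT.gram hT.pos {i} hpq hp hq (hT.mem_facet hS i)]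
  simp

theorem Frame.mem_hIdealVerts (hS : SimplexData G K) (hT : Frame K T k) (w : V5) :
    w ∈ hIdealVerts 4 T ↔ ∃ i, K i i = 0 ∧ w = (k i 0)⁻¹ • k i := by
  constructor
  · rintro ⟨h1, h2, h3⟩
    obtain ⟨a, ha, rfl⟩ := (hT.mem_closure_hCone hS w).1 h3
    obtain ⟨i, hi⟩ := exists_pos_of_ne_zero ha (by rintro rfl; simp [lc] at h2)
    have hz : ∀ j, j ≠ i → a j = 0 := by
      intro j hj
      by_contra hcon
      have := mB_lc_self_neg hS hT.gram ha hj ((ha j).lt_of_ne' hcon) hi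
      rw [← mink_eq_mB, h1] at this
      exact lt_irrefl _ this
    have hs : a = Pi.single i (a i) := by
      funext j
      by_cases hj : j = i
      · subst hj; simp
      · simp [hj, hz j hj]
    rw [hs, lc_single] at h1 h2 ⊢
    rw [mink_eq_mB, map_smul, LinearMap.map_smul₂, hT.gram, smul_eq_mul, smul_eq_mul] at h1
    rw [PiLp.smul_apply, smul_eq_mul] at h2
    refine ⟨i, ?_, ?_⟩
    · simpa [hi.ne'] using h1
    · congr 1
      exact eq_inv_of_mul_eq_one_left h2
  · rintro ⟨i, hi, rfl⟩
    have h0 := hT.pos i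
    refine ⟨?_, ?_, (hT.mem_closure_hCone hS _).2 ⟨Pi.single i (k i 0)⁻¹, fun j => ?_, ?_⟩⟩
    · rw [mink_eq_mB, map_smul, LinearMap.map_smul₂, hT.gram, hi, smul_zero, smul_zero]
    · rw [PiLp.smul_apply, smul_eq_mul, inv_mul_cancel₀ h0.ne']
    · by_cases hj : j = i
      · subst hj; simpa using h0.le
      · simp [hj]
    · rw [lc_single]

theorem Frame.reindex (hT : Frame K T k) (σ : Equiv.Perm (Fin 5)) :
    Frame (K.submatrix σ σ) T (k ∘ σ) := by
  refine ⟨fun i j => hT.gram _ _, fun i => hT.pos _, fun x => ?_⟩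
  rw [hT.mem]
  constructor
  · rintro ⟨a, ha, hx⟩
    refine ⟨a ∘ σ, fun i => ha _, hx.trans ?_⟩
    exact (Equiv.sum_comp σ fun i => a i • k i).symm
  · rintro ⟨a, ha, hx⟩
    refine ⟨a ∘ σ.symm, fun i => ha _, hx.trans ?_⟩
    rw [lc, lc, ← Equiv.sum_comp σ fun i => (a ∘ σ.symm) i • k i]
    simp

end FrameStructure

section Isometries

variable {G K : Matrix (Fin 5) (Fin 5) ℝ} {T : Set (hypSet 4)} {k k' : Fin 5 → V5}

/-- Linear combinations with the same coefficients of vectors with the same Gram matrix. -/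
theorem lc_mem_hypSet (hS : SimplexData G K) (hk : ∀ i j, mB (k i) (k j) = K i j)
    (hp : ∀ i, 0 < k i 0) (hk' : ∀ i j, mB (k' i) (k' j) = K i j) (hp' : ∀ i, 0 < k' i 0)
    {x : V5} (hx : x ∈ hypSet 4) {a : Fin 5 → ℝ} (hxa : x = lc k a) : lc k' a ∈ hypSet 4 := by
  have h1 : mB (lc k' a) (lc k' a) = -1 := by
    rw [mB_lc_lc hk', ← mB_lc_lc hk, ← hxa]
    exact hx.1
  refine ⟨h1, pos_of_mB_neg (x := k' 0) (by rw [hk']; exact hS.nonpos 0) (hp' 0)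
    (by rw [h1]; norm_num) ?_⟩
  have h2 : mB (k' 0) (lc k' a) = mB (k 0) (lc k a) := by simp only [mB_lc, hk, hk']
  rw [h2, ← hxa]
  exact mB_hyp_neg ⟨x, hx⟩ (by rw [hk]; exact hS.nonpos 0) (hp 0)

/-- The isometry carrying the vertex vectors `k` to `k'`. -/
theorem exists_isom (hS : SimplexData G K) (hk : ∀ i j, mB (k i) (k j) = K i j)
    (hp : ∀ i, 0 < k i 0) (hk' : ∀ i j, mB (k' i) (k' j) = K i j) (hp' : ∀ i, 0 < k' i 0) :
    ∃ g, hIsIsom 4 g ∧ ∀ (x : hypSet 4) (a : Fin 5 → ℝ), x.1 = lc k a → (g x).1 = lc k' a := by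
  have hg : ∀ x : hypSet 4, lc k' (fun i => -mB (nrm G k i) x.1) ∈ hypSet 4 := fun x =>
    lc_mem_hypSet hS hk hp hk' hp' x.2 (eq_lc hS hk x.1)
  have hg' : ∀ x : hypSet 4, lc k (fun i => -mB (nrm G k' i) x.1) ∈ hypSet 4 := fun x =>
    lc_mem_hypSet hS hk' hp' hk hp x.2 (eq_lc hS hk' x.1)
  have key : ∀ (x : hypSet 4) (a : Fin 5 → ℝ), x.1 = lc k a →
      (⟨_, hg x⟩ : hypSet 4).1 = lc k' a := by
    intro x a hx
    suffices h : lc k' (fun i => -mB (nrm G k i) x.1) = lc k' a from h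
    congr 1
    funext i
    rw [hx, mB_nrm_lc hS hk, neg_neg]
  have key' : ∀ (x : hypSet 4) (a : Fin 5 → ℝ), x.1 = lc k' a →
      (⟨_, hg' x⟩ : hypSet 4).1 = lc k a := by
    intro x a hx
    suffices h : lc k (fun i => -mB (nrm G k' i) x.1) = lc k a from h
    congr 1
    funext i
    rw [hx, mB_nrm_lc hS hk', neg_neg]
  refine ⟨fun x => ⟨_, hg x⟩, ⟨Function.bijective_iff_has_inverse.2
    ⟨fun x => ⟨_, hg' x⟩, fun x => ?_, fun x => ?_⟩, fun x y => ?_⟩, key⟩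
  · exact Subtype.ext ((key' _ _ (key x _ (eq_lc hS hk x.1))).trans (eq_lc hS hk x.1).symm)
  · exact Subtype.ext ((key _ _ (key' x _ (eq_lc hS hk' x.1))).trans (eq_lc hS hk' x.1).symm)
  · rw [mink_eq_mB, mink_eq_mB, mB_lc_lc hk', ← mB_lc_lc hk, ← eq_lc hS hk, ← eq_lc hS hk]

/-- Points of the hyperboloid spanning the ambient space. -/
def hypPt : Fin 5 → hypSet 4 := Fin.cases
  ⟨EuclideanSpace.single 0 1, by
    constructor
    · simp [mink]
    · simp⟩
  fun i => ⟨√2 • EuclideanSpace.single 0 1 + EuclideanSpace.single i.succ 1, by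
    constructor
    · simp [mink, PiLp.single_apply]
      norm_num
    · simp⟩

/-- Coordinates with respect to `hypPt`. -/
def hypCoord : Fin 5 → V5 → ℝ := Fin.cases (fun x => x 0 - ∑ i : Fin 4, √2 * x i.succ)
  fun i x => x i.succ

theorem sum_hypCoord (x : V5) : ∑ i, hypCoord i x • (hypPt i).1 = x := by
  rw [Fin.sum_univ_succ]
  simp only [hypPt, hypCoord, Fin.cases_zero, Fin.cases_succ]
  ext l
  refine Fin.cases ?_ (fun l => ?_) l
  · simp [mul_comm]
  · simp [Pi.single_apply, Fin.succ_inj]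

theorem hypCoord_lc (a : Fin 5 → ℝ) (j : Fin 5) :
    hypCoord j (lc k a) = ∑ i, a i * hypCoord j (k i) := by
  refine Fin.cases ?_ (fun j => ?_) j
  · simp only [hypCoord, Fin.cases_zero, lc_coord, mul_sub, Finset.sum_sub_distrib, Finset.mul_sum]
    rw [Finset.sum_comm]
    simp only [mul_left_comm]
  · simp only [hypCoord, Fin.cases_succ, lc_coord]

/-- The linear extension of an isometry. -/
def linExt (g : hypSet 4 → hypSet 4) (x : V5) : V5 := ∑ i, hypCoord i x • (g (hypPt i)).1

theorem linExt_lc (g : hypSet 4 → hypSet 4) (a : Fin 5 → ℝ) :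
    linExt g (lc k a) = lc (fun i => linExt g (k i)) a := by
  simp only [linExt, hypCoord_lc]
  simp only [lc, Finset.sum_smul, Finset.smul_sum, smul_smul]
  rw [Finset.sum_comm]

theorem eq_zero_of_forall_hyp {z : V5} (h : ∀ x : hypSet 4, mB z x.1 = 0) : z = 0 := by
  refine eq_zero_of_forall_mB fun y => ?_
  rw [← sum_hypCoord y, map_sum]
  exact Finset.sum_eq_zero fun i _ => by rw [map_smul, h, smul_zero]

theorem mB_linExt_hyp {g : hypSet 4 → hypSet 4} (hg : hIsIsom 4 g) (x : V5) (y : hypSet 4) :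
    mB (linExt g x) (g y).1 = mB x y.1 := by
  conv_rhs => rw [← sum_hypCoord x]
  simp only [linExt, map_sum, LinearMap.sum_apply, map_smul, LinearMap.smul_apply]
  refine Finset.sum_congr rfl fun i _ => ?_
  rw [← mink_eq_mB, hg.2]
  rfl

theorem linExt_hyp {g : hypSet 4 → hypSet 4} (hg : hIsIsom 4 g) (x : hypSet 4) :
    linExt g x.1 = (g x).1 := by
  rw [← sub_eq_zero]
  refine eq_zero_of_forall_hyp fun y => ?_
  obtain ⟨y, rfl⟩ := hg.1.2 y
  rw [LinearMap.map_sub₂, mB_linExt_hyp hg, ← mink_eq_mB, ← mink_eq_mB, hg.2, sub_self]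

theorem mB_linExt {g : hypSet 4 → hypSet 4} (hg : hIsIsom 4 g) (x y : V5) :
    mB (linExt g x) (linExt g y) = mB x y := by
  conv_rhs => rw [← sum_hypCoord y]
  conv_lhs => arg 2; rw [linExt]
  simp only [map_sum, map_smul]
  exact Finset.sum_congr rfl fun i _ => by rw [mB_linExt_hyp hg]

/-- Isometries carry framed simplices to framed simplices. -/
theorem Frame.image (hS : SimplexData G K) (hT : Frame K T k) {g : hypSet 4 → hypSet 4}
    (hg : hIsIsom 4 g) : Frame K (g '' T) fun i => linExt g (k i) := by
  have hgr : ∀ i j, mB (linExt g (k i)) (linExt g (k j)) = K i j := fun i j => by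
    rw [mB_linExt hg, hT.gram]
  refine ⟨hgr, fun i => ?_, fun y => ?_⟩
  · refine pos_of_mB_hyp_neg (g (hypPt 0)) (by rw [hgr]; exact hS.nonpos i) ?_
    rw [mB_linExt_hyp hg]
    exact mB_hyp_neg _ (by rw [hT.gram]; exact hS.nonpos i) (hT.pos i)
  · constructor
    · rintro ⟨x, hx, rfl⟩
      obtain ⟨a, ha, hxa⟩ := (hT.mem x).1 hx
      exact ⟨a, ha, by rw [← linExt_hyp hg, hxa, linExt_lc]⟩
    · rintro ⟨a, ha, hy⟩
      obtain ⟨x, rfl⟩ := hg.1.2 y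
      refine ⟨x, (hT.mem_iff hS x).2 fun i => ?_, rfl⟩
      rw [← mB_linExt hg, linExt_hyp hg, hy, ← linExt_lc, mB_linExt hg, mB_nrm_lc hS hT.gram]
      exact neg_nonpos.2 (ha i)

theorem Frame.exists_of_congr (hS : SimplexData G K) (hT : Frame K T k) {T' : Set (hypSet 4)}
    (h : hCongr 4 T T') : ∃ k', Frame K T' k' := by
  obtain ⟨g, hg, rfl⟩ := h
  exact ⟨_, hT.image hS hg⟩

/-- An isometry matching vertex vectors carries spanned simplices to spanned simplices. -/
theorem image_eq_of_lc {g : hypSet 4 → hypSet 4} (hS : SimplexData G K)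
    (hk : ∀ i j, mB (k i) (k j) = K i j) (hk' : ∀ i j, mB (k' i) (k' j) = K i j)
    (hg : hIsIsom 4 g) (h : ∀ (x : hypSet 4) (a : Fin 5 → ℝ), x.1 = lc k a → (g x).1 = lc k' a)
    (C : Set (Fin 5 → ℝ)) :
    g '' {x | ∃ a ∈ C, x.1 = lc k a} = {x | ∃ a ∈ C, x.1 = lc k' a} := by
  ext y
  constructor
  · rintro ⟨x, ⟨a, ha, hx⟩, rfl⟩
    exact ⟨a, ha, h x a hx⟩
  · rintro ⟨a, ha, hy⟩
    obtain ⟨x, rfl⟩ := hg.1.2 y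
    refine ⟨x, ⟨a, ha, ?_⟩, rfl⟩
    have h1 := h x _ (eq_lc hS hk x.1)
    rw [hy] at h1
    rw [lc_injective hS hk' h1]
    exact eq_lc hS hk x.1

end Isometries

section Normals

open Filter Topology

theorem exists_orthogonal (x y : V5) : ∃ d : V5, d ≠ 0 ∧ mB x d = 0 ∧ mB y d = 0 := by
  have h : ((mB x).prod (mB y)).ker ≠ ⊥ :=
    LinearMap.ker_ne_bot_of_finrank_lt (by simp)
  obtain ⟨d, hd, hd0⟩ := Submodule.exists_mem_ne_zero_of_ne_bot h
  rw [LinearMap.mem_ker, LinearMap.prod_apply] at hd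
  exact ⟨d, hd0, congrArg Prod.fst hd, congrArg Prod.snd hd⟩

theorem mB_add_smul_self (x y : V5) (t : ℝ) :
    mB (x + t • y) (x + t • y) = mB x x + 2 * t * mB x y + t ^ 2 * mB y y := by
  simp only [map_add, LinearMap.add_apply, map_smul, LinearMap.smul_apply, smul_eq_mul,
    mB_comm y x]
  ring

/-- A ray from a timelike forward vector in a spacelike direction hits the light cone. -/
theorem exists_null_on_ray {u x : V5} (hu : mB u u < 0) (hu0 : 0 < u 0) (hx : 0 < mB x x) :
    ∃ t : ℝ, 0 < t ∧ mB (u + t • x) (u + t • x) = 0 ∧ 0 < (u + t • x) 0 := by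
  set b := mB u x with hb
  set D := b ^ 2 - mB u u * mB x x with hD
  have hDb : b ^ 2 < D := by
    have := mul_neg_of_neg_of_pos hu hx
    linarith
  have hs : |b| < √D := by
    rw [← Real.sqrt_sq_eq_abs]
    exact Real.sqrt_lt_sqrt (sq_nonneg b) hDb
  have hs2 : √D * √D = D := Real.mul_self_sqrt ((sq_nonneg b).trans hDb.le)
  set t := (-b + √D) / mB x x with ht
  have htx : t * mB x x = -b + √D := by rw [ht]; field_simp
  have ht0 : 0 < t := div_pos (by linarith [(abs_lt.1 hs).2]) hx
  have hq : mB u u + 2 * t * b + t ^ 2 * mB x x = 0 := by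
    have h1 : mB x x * (mB u u + 2 * t * b + t ^ 2 * mB x x) = 0 := by
      calc mB x x * (mB u u + 2 * t * b + t ^ 2 * mB x x)
          = mB u u * mB x x + 2 * (t * mB x x) * b + (t * mB x x) ^ 2 := by ring
        _ = 0 := by rw [htx]; nlinarith
    exact (mul_eq_zero.1 h1).resolve_left hx.ne'
  have hnull : mB (u + t • x) (u + t • x) = 0 := by rw [mB_add_smul_self]; exact hq
  refine ⟨t, ht0, hnull, ?_⟩
  have h1 : mB u (u + t • x) < 0 := by
    rw [map_add, map_smul, smul_eq_mul]
    have : 0 < t ^ 2 * mB x x := by positivity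
    nlinarith
  obtain ⟨s, hs, hy⟩ := exists_smul_mem_hypSet hu hu0
  refine pos_of_mB_hyp_neg ⟨_, hy⟩ hnull.le ?_
  show mB _ (s • u) < 0
  rw [map_smul, mB_comm, smul_eq_mul]
  exact mul_neg_of_pos_of_neg hs h1

section Family

variable {ι : Type*} {v : ι → V5} {P : Set (hypSet 4)} {x₀ : hypSet 4}

theorem mem_hIdealVerts_of_family (hP : P = ⋂ i, hHalf 4 (v i)) (hx₀ : x₀ ∈ P) {w : V5}
    (hw : mB w w = 0) (hw0 : w 0 = 1) (hv : ∀ i, mB (v i) w ≤ 0) : w ∈ hIdealVerts 4 P := by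
  refine ⟨hw, hw0, ?_⟩
  have hlim : Tendsto (fun ε : ℝ => w + ε • x₀.1) (𝓝[>] 0) (𝓝 w) := by
    have hcont : Continuous fun ε : ℝ => w + ε • x₀.1 := by fun_prop
    have := hcont.tendsto 0
    rw [zero_smul, add_zero] at this
    exact this.mono_left nhdsWithin_le_nhds
  refine mem_closure_of_tendsto hlim ?_
  filter_upwards [self_mem_nhdsWithin] with ε (hε : 0 < ε)
  have h1 : mB w x₀.1 < 0 := mB_hyp_neg x₀ hw.le (by rw [hw0]; exact one_pos)
  have hq : mB (w + ε • x₀.1) (w + ε • x₀.1) < 0 := by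
    rw [mB_add_smul_self, hw, mB_hyp]
    have := mul_neg_of_pos_of_neg hε h1
    nlinarith
  obtain ⟨s, hs, hy⟩ := exists_smul_mem_hypSet hq (by
    rw [PiLp.add_apply, PiLp.smul_apply, hw0, smul_eq_mul]
    have := mul_pos hε (hyp_pos x₀)
    linarith)
  refine ⟨⟨_, hy⟩, ?_, s⁻¹, inv_pos.2 hs, ?_⟩
  · rw [hP, mem_iInter] at hx₀ ⊢
    intro i
    have h2 : mB (v i) x₀.1 ≤ 0 := hx₀ i
    show mB (v i) (s • _) ≤ 0
    rw [map_smul, map_add, map_smul, smul_eq_mul, smul_eq_mul]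
    refine mul_nonpos_of_nonneg_of_nonpos hs.le (add_nonpos (hv i) ?_)
    exact mul_nonpos_of_nonneg_of_nonpos hε.le h2
  · rw [smul_smul, inv_mul_cancel₀ hs.ne', one_smul]

variable [Finite ι]

/-- A polyhedron with finitely many ideal vertices contains no spacelike direction. -/
theorem mB_self_nonpos_of_family (hP : P = ⋂ i, hHalf 4 (v i)) (hint : ∀ i, mB (v i) x₀.1 < 0)
    (hfin : (hIdealVerts 4 P).Finite) {x : V5} (hx : ∀ i, mB (v i) x ≤ 0) : mB x x ≤ 0 := by
  by_contra hcon
  push Not at hcon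
  have hx₀ : x₀ ∈ P := by
    rw [hP, mem_iInter]
    exact fun i => (hint i).le
  obtain ⟨d, hd0, hd1, hd2⟩ := exists_orthogonal x₀.1 x
  have hdd := mB_self_pos_of_orthogonal (by rw [mB_hyp]; norm_num) hd1 hd0
  have hU : {y : hypSet 4 | ∀ i, mB (v i) y.1 < 0} ∈ 𝓝 x₀ := by
    have ho : IsOpen (⋂ i, {x : hypSet 4 | mB (v i) x.1 < 0}) :=
      isOpen_iInter_of_finite fun i => isOpen_setOf_mB_neg _
    refine mem_of_superset (ho.mem_nhds (mem_iInter.2 hint)) fun y hy i => ?_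
    exact (mem_iInter.1 hy i : _)
  have hev := eventually_exists_mem hU d
  -- the ideal vertex attached to a small parameter
  have hw : ∀ s ∈ {s : ℝ | ∃ y ∈ {y : hypSet 4 | ∀ i, mB (v i) y.1 < 0}, ∃ c : ℝ, 0 < c ∧
      y.1 = c • (x₀.1 + s • d)}, ∃ w ∈ hIdealVerts 4 P, ∃ c t : ℝ, 0 < c ∧
      w = c • (x₀.1 + s • d) + t • x := by
    rintro s ⟨y, hy, c, hc, hyc⟩
    obtain ⟨t, ht, hnull, hpos⟩ := exists_null_on_ray (u := y.1) (by rw [mB_hyp]; norm_num)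
      (hyp_pos y) hcon
    set z := y.1 + t • x with hz
    refine ⟨(z 0)⁻¹ • z, mem_hIdealVerts_of_family hP hx₀ ?_ ?_ fun i => ?_,
      (z 0)⁻¹ * c, (z 0)⁻¹ * t, by positivity, ?_⟩
    · rw [map_smul, LinearMap.map_smul₂, hnull, smul_zero, smul_zero]
    · rw [PiLp.smul_apply, smul_eq_mul, inv_mul_cancel₀ hpos.ne']
    · rw [map_smul, hz, map_add, map_smul, smul_eq_mul, smul_eq_mul]
      exact mul_nonpos_of_nonneg_of_nonpos (inv_pos.2 hpos).le
        (add_nonpos (hy i).le (mul_nonpos_of_nonneg_of_nonpos ht.le (hx i)))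
    · conv_lhs => arg 2; rw [hz, hyc]
      rw [smul_add, smul_smul, smul_smul]
  have hinf : {s : ℝ | ∃ y ∈ {y : hypSet 4 | ∀ i, mB (v i) y.1 < 0}, ∃ c : ℝ, 0 < c ∧
      y.1 = c • (x₀.1 + s • d)}.Infinite := infinite_of_mem_nhds 0 hev
  choose! f hf c t hc hfe using hw
  obtain ⟨s, hs, s', hs', hne, heq⟩ := hinf.exists_ne_map_eq_of_mapsTo (f := f) hf hfin
  have h1 := (hfe s hs).symm.trans (heq.trans (hfe s' hs'))
  have hq := congrArg (mB d) h1
  have hdx : mB d x = 0 := (mB_comm _ _).trans hd2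
  have hdx₀ : mB d x₀.1 = 0 := (mB_comm _ _).trans hd1
  simp only [map_add, map_smul, hdx, hdx₀, smul_eq_mul, mul_zero, add_zero, zero_add] at hq
  have h2 : c s * s = c s' * s' := by
    have : (c s * s - c s' * s') * mB d d = 0 := by linarith
    exact sub_eq_zero.1 ((mul_eq_zero.1 this).resolve_right hdd.ne')
  have h3 : (c s - c s') • x₀.1 = (t s' - t s) • x := by
    have h4 : c s • (x₀.1 + s • d) + t s • x = c s • x₀.1 + (c s * s) • d + t s • x := by
      rw [smul_add, smul_smul]
    have h5 : c s' • (x₀.1 + s' • d) + t s' • x = c s' • x₀.1 + (c s * s) • d + t s' • x := by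
      rw [smul_add, smul_smul, h2]
    rw [h4, h5] at h1
    rw [sub_smul, sub_smul, sub_eq_sub_iff_add_eq_add]
    have h6 : (c s • x₀.1 + t s • x) + (c s * s) • d = (t s' • x + c s' • x₀.1) + (c s * s) • d := by
      rw [add_right_comm, h1]; abel
    exact add_right_cancel h6
  have h4 := congrArg (fun z => mB z z) h3
  simp only [map_smul, LinearMap.smul_apply, mB_hyp, smul_eq_mul] at h4
  have h5 : c s = c s' := by
    have h6 := mul_nonneg (mul_self_nonneg (t s' - t s)) hcon.le
    have h7 : (c s - c s') * (c s - c s') ≤ 0 := by nlinarith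
    exact sub_eq_zero.1 (mul_self_eq_zero.1 (le_antisymm h7 (mul_self_nonneg _)))
  rw [h5] at h2
  exact hne (mul_left_cancel₀ (hc s' hs').ne' h2)

/-- A polyhedron with finitely many ideal vertices only contains forward causal directions. -/
theorem pos_of_family (hP : P = ⋂ i, hHalf 4 (v i)) (hint : ∀ i, mB (v i) x₀.1 < 0)
    (hfin : (hIdealVerts 4 P).Finite) {x : V5} (hx : ∀ i, mB (v i) x ≤ 0) (hx0 : x ≠ 0) :
    0 < x 0 := by
  by_contra hcon
  have hneg : x 0 < 0 := lt_of_le_of_ne (not_lt.1 hcon)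
    (zero_coord_ne (mB_self_nonpos_of_family hP hint hfin hx) hx0)
  obtain ⟨i⟩ : Nonempty ι := by
    by_contra hne
    rw [not_nonempty_iff] at hne
    obtain ⟨d, hd0, hd, -⟩ := exists_orthogonal x₀.1 x₀.1
    have h1 := mB_self_pos_of_orthogonal (by rw [mB_hyp]; norm_num) hd hd0
    have h2 := mB_self_nonpos_of_family hP hint hfin (x := d) (fun i => isEmptyElim i)
    linarith
  have hp := hyp_pos x₀
  set c := -x₀.1 0 / x 0 with hc
  have hc0 : 0 < c := div_pos_of_neg_of_neg (by linarith) hneg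
  set y := x₀.1 + c • x with hy
  have hv : ∀ i, mB (v i) y < 0 := fun i => by
    rw [hy, map_add, map_smul, smul_eq_mul]
    exact add_neg_of_neg_of_nonpos (hint i) (mul_nonpos_of_nonneg_of_nonpos hc0.le (hx i))
  refine zero_coord_ne (mB_self_nonpos_of_family hP hint hfin fun i => (hv i).le) ?_ ?_
  · intro h0
    have := hv i
    rw [h0, map_zero] at this
    exact lt_irrefl _ this
  · rw [hy, PiLp.add_apply, PiLp.smul_apply, smul_eq_mul, hc, div_mul_cancel₀ _ hneg.ne,
      add_neg_cancel]

end Family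

end Normals

section ExistsFrame

open Filter Topology

theorem mB_neg_of_ne_smul {x y : V5} (hx : mB x x ≤ 0) (hx0 : 0 < x 0) (hy : mB y y ≤ 0)
    (hy0 : 0 < y 0) (h : ∀ c : ℝ, x ≠ c • y) : mB x y < 0 := by
  refine lt_of_le_of_ne (mB_nonpos hx hx0 hy hy0) fun h0 => ?_
  set c := x 0 / y 0 with hc
  by_contra
  refine zero_coord_ne (x := x + (-c) • y) ?_ ?_ ?_
  · rw [mB_add_smul_self, h0]
    nlinarith [mul_nonpos_of_nonneg_of_nonpos (sq_nonneg c) hy]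
  · intro hz
    refine h c ?_
    rw [neg_smul, ← sub_eq_add_neg] at hz
    exact sub_eq_zero.1 hz
  · rw [PiLp.add_apply, PiLp.smul_apply, smul_eq_mul, neg_mul, hc, div_mul_cancel₀ _ hy0.ne',
      add_neg_cancel]

/-- An irredundant half-space contributes a facet. -/
theorem isFacet_of_irredundant {ι : Type*} [Finite ι] {v : ι → V5} {P : Set (hypSet 4)}
    {x₀ : hypSet 4} (hv : ∀ i, mB (v i) (v i) = 1) (hP : P = ⋂ i, hHalf 4 (v i))
    (hint : ∀ i, mB (v i) x₀.1 < 0) {i : ι} {z : hypSet 4} (hz : ∀ j, j ≠ i → mB (v j) z.1 ≤ 0)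
    (hzi : 0 < mB (v i) z.1) : hIsFacet 4 P (P ∩ hWall 4 (v i)) := by
  set y := (mB (v i) z.1) • x₀.1 + (-mB (v i) x₀.1) • z.1 with hy
  have hi := hint i
  have hvy : mB (v i) y = 0 := by
    rw [hy, map_add, map_smul, map_smul, smul_eq_mul, smul_eq_mul]
    ring
  have hvj : ∀ j, j ≠ i → mB (v j) y < 0 := fun j hj => by
    rw [hy, map_add, map_smul, map_smul, smul_eq_mul, smul_eq_mul]
    exact add_neg_of_neg_of_nonpos (mul_neg_of_pos_of_neg hzi (hint j))
      (mul_nonpos_of_nonneg_of_nonpos (by linarith) (hz j hj))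
  have hyy : mB y y < 0 := by
    have h1 : mB x₀.1 z.1 < 0 := mB_hyp_neg z (by rw [mB_hyp]; norm_num) (hyp_pos x₀)
    rw [hy, mB_add_smul_self, LinearMap.map_smul₂, LinearMap.map_smul₂, map_smul, mB_hyp, mB_hyp,
      smul_eq_mul, smul_eq_mul, smul_eq_mul]
    have h2 : (-mB (v i) x₀.1) * (mB (v i) z.1 * mB x₀.1 z.1) < 0 :=
      mul_neg_of_pos_of_neg (by linarith) (mul_neg_of_pos_of_neg hzi h1)
    nlinarith [sq_nonneg (mB (v i) z.1), sq_nonneg (mB (v i) x₀.1)]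
  have hy0 : 0 < y 0 := by
    rw [hy, PiLp.add_apply, PiLp.smul_apply, PiLp.smul_apply, smul_eq_mul, smul_eq_mul]
    exact add_pos (mul_pos hzi (hyp_pos x₀)) (mul_pos (by linarith) (hyp_pos z))
  obtain ⟨s, hs, hyS⟩ := exists_smul_mem_hypSet hyy hy0
  obtain ⟨p, hp⟩ : ∃ p : hypSet 4, p.1 = s • y := ⟨⟨_, hyS⟩, rfl⟩
  have hpi : mB (v i) p.1 = 0 := by
    rw [hp, map_smul, hvy, smul_zero]
  have hpj : ∀ j, j ≠ i → mB (v j) p.1 < 0 := fun j hj => by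
    rw [hp, map_smul, smul_eq_mul]
    exact mul_neg_of_pos_of_neg hs (hvj j hj)
  have hmem : ∀ q : hypSet 4, mB (v i) q.1 = 0 → (∀ j, j ≠ i → mB (v j) q.1 < 0) →
      q ∈ P ∩ hWall 4 (v i) := by
    intro q hqi hqj
    refine ⟨?_, hqi⟩
    rw [hP, mem_iInter]
    intro j
    by_cases hj : j = i
    · subst hj; exact hqi.le
    · exact (hqj j hj).le
  refine ⟨⟨p, hmem p hpi hpj⟩, v i, hv i, ?_, rfl, fun u hu hsub => ?_⟩
  · rw [hP]; exact iInter_subset _ i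
  have hU : {q : hypSet 4 | ∀ j, j ≠ i → mB (v j) q.1 < 0} ∈ 𝓝 p := by
    have ho : IsOpen (⋂ j, ⋂ _ : j ≠ i, {x : hypSet 4 | mB (v j) x.1 < 0}) :=
      isOpen_iInter_of_finite fun j => isOpen_iInter_of_finite fun _ => isOpen_setOf_mB_neg _
    refine mem_of_superset (ho.mem_nhds (mem_iInter₂.2 hpj)) fun q hq j hj => ?_
    exact (mem_iInter₂.1 hq j hj : _)
  refine hWall_eq_of_eq_smul hu (eq_smul_of_forall_orthogonal (hv i) fun d hd => ?_)
  have h1 := (eventually_exists_mem hU d).filter_mono (nhdsWithin_le_nhds (s := Ioi 0))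
  obtain ⟨r, ⟨q, hq, c, hc, hqc⟩, hr⟩ := (h1.and self_mem_nhdsWithin).exists
  have hr : 0 < r := hr
  have h2 : mB u q.1 = 0 := hsub (hmem q (by
    rw [hqc, map_smul, map_add, map_smul, hpi, hd]; simp) hq)
  have h3 : mB u p.1 = 0 := hsub (hmem p hpi hpj)
  rw [hqc, map_smul, map_add, map_smul, h3, zero_add, smul_eq_mul, smul_eq_mul] at h2
  exact (mul_eq_zero.1 ((mul_eq_zero.1 h2).resolve_left hc.ne')).resolve_left hr.ne'

/-- A Coxeter simplex with finitely many ideal vertices is framed. -/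
theorem exists_frame {P : Set (hypSet 4)} (hP : hCoxSimplex 4 P)
    (hfin : (hIdealVerts 4 P).Finite) :
    ∃ G K k, SimplexData G K ∧ Frame K P k ∧
      ∀ i j, i ≠ j → ∃ m : ℕ, 2 ≤ m ∧ G i j = -Real.cos (Real.pi / (m : ℝ)) := by
  classical
  obtain ⟨⟨m, v, hv, hPv, ⟨x₀, hx₀⟩, -, hang⟩, -, hcard⟩ := hP
  have hint : ∀ i, mB (v i) x₀.1 < 0 := fun i =>
    mB_neg_of_mem_interior (hv i) (interior_mono (hPv ▸ iInter_subset _ i) hx₀)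
  -- a minimal subfamily
  obtain ⟨I, hI, hmin⟩ : ∃ I : Finset (Fin m), P = ⋂ i ∈ I, hHalf 4 (v i) ∧
      ∀ J : Finset (Fin m), P = ⋂ i ∈ J, hHalf 4 (v i) → I.card ≤ J.card := by
    have hne : {n | ∃ J : Finset (Fin m), P = ⋂ i ∈ J, hHalf 4 (v i) ∧ J.card = n}.Nonempty :=
      ⟨_, Finset.univ, by simpa using hPv, rfl⟩
    obtain ⟨I, hI, hc⟩ := Nat.sInf_mem hne
    exact ⟨I, hI, fun J hJ => hc ▸ Nat.sInf_le ⟨J, hJ, rfl⟩⟩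
  have hI' : P = ⋂ i : I, hHalf 4 (v i) := by rw [hI, iInter_subtype]
  have hfacet : ∀ i : I, hIsFacet 4 P (P ∩ hWall 4 (v i)) := by
    intro i
    obtain ⟨z, hz, hzP⟩ : ∃ z, z ∈ ⋂ j ∈ I.erase i, hHalf 4 (v j) ∧ z ∉ P := by
      by_contra hcon
      push Not at hcon
      have h1 := hmin (I.erase i) (subset_antisymm
        (by rw [hI]; exact biInter_subset_biInter_left (fun j hj => Finset.mem_of_mem_erase hj))
        hcon)
      have h2 := Finset.card_erase_lt_of_mem i.2
      omega
    have hz' : ∀ j : I, j ≠ i → mB (v j) z.1 ≤ 0 := fun j hj =>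
      mem_iInter₂.1 hz j (Finset.mem_erase.2 ⟨fun h => hj (Subtype.ext h), j.2⟩)
    refine isFacet_of_irredundant (v := fun i : I => v i) (fun i => hv i) hI' (fun i => hint i)
      hz' ?_
    by_contra hcon
    refine hzP (hI' ▸ mem_iInter.2 fun j => ?_)
    by_cases hj : j = i
    · subst hj; exact not_lt.1 hcon
    · exact hz' j hj
  have hinj : Function.Injective fun i : I => P ∩ hWall 4 (v i) := by
    intro i j hij
    have hij : P ∩ hWall 4 (v i) = P ∩ hWall 4 (v j) := hij
    obtain ⟨-, u, hu, -, hSu, huniq⟩ := hfacet i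
    have h1 := huniq (v i) (hv i) inter_subset_right
    have h2 := huniq (v j) (hv j) (hij ▸ inter_subset_right)
    have h3 : v i = v j := by
      refine (eq_or_eq_neg_of_hWall_eq (hv i) (hv j) (h1.trans h2.symm)).resolve_right fun h => ?_
      have h4 := hint i
      have h5 := hint j
      rw [h, map_neg, LinearMap.neg_apply] at h4
      linarith
    by_contra hne
    have h4 : P = ⋂ l ∈ I.erase i, hHalf 4 (v l) := by
      refine subset_antisymm
        (by rw [hI]; exact biInter_subset_biInter_left (fun j hj => Finset.mem_of_mem_erase hj))
        fun x hx => ?_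
      rw [hI, mem_iInter₂]
      intro l hl
      by_cases hli : l = i
      · rw [hli, h3]
        exact mem_iInter₂.1 hx j (Finset.mem_erase.2 ⟨fun h => hne (Subtype.ext h.symm), j.2⟩)
      · exact mem_iInter₂.1 hx l (Finset.mem_erase.2 ⟨hli, hl⟩)
    have h5 := hmin _ h4
    have h6 := Finset.card_erase_lt_of_mem i.2
    omega
  have hle : I.card ≤ 5 := by
    have h1 : (range fun i : I => P ∩ hWall 4 (v i)).ncard = I.card := by
      rw [← Nat.card_coe_set_eq, Nat.card_range_of_injective hinj]
      simp
    have h2 : (range fun i : I => P ∩ hWall 4 (v i)).ncard ≤ {S | hIsFacet 4 P S}.ncard := by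
      refine ncard_le_ncard ?_ (finite_of_ncard_ne_zero (by rw [hcard]; norm_num))
      rintro _ ⟨i, rfl⟩
      exact hfacet i
    rwa [h1, hcard] at h2
  -- the normals separate points
  have hker : ∀ x : V5, (∀ i : I, mB (v i) x = 0) → x = 0 := by
    intro x hx
    by_contra hne
    have h1 := pos_of_family (v := fun i : I => v i) hI' (fun i => hint i) hfin
      (fun i => (hx i).le) hne
    have h2 := pos_of_family (v := fun i : I => v i) hI' (fun i => hint i) hfin (x := -x)
      (fun i => by rw [map_neg, hx i, neg_zero]) (neg_ne_zero.2 hne)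
    rw [PiLp.neg_apply] at h2
    linarith
  have hge : 5 ≤ I.card := by
    have hinj' : Function.Injective (LinearMap.pi fun i : I => mB (v i)) := by
      rw [← LinearMap.ker_eq_bot, LinearMap.ker_eq_bot']
      exact fun x hx => hker x fun i => congrFun hx i
    have := LinearMap.finrank_le_finrank_of_injective hinj'
    simpa using this
  let e : Fin 5 ≃ I := Fintype.equivOfCardEq (by simp; omega)
  set n : Fin 5 → V5 := fun i => v (e i) with hn
  have hPn : P = ⋂ i, hHalf 4 (n i) := by
    rw [hI', ← e.surjective.iInter_comp]
  have hint' : ∀ i, mB (n i) x₀.1 < 0 := fun i => hint _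
  have hkn : ∀ x : V5, (∀ i, mB (n i) x = 0) → x = 0 := fun x hx => hker x fun i => by
    have := hx (e.symm i)
    simpa only [hn, Equiv.apply_symm_apply] using this
  have hsurj : Function.Surjective (LinearMap.pi fun i => mB (n i)) := by
    refine (LinearMap.injective_iff_surjective_of_finrank_eq_finrank (by simp)).1 ?_
    rw [← LinearMap.ker_eq_bot, LinearMap.ker_eq_bot']
    exact fun x hx => hkn x fun i => congrFun hx i
  choose k hk using fun j => hsurj (Pi.single j (-1))
  have hk : ∀ i j, mB (n i) (k j) = if i = j then -1 else 0 := fun i j => by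
    have := congrFun (hk j) i
    rwa [LinearMap.pi_apply, Pi.single_apply] at this
  have hkle : ∀ i j, mB (n i) (k j) ≤ 0 := fun i j => by rw [hk]; split_ifs <;> norm_num
  have hk0 : ∀ j, k j ≠ 0 := fun j h => by
    have := hk j j
    rw [h, map_zero, if_pos rfl] at this
    norm_num at this
  have hkk : ∀ j, mB (k j) (k j) ≤ 0 := fun j =>
    mB_self_nonpos_of_family hPn hint' hfin fun i => hkle i j
  have hkp : ∀ j, 0 < k j 0 := fun j =>
    pos_of_family hPn hint' hfin (fun i => hkle i j) (hk0 j)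
  set G : Matrix (Fin 5) (Fin 5) ℝ := Matrix.of fun i j => mB (n i) (n j) with hG
  set K : Matrix (Fin 5) (Fin 5) ℝ := Matrix.of fun i j => mB (k i) (k j) with hK
  have hnrm : ∀ i, nrm G k i = n i := by
    intro i
    rw [← sub_eq_zero]
    refine hkn _ fun l => ?_
    rw [map_sub, nrm, mB_lc]
    simp [hk, hG, mB_comm (n l)]
  have hS : SimplexData G K := by
    refine ⟨?_, fun i j => mB_comm _ _, fun i => hv _, fun i j hij => ?_, hkk⟩
    · ext i j
      have h1 : (G * K) i j = -mB (nrm G k i) (k j) := by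
        rw [Matrix.mul_apply, mB_comm, nrm, mB_lc]
        simp [hK, mB_comm (k j)]
      rw [h1, hnrm, hk, Matrix.one_apply]
      split_ifs <;> simp
    · refine mB_neg_of_ne_smul (hkk i) (hkp i) (hkk j) (hkp j) fun c hc => ?_
      have h1 := hk i i
      rw [hc, map_smul, hk i j, if_neg hij, if_pos rfl, smul_zero] at h1
      norm_num at h1
  have hT : Frame K P k := by
    refine ⟨fun i j => rfl, hkp, fun x => ?_⟩
    rw [hPn, mem_iInter]
    constructor
    · intro h
      refine ⟨_, fun i => ?_, eq_lc hS (fun i j => rfl) x.1⟩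
      rw [hnrm]
      exact neg_nonneg.2 (h i)
    · rintro ⟨a, ha, hx⟩ i
      rw [← hnrm, mem_hHalf, hx, mB_nrm_lc hS (fun i j => rfl)]
      exact neg_nonpos.2 (ha i)
  refine ⟨G, K, k, hS, hT, fun i j hij => hang _ _ ?_ ?_⟩
  · show hWall 4 (n i) ≠ hWall 4 (n j)
    intro h
    rw [← hnrm, ← hnrm] at h
    exact hij (hT.facet_injective hS (by rw [h]))
  · obtain ⟨p, q, hpq, hpi, hpj, hqi, hqj⟩ : ∃ p q : Fin 5, p ≠ q ∧ p ≠ i ∧ p ≠ j ∧ q ≠ i ∧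
        q ≠ j := by
      revert i j; decide
    have ha : ∀ l, 0 ≤ (Pi.single p 1 + Pi.single q 1 : Fin 5 → ℝ) l := fun l => by
      rw [Pi.add_apply, Pi.single_apply, Pi.single_apply]
      split_ifs <;> norm_num
    obtain ⟨s, hs, x, hx⟩ := exists_hyp_of_neg hkp ha
      (mB_lc_self_neg hS hT.gram ha hpq (by simp [hpq]) (by simp [hpq.symm]))
    refine ⟨x, (hT.mem x).2 ⟨_, fun l => mul_nonneg hs.le (ha l), hx⟩, ?_, ?_⟩
    · show mB (n i) x.1 = 0
      rw [← hnrm, hx, mB_nrm_lc hS hT.gram]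
      simp [hpi.symm, hqi.symm]
    · show mB (n j) x.1 = 0
      rw [← hnrm, hx, mB_nrm_lc hS hT.gram]
      simp [hpj.symm, hqj.symm]

end ExistsFrame

section Link

variable {G K : Matrix (Fin 5) (Fin 5) ℝ} {P : Set (hypSet 4)} {k : Fin 5 → V5}

theorem cmA3t_apply : ∀ a b : Fin 4, a ≠ b → cmA3t a b = if a + 2 = b then 2 else 3 := by
  intro a b h
  fin_cases a <;> fin_cases b <;> first | rfl | exact absurd rfl h

theorem neg_cos_cmA3t {a b : Fin 4} (h : a ≠ b) :
    -Real.cos (Real.pi / (cmA3t a b : ℝ)) = if a + 2 = b then 0 else -1 / 2 := by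
  rw [cmA3t_apply a b h]
  split_ifs
  · rw [Nat.cast_ofNat, Real.cos_pi_div_two, neg_zero]
  · rw [Nat.cast_ofNat, Real.cos_pi_div_three, neg_div]

/-- A vertex with link of type `Ã₃` exhibits a `4`-cycle in the Coxeter diagram. -/
theorem exists_perm_of_link (hS : SimplexData G K) (hT : Frame K P k) {j : Fin 5}
    (hl : hIdealLink 4 P ((k j 0)⁻¹ • k j) cmA3t) :
    ∃ σ : Equiv.Perm (Fin 5), σ 4 = j ∧ ∀ a b : Fin 4, G (σ a.castSucc) (σ b.castSucc) =
      if a = b then 1 else if a + 2 = b then 0 else -1 / 2 := by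
  obtain ⟨e, he1, -, he, hne, hset⟩ := hl
  have hfac : ∀ i, ∃ t, P ∩ hWall 4 (e i) = P ∩ hWall 4 (nrm G k t) ∧ t ≠ j := by
    intro i
    have hi : P ∩ hWall 4 (e i) ∈
        {S | hIsFacet 4 P S ∧ (k j 0)⁻¹ • k j ∈ closure (hCone 4 S)} := by
      rw [hset]; exact ⟨i, rfl⟩
    obtain ⟨hf, hw⟩ := hi
    obtain ⟨t, ht⟩ := (hT.isFacet_iff hS _).1 hf
    refine ⟨t, ht, ?_⟩
    rintro rfl
    rw [ht, hT.mem_closure_hCone_facet hS] at hw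
    obtain ⟨a, -, ha, hw⟩ := hw
    rw [← lc_single] at hw
    have h1 := congrFun (lc_injective hS hT.gram hw) t
    rw [ha, Pi.single_eq_same] at h1
    exact (inv_pos.2 (hT.pos t)).ne' h1
  choose τ hτ hτj using hfac
  have hsm : ∀ i, e i = (-mB (e i) (k (τ i))) • nrm G k (τ i) := fun i =>
    eq_smul_nrm hS hT.gram fun l hl' =>
      hT.mB_eq_zero_of_facet hS (hτ i ▸ inter_subset_right) hl'
  set ε : Fin 4 → ℝ := fun i => -mB (e i) (k (τ i)) with hε
  have hsm : ∀ i, e i = ε i • nrm G k (τ i) := hsm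
  have hinj : Function.Injective τ := by
    intro a b hab
    by_contra hcon
    refine hne a b hcon ?_
    rw [hWall_eq_of_eq_smul (he1 a) (hsm a), hWall_eq_of_eq_smul (he1 b) (hsm b), hab]
  have hee : ∀ a b, mB (e a) (e b) = if a = b then 1 else if a + 2 = b then 0 else -1 / 2 := by
    intro a b
    split_ifs with h h2
    · subst h; exact he1 a
    · exact (he a b h).trans ((neg_cos_cmA3t h).trans (if_pos h2))
    · exact (he a b h).trans ((neg_cos_cmA3t h).trans (if_neg h2))
  have hprod : ∀ a b, mB (e a) (e b) = ε a * ε b * G (τ a) (τ b) := by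
    intro a b
    rw [hsm a, hsm b, map_smul, LinearMap.map_smul₂, mB_nrm_nrm hS hT.gram]
    simp only [smul_eq_mul]
    ring
  have hsq : ∀ a, ε a * ε a = 1 := by
    intro a
    have h1 := hprod a a
    rw [hS.diag, mul_one, hee, if_pos rfl] at h1
    exact h1.symm
  have hε0 : ∀ a, ε a ≠ 0 := fun a h => by have := hsq a; rw [h] at this; norm_num at this
  set s : V5 := ∑ i, e i with hs
  have hes : ∀ a, mB (e a) s = 0 := by
    intro a
    rw [hs, map_sum]
    simp only [hee]
    fin_cases a <;> simp [Fin.sum_univ_four, Fin.ext_iff] <;> norm_num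
  have hns : ∀ l, l ≠ j → mB (nrm G k l) s = 0 := by
    intro l hl'
    have hr : l ∈ range τ := by
      by_contra hcon
      have h1 : (Finset.univ.image τ).card = 4 := by
        rw [Finset.card_image_of_injective _ hinj]; rfl
      have h2 : (Finset.univ.image τ) ⊆ (Finset.univ.erase j).erase l := by
        intro x hx
        obtain ⟨a, -, rfl⟩ := Finset.mem_image.1 hx
        exact Finset.mem_erase.2 ⟨fun h => hcon ⟨a, h⟩,
          Finset.mem_erase.2 ⟨hτj a, Finset.mem_univ _⟩⟩
      have h3 := Finset.card_le_card h2
      rw [Finset.card_erase_of_mem (Finset.mem_erase.2 ⟨hl', Finset.mem_univ _⟩),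
        Finset.card_erase_of_mem (Finset.mem_univ _), h1] at h3
      simp at h3
    obtain ⟨a, rfl⟩ := hr
    have h1 := hes a
    rw [hsm a, LinearMap.map_smul₂, smul_eq_mul] at h1
    exact (mul_eq_zero.1 h1).resolve_left (hε0 a)
  have hsk : s = (-mB (nrm G k j) s) • k j := by
    conv_lhs => rw [eq_lc hS hT.gram s]
    rw [← lc_single]
    congr 1
    funext l
    by_cases h : l = j
    · subst h; rw [Pi.single_eq_same]
    · rw [Pi.single_eq_of_ne h, hns l h, neg_zero]
  set c := -mB (nrm G k j) s with hc
  have hεc : ∀ a, ε a = -c * K j (τ a) := by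
    intro a
    have h1 : mB s (k (τ a)) = c * K j (τ a) := by
      rw [hsk, LinearMap.map_smul₂, hT.gram, smul_eq_mul]
    have h2 : mB s (k (τ a)) = -ε a := by
      rw [hs, LinearMap.map_sum₂, Finset.sum_eq_single a]
      · rw [hε]; ring
      · intro b _ hb
        rw [hsm b, LinearMap.map_smul₂, mB_nrm hS hT.gram, if_neg (fun h => hb (hinj h)),
          smul_zero]
      · exact fun h => absurd (Finset.mem_univ a) h
    linarith
  have hεε : ∀ a b, ε a * ε b = 1 := by
    intro a b
    have h1 : 0 < ε a * ε b := by
      have hc0 : c ≠ 0 := fun h => hε0 a (by rw [hεc, h]; ring)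
      have h2 : 0 < K j (τ a) * K j (τ b) :=
        mul_pos_of_neg_of_neg (hS.neg _ _ (hτj a).symm) (hS.neg _ _ (hτj b).symm)
      rw [hεc a, hεc b]
      have := mul_pos (mul_self_pos.2 hc0) h2
      linarith
    nlinarith [hsq a, hsq b]
  have hbij : Function.Bijective (Fin.snoc (α := fun _ => Fin 5) τ j : Fin 5 → Fin 5) := by
    rw [← Finite.injective_iff_bijective]
    intro a b
    refine Fin.lastCases ?_ (fun a => ?_) a <;> refine Fin.lastCases ?_ (fun b => ?_) b
    · exact fun _ => rfl
    · rw [Fin.snoc_last, Fin.snoc_castSucc]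
      exact fun h => absurd h.symm (hτj b)
    · rw [Fin.snoc_last, Fin.snoc_castSucc]
      exact fun h => absurd h (hτj a)
    · rw [Fin.snoc_castSucc, Fin.snoc_castSucc]
      exact fun h => by rw [hinj h]
  refine ⟨Equiv.ofBijective _ hbij, Fin.snoc_last (α := fun _ => Fin 5) j τ, fun a b => ?_⟩
  have h1 := hprod a b
  rw [hεε, one_mul, hee] at h1
  rw [h1, Equiv.ofBijective_apply, Equiv.ofBijective_apply,
    Fin.snoc_castSucc (α := fun _ => Fin 5), Fin.snoc_castSucc (α := fun _ => Fin 5)]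

end Link

section Classification

variable {G K : Matrix (Fin 5) (Fin 5) ℝ} {P : Set (hypSet 4)} {k : Fin 5 → V5}

theorem SimplexData.reindex (hS : SimplexData G K) (σ : Equiv.Perm (Fin 5)) :
    SimplexData (G.submatrix σ σ) (K.submatrix σ σ) where
  mul_eq := by rw [Matrix.submatrix_mul_equiv, hS.mul_eq, Matrix.submatrix_one_equiv]
  symm i j := hS.symm _ _
  diag i := hS.diag _
  neg i j h := hS.neg _ _ fun hh => h (σ.injective hh)
  nonpos i := hS.nonpos _

/-- Gram matrices of Coxeter simplices whose first four facets form a `4`-cycle in the Coxeter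
diagram. -/
structure CycleData (G K : Matrix (Fin 5) (Fin 5) ℝ) : Prop extends SimplexData G K where
  cyc : ∀ a b : Fin 4, G a.castSucc b.castSucc =
    if a = b then 1 else if a + 2 = b then 0 else -1 / 2
  angle : ∀ i j, i ≠ j → ∃ m : ℕ, 2 ≤ m ∧ G i j = -Real.cos (Real.pi / (m : ℝ))

/-- The rotation of the first four indices. -/
def rotPerm : Equiv.Perm (Fin 5) where
  toFun := ![1, 2, 3, 0, 4]
  invFun := ![3, 0, 1, 2, 4]
  left_inv := by decide
  right_inv := by decide

theorem CycleData.rotate (h : CycleData G K) :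
    CycleData (G.submatrix rotPerm rotPerm) (K.submatrix rotPerm rotPerm) where
  toSimplexData := h.toSimplexData.reindex _
  cyc a b := by
    have h1 : ∀ a : Fin 4, rotPerm a.castSucc = (a + 1).castSucc := by decide
    rw [Matrix.submatrix_apply, h1, h1, h.cyc, add_right_comm]
    simp only [add_left_inj]
  angle i j hij := h.angle _ _ fun hh => hij (rotPerm.injective hh)

theorem cos_pi_div_cases {m : ℕ} (hm : 2 ≤ m) {x : ℝ} (hx : x = Real.cos (Real.pi / (m : ℝ))) :
    x = 0 ∨ x = 1 / 2 ∨ (1 / 2 ≤ x ∧ 2 * x ^ 2 = 1) ∨ (1 / 2 ≤ x ∧ 1 < 2 * x ^ 2) := by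
  have hsqrt : Real.sqrt 2 ^ 2 = 2 := Real.sq_sqrt (by norm_num)
  have hs1 : 1 ≤ Real.sqrt 2 := Real.one_le_sqrt.2 (by norm_num)
  obtain rfl | rfl | rfl | h5 : m = 2 ∨ m = 3 ∨ m = 4 ∨ 5 ≤ m := by omega
  · exact Or.inl (by rw [hx, Nat.cast_ofNat, Real.cos_pi_div_two])
  · exact Or.inr (Or.inl (by rw [hx, Nat.cast_ofNat, Real.cos_pi_div_three]))
  · rw [Nat.cast_ofNat, Real.cos_pi_div_four] at hx
    exact Or.inr (Or.inr (Or.inl ⟨by rw [hx]; linarith, by rw [hx]; nlinarith⟩))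
  · have h5' : (5 : ℝ) ≤ m := by exact_mod_cast h5
    have h1 : Real.cos (Real.pi / 4) < x := by
      rw [hx]
      refine Real.cos_lt_cos_of_nonneg_of_le_pi (by positivity)
        (div_le_self Real.pi_pos.le (by norm_num)) ?_
      exact div_lt_div_of_pos_left Real.pi_pos (by norm_num) (by linarith)
    rw [Real.cos_pi_div_four] at h1
    exact Or.inr (Or.inr (Or.inr ⟨by linarith, by nlinarith⟩))

theorem CycleData.cases (h : CycleData G K) {i : Fin 5} (hi : i ≠ 4) :
    -G i 4 = 0 ∨ -G i 4 = 1 / 2 ∨ (1 / 2 ≤ -G i 4 ∧ 2 * (-G i 4) ^ 2 = 1) ∨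
      (1 / 2 ≤ -G i 4 ∧ 1 < 2 * (-G i 4) ^ 2) := by
  obtain ⟨m, hm, hx⟩ := h.angle i 4 hi
  exact cos_pi_div_cases hm (by rw [hx, neg_neg])

theorem CycleData.entries (h : CycleData G K) :
    (G 0 0 = 1 ∧ G 1 1 = 1 ∧ G 2 2 = 1 ∧ G 3 3 = 1 ∧ G 4 4 = 1) ∧
    (G 0 1 = -1 / 2 ∧ G 1 2 = -1 / 2 ∧ G 2 3 = -1 / 2 ∧ G 0 3 = -1 / 2 ∧ G 0 2 = 0 ∧
      G 1 3 = 0) ∧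
    (G 1 0 = -1 / 2 ∧ G 2 1 = -1 / 2 ∧ G 3 2 = -1 / 2 ∧ G 3 0 = -1 / 2 ∧ G 2 0 = 0 ∧
      G 3 1 = 0) ∧
    (G 4 0 = G 0 4 ∧ G 4 1 = G 1 4 ∧ G 4 2 = G 2 4 ∧ G 4 3 = G 3 4) :=
  ⟨⟨h.diag _, h.diag _, h.diag _, h.diag _, h.diag _⟩,
    ⟨h.cyc 0 1, h.cyc 1 2, h.cyc 2 3, h.cyc 0 3, h.cyc 0 2, h.cyc 1 3⟩,
    ⟨h.cyc 1 0, h.cyc 2 1, h.cyc 3 2, h.cyc 3 0, h.cyc 2 0, h.cyc 3 1⟩,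
    ⟨h.symm _ _, h.symm _ _, h.symm _ _, h.symm _ _⟩⟩

theorem CycleData.column (h : CycleData G K) (i j : Fin 5) :
    G i 0 * K 0 j + G i 1 * K 1 j + G i 2 * K 2 j + G i 3 * K 3 j + G i 4 * K 4 j =
      if i = j then 1 else 0 := by
  have := congrFun (congrFun h.mul_eq i) j
  rwa [Matrix.mul_apply, Fin.sum_univ_five, Matrix.one_apply] at this

theorem CycleData.sum_mul (h : CycleData G K) :
    (G 0 4 + G 1 4 + G 2 4 + G 3 4) * K 4 0 = 1 ∧
      (G 0 4 + G 1 4 + G 2 4 + G 3 4) * K 4 4 = 0 := by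
  obtain ⟨⟨d0, d1, d2, d3, d4⟩, ⟨e1, e2, e3, e4, e5, e6⟩, ⟨f1, f2, f3, f4, f5, f6⟩, -⟩ := h.entries
  constructor
  · have h0 := h.column 0 0
    have h1 := h.column 1 0
    have h2 := h.column 2 0
    have h3 := h.column 3 0
    simp only [d0, d1, d2, d3, e1, e2, e3, e4, e5, e6, f1, f2, f3, f4, f5, f6, Fin.reduceEq,
      if_true, if_false] at h0 h1 h2 h3
    linarith
  · have h0 := h.column 0 4
    have h1 := h.column 1 4
    have h2 := h.column 2 4
    have h3 := h.column 3 4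
    simp only [d0, d1, d2, d3, e1, e2, e3, e4, e5, e6, f1, f2, f3, f4, f5, f6, Fin.reduceEq,
      if_false] at h0 h1 h2 h3
    linarith

theorem CycleData.sum_neg (h : CycleData G K) : G 0 4 + G 1 4 + G 2 4 + G 3 4 < 0 := by
  have h1 := h.sum_mul.1
  have h2 := h.neg 4 0 (by decide)
  by_contra hcon
  nlinarith

theorem CycleData.corner (h : CycleData G K) : K 4 4 = 0 :=
  (mul_eq_zero.1 h.sum_mul.2).resolve_left h.sum_neg.ne

theorem CycleData.quad (h : CycleData G K) :
    3 / 2 * G 1 4 ^ 2 + 2 * G 2 4 ^ 2 + 3 / 2 * G 3 4 ^ 2 + 2 * (G 1 4 * G 2 4) +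
      2 * (G 2 4 * G 3 4) + G 1 4 * G 3 4 ≤ 1 ∧
    (K 0 0 = 0 ↔ 3 / 2 * G 1 4 ^ 2 + 2 * G 2 4 ^ 2 + 3 / 2 * G 3 4 ^ 2 + 2 * (G 1 4 * G 2 4) +
      2 * (G 2 4 * G 3 4) + G 1 4 * G 3 4 = 1) := by
  obtain ⟨⟨d0, d1, d2, d3, d4⟩, ⟨e1, e2, e3, e4, e5, e6⟩, ⟨f1, f2, f3, f4, f5, f6⟩,
    ⟨s0, s1, s2, s3⟩⟩ := h.entries
  have h1 := h.column 1 0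
  have h2 := h.column 2 0
  have h3 := h.column 3 0
  have h4 := h.column 4 0
  simp only [d1, d2, d3, d4, e2, e3, e6, f1, f2, f3, f4, f5, f6, s0, s1, s2, s3,
    Fin.reduceEq, if_false] at h1 h2 h3 h4
  have hneg := h.sum_neg
  have hK := h.neg 4 0 (by decide)
  have hK0 := h.nonpos 0
  generalize G 0 4 = x0 at *
  generalize G 1 4 = x1 at *
  generalize G 2 4 = x2 at *
  generalize G 3 4 = x3 at *
  have k1 : K 1 0 = K 0 0 - K 4 0 * (3 / 2 * x1 + x2 + 1 / 2 * x3) := by linarith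
  have k2 : K 2 0 = K 0 0 - K 4 0 * (x1 + 2 * x2 + x3) := by linarith
  have k3 : K 3 0 = K 0 0 - K 4 0 * (1 / 2 * x1 + x2 + 3 / 2 * x3) := by linarith
  have key : K 4 0 * (1 - (3 / 2 * x1 ^ 2 + 2 * x2 ^ 2 + 3 / 2 * x3 ^ 2 + 2 * (x1 * x2) +
      2 * (x2 * x3) + x1 * x3)) = -(x0 + x1 + x2 + x3) * K 0 0 := by
    rw [k1, k2, k3] at h4
    linear_combination h4
  generalize 3 / 2 * x1 ^ 2 + 2 * x2 ^ 2 + 3 / 2 * x3 ^ 2 + 2 * (x1 * x2) +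
      2 * (x2 * x3) + x1 * x3 = Q at *
  constructor
  · by_contra hcon
    have := mul_pos_of_neg_of_neg hK (show 1 - Q < 0 by linarith)
    have := mul_nonpos_of_nonneg_of_nonpos (show 0 ≤ -(x0 + x1 + x2 + x3) by linarith) hK0
    linarith
  · constructor
    · intro h0
      rw [h0, mul_zero] at key
      linarith [(mul_eq_zero.1 key).resolve_left hK.ne]
    · intro hQ
      rw [hQ, sub_self, mul_zero] at key
      exact (mul_eq_zero.1 key.symm).resolve_left (by linarith)

theorem quarter_le_mul {x y : ℝ} (hx : 1 / 2 ≤ x) (hy : 1 / 2 ≤ y) : 1 / 4 ≤ x * y := by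
  nlinarith

theorem quad_solutions {x0 x1 x2 x3 : ℝ} (h0 : 1 / 2 ≤ x0)
    (c0 : x0 = 1 / 2 ∨ 1 ≤ 2 * x0 ^ 2) (c1 : x1 = 0 ∨ 1 / 2 ≤ x1)
    (c2 : x2 = 0 ∨ x2 = 1 / 2 ∨ (1 / 2 ≤ x2 ∧ 1 ≤ 2 * x2 ^ 2)) (c3 : x3 = 0 ∨ 1 / 2 ≤ x3)
    (q1 : 3 / 2 * x2 ^ 2 + 2 * x3 ^ 2 + 3 / 2 * x0 ^ 2 + 2 * (x2 * x3) + 2 * (x3 * x0) +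
      x2 * x0 ≤ 1)
    (q2 : 3 / 2 * x3 ^ 2 + 2 * x0 ^ 2 + 3 / 2 * x1 ^ 2 + 2 * (x3 * x0) + 2 * (x0 * x1) +
      x3 * x1 ≤ 1)
    (q3 : 3 / 2 * x0 ^ 2 + 2 * x1 ^ 2 + 3 / 2 * x2 ^ 2 + 2 * (x0 * x1) + 2 * (x1 * x2) +
      x0 * x2 ≤ 1) :
    x1 = 0 ∧ x3 = 0 ∧ ((x0 = 1 / 2 ∧ x2 = 0) ∨ (x0 ^ 2 = 1 / 2 ∧ x2 = 0) ∨
      (x0 = 1 / 2 ∧ x2 = 1 / 2)) := by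
  have n2 : 0 ≤ x2 := by rcases c2 with h | h | h <;> linarith
  have s0 := quarter_le_mul h0 h0
  have s2 := sq_nonneg x2
  have m02 : 0 ≤ x0 * x2 := mul_nonneg (by linarith) n2
  have hx1 : x1 = 0 := by
    refine c1.resolve_right fun hh => ?_
    have h1 := quarter_le_mul hh hh
    have h2 := quarter_le_mul h0 hh
    have h3 : 0 ≤ x1 * x2 := mul_nonneg (by linarith) n2
    linarith [sq x0, sq x1]
  have hx3 : x3 = 0 := by
    refine c3.resolve_right fun hh => ?_
    have h1 := quarter_le_mul hh hh
    have h2 := quarter_le_mul hh h0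
    have h3 : 0 ≤ x2 * x3 := mul_nonneg n2 (by linarith)
    linarith [sq x0, sq x3, mul_comm x0 x2]
  subst hx1 hx3
  refine ⟨rfl, rfl, ?_⟩
  rcases c2 with hx2 | hx2
  · rcases c0 with hx0 | hx0
    · exact Or.inl ⟨hx0, hx2⟩
    · exact Or.inr (Or.inl ⟨by linarith, hx2⟩)
  · have h2 : 1 / 2 ≤ x2 := by rcases hx2 with h | h <;> linarith
    have h3 := quarter_le_mul h0 h2
    have h4 := quarter_le_mul h2 h2
    refine Or.inr (Or.inr ⟨?_, ?_⟩)
    · refine c0.resolve_right fun h => ?_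
      linarith [sq x2]
    · refine hx2.resolve_right fun h => ?_
      linarith [sq x0, h.2]

/-- The possible values of the products with the fifth normal, up to rotation. -/
theorem CycleData.values (h : CycleData G K) (h0 : G 0 4 ≠ 0) :
    G 1 4 = 0 ∧ G 3 4 = 0 ∧ ((G 0 4 = -1 / 2 ∧ G 2 4 = 0 ∧ ∀ i, K i i = 0 ↔ i = 4) ∨
      (G 2 4 = 0 ∧ ∀ i, K i i = 0 ↔ i = 2 ∨ i = 4) ∨
      (G 0 4 = -1 / 2 ∧ G 2 4 = -1 / 2 ∧ ∀ i, K i i = 0 ↔ i = 1 ∨ i = 3 ∨ i = 4)) := by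
  obtain ⟨-, z0⟩ := h.quad
  obtain ⟨q1, z1⟩ := h.rotate.quad
  obtain ⟨q2, z2⟩ := h.rotate.rotate.quad
  obtain ⟨q3, z3⟩ := h.rotate.rotate.rotate.quad
  have c0 := h.cases (i := 0) (by decide)
  have c1 := h.cases (i := 1) (by decide)
  have c2 := h.cases (i := 2) (by decide)
  have c3 := h.cases (i := 3) (by decide)
  have z4 := h.corner
  simp only [Matrix.submatrix_apply, show rotPerm 0 = 1 from rfl, show rotPerm 1 = 2 from rfl,
    show rotPerm 2 = 3 from rfl, show rotPerm 3 = 0 from rfl, show rotPerm 4 = 4 from rfl]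
    at q1 q2 q3 z1 z2 z3
  obtain ⟨x0, e0⟩ : ∃ x, G 0 4 = -x := ⟨-G 0 4, by ring⟩
  obtain ⟨x1, e1⟩ : ∃ x, G 1 4 = -x := ⟨-G 1 4, by ring⟩
  obtain ⟨x2, e2⟩ : ∃ x, G 2 4 = -x := ⟨-G 2 4, by ring⟩
  obtain ⟨x3, e3⟩ : ∃ x, G 3 4 = -x := ⟨-G 3 4, by ring⟩
  clear h
  simp only [e0, e1, e2, e3, neg_neg, neg_mul_neg, neg_sq, neg_eq_zero, ne_eq] at *
  obtain ⟨rfl, rfl, ⟨rfl, rfl⟩ | ⟨hsq, rfl⟩ | ⟨rfl, rfl⟩⟩ := quad_solutions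
    (by rcases c0 with h | h | h | h
        · exact absurd h h0
        · exact h.ge
        · exact h.1
        · exact h.1)
    (by rcases c0 with h | h | h | h
        · exact absurd h h0
        · exact Or.inl h
        · exact Or.inr h.2.ge
        · exact Or.inr h.2.le)
    (by rcases c1 with h | h | h | h
        · exact Or.inl h
        · exact Or.inr h.ge
        · exact Or.inr h.1
        · exact Or.inr h.1)
    (by rcases c2 with h | h | h | h
        · exact Or.inl h
        · exact Or.inr (Or.inl h)
        · exact Or.inr (Or.inr ⟨h.1, h.2.ge⟩)
        · exact Or.inr (Or.inr ⟨h.1, h.2.le⟩))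
    (by rcases c3 with h | h | h | h
        · exact Or.inl h
        · exact Or.inr h.ge
        · exact Or.inr h.1
        · exact Or.inr h.1) q1 q2 q3
  · refine ⟨rfl, rfl, Or.inl ⟨by norm_num, rfl, fun i => ?_⟩⟩
    norm_num at z0 z1 z2 z3
    fin_cases i <;> simp [z0, z1, z2, z3, z4]
  · refine ⟨rfl, rfl, Or.inr (Or.inl ⟨rfl, fun i => ?_⟩)⟩
    norm_num [hsq] at z0 z1 z2 z3
    fin_cases i <;> simp [z0, z1, z2, z3, z4]
  · refine ⟨rfl, rfl, Or.inr (Or.inr ⟨by norm_num, by norm_num, fun i => ?_⟩)⟩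
    norm_num at z0 z1 z2 z3
    fin_cases i <;> simp [z0, z1, z2, z3, z4]

end Classification

section ExplicitFrames

variable {G K : Matrix (Fin 5) (Fin 5) ℝ} {P : Set (hypSet 4)} {k : Fin 5 → V5}

theorem Frame.ncard_hIdealVerts (hS : SimplexData G K) (hT : Frame K P k) :
    (hIdealVerts 4 P).ncard = {i | K i i = 0}.ncard := by
  have h1 : hIdealVerts 4 P = (fun i => (k i 0)⁻¹ • k i) '' {i | K i i = 0} := by
    ext w
    rw [hT.mem_hIdealVerts hS]
    exact ⟨fun ⟨i, hi, hw⟩ => ⟨i, hi, hw.symm⟩, fun ⟨i, hi, hw⟩ => ⟨i, hi, hw.symm⟩⟩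
  rw [h1, ncard_image_of_injective]
  intro i j hij
  by_contra hne
  have h2 : lc k (Pi.single i (k i 0)⁻¹) = lc k (Pi.single j (k j 0)⁻¹) := by
    rw [lc_single, lc_single]; exact hij
  have h3 := congrFun (lc_injective hS hT.gram h2) i
  rw [Pi.single_eq_same, Pi.single_eq_of_ne hne] at h3
  exact (inv_pos.2 (hT.pos i)).ne' h3

theorem SimplexData.unique {K' : Matrix (Fin 5) (Fin 5) ℝ} (h : G * K = 1) (h' : G * K' = 1) :
    K = K' := by
  rw [← Matrix.inv_eq_right_inv h, ← Matrix.inv_eq_right_inv h']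

/-- A Coxeter simplex whose ideal vertices have links of type `Ã₃` has a frame adapted to a
`4`-cycle in its Coxeter diagram. -/
theorem exists_cycle_frame (hP : hCoxSimplex 4 P) (hcard : (hIdealVerts 4 P).ncard ≠ 0)
    (hl : ∀ w ∈ hIdealVerts 4 P, hIdealLink 4 P w cmA3t) :
    ∃ G K k, CycleData G K ∧ Frame K P k ∧ G 0 4 ≠ 0 := by
  obtain ⟨G, K, k, hS, hT, hang⟩ := exists_frame hP (finite_of_ncard_ne_zero hcard)
  obtain ⟨w, hw⟩ := nonempty_of_ncard_ne_zero hcard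
  obtain ⟨j, hj, rfl⟩ := (hT.mem_hIdealVerts hS w).1 hw
  obtain ⟨σ, -, hσ⟩ := exists_perm_of_link hS hT (hl _ hw)
  have hC : CycleData (G.submatrix σ σ) (K.submatrix σ σ) :=
    ⟨hS.reindex σ, hσ, fun i j hij => hang _ _ fun h => hij (σ.injective h)⟩
  have hT' := hT.reindex σ
  generalize G.submatrix σ σ = G' at hC
  generalize K.submatrix σ σ = K' at hC hT'
  generalize k ∘ σ = k' at hT'
  by_cases h0 : G' 0 4 = 0
  swap
  · exact ⟨_, _, _, hC, hT', h0⟩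
  by_cases h1 : G' 1 4 = 0
  swap
  · exact ⟨_, _, _, hC.rotate, hT'.reindex rotPerm, h1⟩
  by_cases h2 : G' 2 4 = 0
  swap
  · exact ⟨_, _, _, hC.rotate.rotate, (hT'.reindex rotPerm).reindex rotPerm, h2⟩
  refine ⟨_, _, _, hC.rotate.rotate.rotate,
    ((hT'.reindex rotPerm).reindex rotPerm).reindex rotPerm, fun h3 => ?_⟩
  have h4 := hC.sum_neg
  have h3 : G' 3 4 = 0 := h3
  rw [h0, h1, h2, h3] at h4
  norm_num at h4

/-- The Gram matrix of the normals of the fundamental simplex. -/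
def gramF : Matrix (Fin 5) (Fin 5) ℝ := (1 / 2 : ℝ) • mat invF

/-- The Gram matrix of the vertices of the fundamental simplex. -/
def cogramF : Matrix (Fin 5) (Fin 5) ℝ := (1 / 2 : ℝ) • mat formF

/-- Twice the Gram matrix of the normals of the large simplex. -/
def invP : List (List ℤ) :=
  [[2, 0, -1, -1, -1], [0, 2, -1, -1, -1], [-1, -1, 2, 0, 0], [-1, -1, 0, 2, 0], [-1, -1, 0, 0, 2]]

/-- The Gram matrix of the normals of the large simplex. -/
def gramP : Matrix (Fin 5) (Fin 5) ℝ := (1 / 2 : ℝ) • mat invP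

/-- The Gram matrix of the vertices of the large simplex. -/
def cogramP : Matrix (Fin 5) (Fin 5) ℝ := (1 / 2 : ℝ) • mat formP

theorem gramF_mul : gramF * cogramF = 1 := by
  rw [gramF, cogramF, Matrix.smul_mul, Matrix.mul_smul, invF_mul_formF, smul_smul, smul_smul]
  norm_num

theorem gramP_mul : gramP * cogramP = 1 := by
  have : mat invP * mat formP = (4 : ℝ) • (1 : Matrix (Fin 5) (Fin 5) ℝ) := by
    ext i j
    fin_cases i <;> fin_cases j <;>
      simp [Matrix.mul_apply, Fin.sum_univ_five, mat_apply, invP, formP] <;> norm_num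
  rw [gramP, cogramP, Matrix.smul_mul, Matrix.mul_smul, this, smul_smul, smul_smul]
  norm_num

theorem exists_frameF {F : Set (hypSet 4)} (hF : IsH34 F) :
    SimplexData gramF cogramF ∧ ∃ k, Frame cogramF F k := by
  obtain ⟨-, hc, -, hcard, hl, -⟩ := hF
  obtain ⟨G, K, k, hC, hT, h0⟩ := exists_cycle_frame hc (by rw [hcard]; norm_num) hl
  have hn := hT.ncard_hIdealVerts hC.toSimplexData
  rw [hcard] at hn
  obtain ⟨v1, v3, ⟨v0, v2, -⟩ | ⟨-, hz⟩ | ⟨-, -, hz⟩⟩ := hC.values h0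
  · obtain ⟨⟨d0, d1, d2, d3, d4⟩, ⟨e1, e2, e3, e4, e5, e6⟩, ⟨f1, f2, f3, f4, f5, f6⟩,
      ⟨s0, s1, s2, s3⟩⟩ := hC.entries
    clear hn hcard hl hc
    have hG : G = gramF := by
      ext i j
      fin_cases i <;> fin_cases j <;> simp [gramF, mat_apply, invF, *] <;> norm_num
    have hK : K = cogramF := SimplexData.unique (hG ▸ hC.mul_eq) gramF_mul
    subst hG hK
    exact ⟨hC.toSimplexData, k, hT⟩
  · rw [show {i | K i i = 0} = {2, 4} by ext i; simp [hz], ncard_pair (by decide)] at hn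
    norm_num at hn
  · rw [show {i | K i i = 0} = {1, 3, 4} by ext i; simp [hz], ncard_eq_three.2
      ⟨1, 3, 4, by decide, by decide, by decide, rfl⟩] at hn
    norm_num at hn

theorem exists_frameP {P : Set (hypSet 4)} (hP : IsH94 P) :
    SimplexData gramP cogramP ∧ ∃ k, Frame cogramP P k := by
  obtain ⟨-, hc, -, hcard, hl, -⟩ := hP
  obtain ⟨G, K, k, hC, hT, h0⟩ := exists_cycle_frame hc (by rw [hcard]; norm_num) hl
  have hn := hT.ncard_hIdealVerts hC.toSimplexData
  rw [hcard] at hn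
  obtain ⟨v1, v3, ⟨-, -, hz⟩ | ⟨-, hz⟩ | ⟨v0, v2, -⟩⟩ := hC.values h0
  · rw [show {i | K i i = 0} = {4} by ext i; simp [hz], ncard_singleton] at hn
    norm_num at hn
  · rw [show {i | K i i = 0} = {2, 4} by ext i; simp [hz], ncard_pair (by decide)] at hn
    norm_num at hn
  · obtain ⟨⟨d0, d1, d2, d3, d4⟩, ⟨e1, e2, e3, e4, e5, e6⟩, ⟨f1, f2, f3, f4, f5, f6⟩,
      ⟨s0, s1, s2, s3⟩⟩ := hC.entries
    clear hn hcard hl hc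
    have hG : G.submatrix (Equiv.swap 1 2) (Equiv.swap 1 2) = gramP := by
      have w : ∀ i : Fin 5, Equiv.swap (1 : Fin 5) 2 i = ![0, 2, 1, 3, 4] i := by decide
      ext i j
      rw [Matrix.submatrix_apply, w, w]
      fin_cases i <;> fin_cases j <;> simp [gramP, mat_apply, invP, *] <;> norm_num
    have hS := hC.toSimplexData.reindex (Equiv.swap 1 2)
    have hK : K.submatrix (Equiv.swap 1 2) (Equiv.swap 1 2) = cogramP :=
      SimplexData.unique (hG ▸ hS.mul_eq) gramP_mul
    have hT' := hT.reindex (Equiv.swap 1 2)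
    rw [hK] at hT'
    rw [hG, hK] at hS
    exact ⟨hS, _, hT'⟩

end ExplicitFrames

section Tiles

open scoped Matrix

variable {P T : Set (hypSet 4)} {κ k : Fin 5 → V5} {A : Matrix (Fin 5) (Fin 5) ℝ}

/-- The set spanned by the vectors whose coordinates with respect to `κ` are the rows of `A`. -/
def tile (κ : Fin 5 → V5) (A : Matrix (Fin 5) (Fin 5) ℝ) : Set (hypSet 4) :=
  {x | ∃ a ∈ coneC A, x.1 = lc κ a}

theorem lc_vecMul (κ : Fin 5 → V5) (A : Matrix (Fin 5) (Fin 5) ℝ) (a : Fin 5 → ℝ) :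
    lc κ (a ᵥ* A) = lc (fun i => lc κ (A i)) a := by
  ext l
  simp only [lc_coord, Matrix.vecMul, dotProduct, Finset.sum_mul, Finset.mul_sum]
  rw [Finset.sum_comm]
  exact Finset.sum_congr rfl fun _ _ => Finset.sum_congr rfl fun _ _ => mul_assoc _ _ _

theorem tile_eq_spanned (κ : Fin 5 → V5) (A : Matrix (Fin 5) (Fin 5) ℝ) :
    tile κ A = spanned fun i => lc κ (A i) := by
  ext x
  constructor
  · rintro ⟨_, ⟨a, ha, rfl⟩, hx⟩
    exact ⟨a, ha, by rw [hx, lc_vecMul]⟩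
  · rintro ⟨a, ha, hx⟩
    exact ⟨_, ⟨a, ha, rfl⟩, by rw [hx, lc_vecMul]⟩

theorem tile_submatrix_left (κ : Fin 5 → V5) (A : Matrix (Fin 5) (Fin 5) ℝ)
    (ρ : Equiv.Perm (Fin 5)) : tile κ (A.submatrix ρ id) = tile κ A := by
  rw [tile, coneC_submatrix, tile]

theorem lc_comp_perm (κ : Fin 5 → V5) (a : Fin 5 → ℝ) (π : Equiv.Perm (Fin 5)) :
    lc (κ ∘ π) (a ∘ π) = lc κ a := by
  ext l
  simp only [lc_coord, Function.comp]
  exact Equiv.sum_comp π fun i => a i * κ i l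

theorem tile_submatrix_right (κ : Fin 5 → V5) (A : Matrix (Fin 5) (Fin 5) ℝ)
    (π : Equiv.Perm (Fin 5)) : tile (κ ∘ π) (A.submatrix id π) = tile κ A := by
  ext x
  constructor
  · rintro ⟨_, ⟨a, ha, rfl⟩, hx⟩
    exact ⟨_, ⟨a, ha, rfl⟩, by rw [hx, vecMul_submatrix_right, lc_comp_perm]⟩
  · rintro ⟨_, ⟨a, ha, rfl⟩, hx⟩
    exact ⟨_, ⟨a, ha, rfl⟩, by rw [hx, vecMul_submatrix_right, lc_comp_perm]⟩

theorem mB_lc_cogramP (hk : ∀ i j, mB (κ i) (κ j) = cogramP i j) (a b : Fin 5 → ℝ) :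
    mB (lc κ a) (lc κ b) = 1 / 2 * (a ⬝ᵥ (mat formP *ᵥ b)) := by
  rw [mB_lc_lc hk]
  simp only [dotProduct, Matrix.mulVec, Finset.mul_sum]
  refine Finset.sum_congr rfl fun i _ => Finset.sum_congr rfl fun j _ => ?_
  rw [cogramP, Matrix.smul_apply, smul_eq_mul]
  ring

theorem mB_rows (hk : ∀ i j, mB (κ i) (κ j) = cogramP i j) (A : Matrix (Fin 5) (Fin 5) ℝ)
    (i j : Fin 5) : mB (lc κ (A i)) (lc κ (A j)) = 1 / 2 * (A * mat formP * Aᵀ) i j := by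
  rw [mB_lc_cogramP hk, Matrix.mul_assoc]
  rfl

/-- A tile is a simplex with the Gram matrix of the fundamental simplex. -/
theorem tile_frame (hP : Frame cogramP P κ)
    (hA : A * mat formP * Aᵀ = mat formF) (hn : ∀ i j, 0 ≤ A i j) :
    Frame cogramF (tile κ A) fun i => lc κ (A i) := by
  have hg : ∀ i j, mB (lc κ (A i)) (lc κ (A j)) = cogramF i j := fun i j => by
    rw [mB_rows hP.gram, hA, cogramF, Matrix.smul_apply, smul_eq_mul]
  rw [tile_eq_spanned]
  refine frame_spanned hg fun i => ?_
  have h0 : A i ≠ 0 := by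
    intro h
    have := hg i 0
    have hz : lc κ 0 = 0 := by ext; simp [lc_coord]
    rw [h, hz, map_zero, LinearMap.zero_apply] at this
    fin_cases i <;> simp [cogramF, mat_apply, formF] at this
  obtain ⟨j, hj⟩ := exists_pos_of_ne_zero (hn i) h0
  exact lc_pos hP.pos (hn i) hj

theorem mem_interior_tile (hS : SimplexData gramP cogramP) (hF : SimplexData gramF cogramF)
    (hP : Frame cogramP P κ) (hA : A * mat formP * Aᵀ = mat formF) (hn : ∀ i j, 0 ≤ A i j)
    {x : hypSet 4} {a : Fin 5 → ℝ} (hx : x.1 = lc κ a) :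
    x ∈ interior (tile κ A) ↔ a ∈ coneI A := by
  have hT := tile_frame hP hA hn
  constructor
  · intro h
    obtain ⟨_, ⟨b, hb, rfl⟩, hxb⟩ := interior_subset h
    rw [lc_vecMul] at hxb
    refine ⟨b, (hT.mem_interior_of_eq hF hxb).1 h, lc_injective hS hP.gram ?_⟩
    rw [← hx, hxb, lc_vecMul]
  · rintro ⟨b, hb, rfl⟩
    rw [lc_vecMul] at hx
    exact (hT.mem_interior_of_eq hF hx).2 hb

/-- A simplex congruent to the fundamental one inside the large simplex is a tile. -/
theorem Frame.exists_eq_tile (hS : SimplexData gramP cogramP) (hF : SimplexData gramF cogramF)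
    (hP : Frame cogramP P κ) (hT : Frame cogramF T k) (hTP : T ⊆ P) :
    ∃ A : Matrix (Fin 5) (Fin 5) ℝ, A * mat formP * Aᵀ = mat formF ∧ (∀ i j, 0 ≤ A i j) ∧
      T = tile κ A := by
  have hx : ∀ i, ∃ a, (∀ j, 0 ≤ a j) ∧ k i = lc κ a := fun i => by
    refine (hP.mem_closure_hCone hS (k i)).1 ?_
    have hsub : hCone 4 T ⊆ hCone 4 P := by
      rintro y ⟨x, hx, h⟩
      exact ⟨x, hTP hx, h⟩
    refine closure_mono hsub ((hT.mem_closure_hCone hF (k i)).2 ⟨Pi.single i 1, fun j => ?_, ?_⟩)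
    · by_cases h : j = i
      · subst h; simp
      · simp [h]
    · rw [lc_single, one_smul]
  choose B hA hk using hx
  obtain ⟨A, rfl⟩ : ∃ A : Matrix (Fin 5) (Fin 5) ℝ, A = B := ⟨B, rfl⟩
  refine ⟨A, ?_, hA, ?_⟩
  · ext i j
    have h1 := hT.gram i j
    rw [hk, hk, mB_rows hP.gram A, cogramF, Matrix.smul_apply, smul_eq_mul] at h1
    linarith
  · rw [tile_eq_spanned, hT.eq_spanned]
    congr 1
    exact funext hk

/-- The cones over the tiles of a decomposition. -/
theorem exists_tiling {F : Set (hypSet 4)} {φ : Fin 5 → V5} {𝒯 : Set (Set (hypSet 4))}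
    (hS : SimplexData gramP cogramP) (hF : SimplexData gramF cogramF)
    (hP : Frame cogramP P κ) (hT : Frame cogramF F φ) (h : hSTDecomp 4 P F 𝒯) :
    ∃ M : 𝒯 → Matrix (Fin 5) (Fin 5) ℝ, Tiling M ∧ ∀ t, t.1 = tile κ (M t) := by
  obtain ⟨⟨-, -, -, hU, hD, -⟩, hC, -⟩ := h
  have key : ∀ t : 𝒯, ∃ A : Matrix (Fin 5) (Fin 5) ℝ, A * mat formP * Aᵀ = mat formF ∧
      (∀ i j, 0 ≤ A i j) ∧ t.1 = tile κ A := fun t => by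
    obtain ⟨k, hk⟩ := hT.exists_of_congr hF (hC t.1 t.2)
    exact hP.exists_eq_tile hS hF hk (hU ▸ subset_sUnion_of_mem t.2)
  choose M hM hn ht using key
  refine ⟨M, ⟨hM, hn, fun x hx hneg => ?_, fun t t' htt => ?_⟩, ht⟩
  · obtain ⟨s, hs, y, hy⟩ := exists_hyp_of_neg hP.pos hx (by rw [mB_lc_cogramP hP.gram]; linarith)
    have hyP : y ∈ P := (hP.mem y).2 ⟨s • x, fun i => mul_nonneg hs.le (hx i), hy⟩
    obtain ⟨T, hT𝒯, hyT⟩ := mem_sUnion.1 (hU ▸ hyP)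
    have hT' : T = tile κ (M ⟨T, hT𝒯⟩) := ht ⟨T, hT𝒯⟩
    rw [hT'] at hyT
    obtain ⟨_, ⟨b, hb, rfl⟩, hyb⟩ := hyT
    refine ⟨⟨T, hT𝒯⟩, s⁻¹ • b, fun i => mul_nonneg (inv_nonneg.2 hs.le) (hb i), ?_⟩
    have := lc_injective hS hP.gram (hy.symm.trans hyb)
    rw [Matrix.smul_vecMul, ← this, smul_smul, inv_mul_cancel₀ hs.ne', one_smul]
  · rw [Set.disjoint_left]
    rintro x hx hx'
    have hTf := tile_frame hP (hM t) (hn t)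
    have hx0 : ∀ i, 0 ≤ x i := by
      obtain ⟨a, ha, rfl⟩ := hx
      refine fun i => ?_
      simp only [Matrix.vecMul, dotProduct]
      exact Finset.sum_nonneg fun j _ => mul_nonneg (ha j).le (hn t j i)
    have hneg : mB (lc κ x) (lc κ x) < 0 := by
      obtain ⟨a, ha, rfl⟩ := hx
      rw [lc_vecMul]
      exact mB_lc_self_neg hF hTf.gram (fun i => (ha i).le) (zero_ne_one) (ha 0) (ha 1)
    obtain ⟨s, hs, y, hy⟩ := exists_hyp_of_neg hP.pos hx0 hneg
    have hsm : ∀ {B}, x ∈ coneI B → s • x ∈ coneI B := by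
      rintro B ⟨a, ha, rfl⟩
      exact ⟨s • a, fun i => mul_pos hs (ha i), (Matrix.smul_vecMul _ _ _).symm⟩
    have h1 := (mem_interior_tile hS hF hP (hM t) (hn t) hy).2 (hsm hx)
    have h2 := (mem_interior_tile hS hF hP (hM t') (hn t') hy).2 (hsm hx')
    rw [← ht] at h1 h2
    have := hD t.1 t.2 t'.1 t'.2 fun h => htt (Subtype.ext h)
    exact (Set.eq_empty_iff_forall_notMem.1 this y) ⟨h1, h2⟩

/-- The standard decomposition. -/
def stdSet (κ : Fin 5 → V5) : Set (Set (hypSet 4)) := Set.range fun n => tile κ (stdM n)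

theorem Frame.comp_leafPerm (hP : Frame cogramP P κ) (n : ℕ) :
    Frame cogramP P (κ ∘ leafPerm n) := by
  have h := hP.reindex (leafPerm n)
  rwa [cogramP, Matrix.submatrix_smul, Pi.smul_apply, Pi.smul_apply, leafPerm_formP] at h

theorem eq_stdSet {F : Set (hypSet 4)} {φ : Fin 5 → V5} {𝒯 : Set (Set (hypSet 4))}
    (hS : SimplexData gramP cogramP) (hF : SimplexData gramF cogramF)
    (hP : Frame cogramP P κ) (hT : Frame cogramF F φ) (h : hSTDecomp 4 P F 𝒯) :
    ∃ κ', Frame cogramP P κ' ∧ 𝒯 = stdSet κ' := by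
  obtain ⟨M, hM, ht⟩ := exists_tiling hS hF hP hT h
  have : Finite 𝒯 := h.1.1
  obtain ⟨k, hk⟩ := hM.exists_leafPerm
  have ht' : ∀ t, t.1 = tile (κ ∘ leafPerm k) ((M t).submatrix id (leafPerm k)) := fun t => by
    rw [tile_submatrix_right, ht]
  refine ⟨_, hP.comp_leafPerm k, Set.Subset.antisymm (fun T hT𝒯 => ?_) ?_⟩
  · obtain ⟨n, ρ, hρ⟩ := (hM.submatrix (leafPerm_formP k)).eq_std hk ⟨T, hT𝒯⟩
    refine ⟨n, ?_⟩
    dsimp only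
    rw [← tile_submatrix_left _ _ ρ, ← hρ]
    exact (ht' ⟨T, hT𝒯⟩).symm
  · rintro _ ⟨n, rfl⟩
    obtain ⟨t, ρ, hρ⟩ := hk n n.isLt
    dsimp only at hρ ⊢
    rw [stdM, ← tile_submatrix_left _ _ ρ, ← hρ, ← ht']
    exact t.2

end Tiles

section StandardDecomposition

open scoped Matrix

variable {P F : Set (hypSet 4)} {κ φ : Fin 5 → V5} {A : Matrix (Fin 5) (Fin 5) ℝ}

theorem hVol_mono {S T : Set (hypSet 4)} (h : S ⊆ T) : hVol 4 S ≤ hVol 4 T :=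
  lintegral_mono_set (image_mono h)

theorem Frame.std (hP : Frame cogramP P κ) (n : Fin 10) :
    Frame cogramF (tile κ (stdM n)) fun i => lc κ (stdM n i) :=
  tile_frame hP (stdM_gram n) (stdM_nonneg n)

theorem vecMul_nonneg (hn : ∀ i j, 0 ≤ A i j) {a : Fin 5 → ℝ} (ha : ∀ i, 0 ≤ a i) (j : Fin 5) :
    0 ≤ (a ᵥ* A) j := by
  simp only [Matrix.vecMul, dotProduct]
  exact Finset.sum_nonneg fun i _ => mul_nonneg (ha i) (hn i j)

theorem tile_subset (hP : Frame cogramP P κ) (hn : ∀ i j, 0 ≤ A i j) : tile κ A ⊆ P := by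
  rintro x ⟨_, ⟨a, ha, rfl⟩, hx⟩
  exact (hP.mem x).2 ⟨_, vecMul_nonneg hn ha, hx⟩

theorem Frame.isCoxPoly (hF : SimplexData gramF cogramF) (hT : Frame cogramF F φ)
    (hvol : hVol 4 F < ⊤) : hIsCoxPoly 4 F := by
  refine ⟨5, nrm gramF φ, fun i => mB_nrm_self hF hT.gram i, hT.eq_iInter hF, ?_, hvol,
    fun i j hij _ => ?_⟩
  · obtain ⟨x, -, a, ha, hx⟩ := hT.exists_interior hF
    exact ⟨x, (hT.mem_interior_of_eq hF hx).2 ha⟩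
  · have hne : i ≠ j := fun h => hij (by rw [h])
    have hv : gramF i j = -(1 / 2) ∨ gramF i j = 0 := by
      fin_cases i <;> fin_cases j <;> first
        | exact absurd rfl hne
        | (simp [gramF, mat_apply, invF])
    rw [mink_eq_mB, mB_nrm_nrm hF hT.gram]
    rcases hv with h | h
    · exact ⟨3, by norm_num, by rw [h]; push_cast; rw [Real.cos_pi_div_three]⟩
    · exact ⟨2, le_rfl, by rw [h]; push_cast; rw [Real.cos_pi_div_two, neg_zero]⟩

theorem sUnion_stdSet (hP : Frame cogramP P κ) : ⋃₀ stdSet κ = P := by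
  refine Set.Subset.antisymm ?_ fun x hx => ?_
  · rintro x ⟨_, ⟨n, rfl⟩, hx⟩
    exact tile_subset hP (stdM_nonneg n) hx
  · obtain ⟨a, ha, hxa⟩ := (hP.mem x).1 hx
    obtain ⟨n, hn⟩ := stdM_cover a ha
    exact ⟨_, ⟨n, rfl⟩, a, hn, hxa⟩

theorem interior_tile_disjoint (hS : SimplexData gramP cogramP) (hF : SimplexData gramF cogramF)
    (hP : Frame cogramP P κ) {n m : Fin 10} (h : n ≠ m) :
    interior (tile κ (stdM n)) ∩ interior (tile κ (stdM m)) = ∅ := by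
  refine Set.eq_empty_of_forall_notMem fun x ⟨hx, hx'⟩ => ?_
  obtain ⟨a, -, hxa⟩ := (hP.mem x).1 (tile_subset hP (stdM_nonneg n) (interior_subset hx))
  rw [mem_interior_tile hS hF hP (stdM_gram _) (stdM_nonneg _) hxa] at hx hx'
  exact Set.disjoint_left.1 (stdM_disjoint h) hx hx'

theorem mB_hReflect {v : V5} (hv : mB v v = 1) (x : V5) :
    mB (hReflect 4 v x) (hReflect 4 v x) = mB x x := by
  simp only [hReflect, mink_eq_mB, map_sub, map_smul, LinearMap.sub_apply, LinearMap.smul_apply,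
    smul_eq_mul, hv, mB_comm x v]
  ring

theorem hReflect_lc (hF : SimplexData gramF cogramF)
    (hg : ∀ i j, mB (lc κ (A i)) (lc κ (A j)) = cogramF i j) (i : Fin 5) (a : Fin 5 → ℝ) :
    hReflect 4 (nrm gramF (fun l => lc κ (A l)) i) (lc κ (a ᵥ* A)) =
      lc κ (a ᵥ* reflectRow i A) := by
  have h1 : a ᵥ* reflectRow i A = a ᵥ* A + (-a i) • (mat invF i ᵥ* A) := by
    have : reflectRow i A = A + Matrix.of (Pi.single i (-(mat invF i ᵥ* A))) := by
      ext p q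
      by_cases h : p = i
      · subst h
        simp only [reflectRow, Matrix.updateRow_self, Matrix.add_apply, Matrix.of_apply,
          Pi.single_eq_same, Pi.neg_apply, sub_eq_add_neg]
        rfl
      · simp [reflectRow, h]
    rw [this, Matrix.vecMul_add]
    congr 1
    ext q
    simp [Matrix.vecMul, dotProduct, Pi.single_apply, ite_apply]
  have h2 : nrm gramF (fun l => lc κ (A l)) i = lc κ ((-(1 / 2 : ℝ)) • (mat invF i ᵥ* A)) := by
    rw [lc_smul, lc_vecMul, ← lc_smul, nrm]
    congr 1
    ext j
    simp [gramF]
  have h3 : mB (nrm gramF (fun l => lc κ (A l)) i) (lc κ (a ᵥ* A)) = -a i := by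
    rw [lc_vecMul, mB_nrm_lc hF hg]
  rw [hReflect, mink_eq_mB, h3, h1, lc_add, h2, lc_smul, lc_smul, smul_smul, sub_eq_add_neg,
    ← neg_smul]
  congr 2
  ring

theorem mem_hypSet_of_lc (hp : ∀ i, 0 < κ i 0) {a : Fin 5 → ℝ} (ha : ∀ i, 0 ≤ a i)
    (h : mB (lc κ a) (lc κ a) = -1) : lc κ a ∈ hypSet 4 := by
  refine ⟨h, ?_⟩
  have h0 : a ≠ 0 := by
    rintro rfl
    rw [mB_lc] at h
    simp at h
  obtain ⟨j, hj⟩ := exists_pos_of_ne_zero ha h0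
  exact lc_pos hp ha hj

theorem tile_reflectRow (hF : SimplexData gramF cogramF) (hp : ∀ i, 0 < κ i 0)
    (hg : ∀ i j, mB (lc κ (A i)) (lc κ (A j)) = cogramF i j) (hn : ∀ i j, 0 ≤ A i j)
    (i : Fin 5) (hn' : ∀ p q, 0 ≤ reflectRow i A p q) :
    Subtype.val '' tile κ (reflectRow i A) =
      {y | ∃ x ∈ tile κ A, y = hReflect 4 (nrm gramF (fun l => lc κ (A l)) i) x.1} := by
  have hv := mB_nrm_self hF hg i
  ext y
  constructor
  · rintro ⟨y, ⟨_, ⟨a, ha, rfl⟩, hy⟩, rfl⟩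
    rw [← hReflect_lc hF hg] at hy
    refine ⟨⟨_, mem_hypSet_of_lc hp (vecMul_nonneg hn ha) ?_⟩, ⟨_, ⟨a, ha, rfl⟩, rfl⟩, hy⟩
    rw [← mB_hReflect hv, ← hy, mB_hyp]
  · rintro ⟨x, ⟨_, ⟨a, ha, rfl⟩, hx⟩, rfl⟩
    have hxx := mB_hyp x
    rw [← mB_hReflect hv, hx, hReflect_lc hF hg] at hxx
    rw [hx, hReflect_lc hF hg]
    exact ⟨⟨_, mem_hypSet_of_lc hp (vecMul_nonneg hn' ha) hxx⟩, ⟨_, ⟨a, ha, rfl⟩, rfl⟩, rfl⟩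

theorem stdSet_symmetric (hS : SimplexData gramP cogramP) (hF : SimplexData gramF cogramF)
    (hP : Frame cogramP P κ) {n m : Fin 10} (h : n ≠ m) {S : Set (hypSet 4)}
    (hn : hIsFacet 4 (tile κ (stdM n)) S) (hm : hIsFacet 4 (tile κ (stdM m)) S) :
    ∃ v, mink 4 v v = 1 ∧ S ⊆ hWall 4 v ∧
      Subtype.val '' tile κ (stdM m) = {y | ∃ x ∈ tile κ (stdM n), y = hReflect 4 v x.1} := by
  have hT := hP.std n
  obtain ⟨i, rfl⟩ := (hT.isFacet_iff hF S).1 hn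
  refine ⟨_, mB_nrm_self hF hT.gram i, inter_subset_right, ?_⟩
  obtain ⟨x, hx, s, hs, hxs⟩ := hT.exists_facet_point hF i
  have hxm : x ∈ tile κ (stdM m) := by
    obtain ⟨-, v, -, -, h, -⟩ := hm
    rw [h] at hx
    exact hx.1
  obtain ⟨_, ⟨b, hb, rfl⟩, hxb⟩ := hxm
  rw [← lc_vecMul, hxb] at hxs
  have hbs := lc_injective hS hP.gram hxs
  obtain ⟨ρ, hρ⟩ := stdM_reflect h i ⟨s⁻¹ • b, fun i => mul_nonneg (inv_nonneg.2 hs.le) (hb i), by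
    rw [Matrix.smul_vecMul, hbs, Matrix.smul_vecMul, smul_smul, inv_mul_cancel₀ hs.ne', one_smul]⟩
  rw [← tile_reflectRow hF hP.pos hT.gram (stdM_nonneg n) i
    (by rw [hρ]; exact fun p q => stdM_nonneg m (ρ p) q), hρ, tile_submatrix_left]

theorem Frame.congr_spanned {K G : Matrix (Fin 5) (Fin 5) ℝ} {k k' : Fin 5 → V5}
    {T T' : Set (hypSet 4)} (hS : SimplexData G K) (hT : Frame K T k) (hT' : Frame K T' k') :
    hCongr 4 T T' := by
  obtain ⟨g, hg, h⟩ := exists_isom hS hT.gram hT.pos hT'.gram hT'.pos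
  refine ⟨g, hg, ?_⟩
  rw [hT.eq_spanned, hT'.eq_spanned]
  exact image_eq_of_lc hS hT.gram hT'.gram hg h {a | ∀ i, 0 ≤ a i}

theorem four_mul_mB_nrm_std (hS : SimplexData gramP cogramP) (hF : SimplexData gramF cogramF)
    (hP : Frame cogramP P κ) (n : Fin 10) (c l : Fin 5) :
    mat (wallsZ (stdTile n)) c l = -4 * mB (nrm gramF (fun i => lc κ (stdM n i)) c) (κ l) := by
  have hT := hP.std n
  obtain ⟨a, ha⟩ : ∃ a, κ l = lc (fun i => lc κ (stdM n i)) a := ⟨_, eq_lc hF hT.gram (κ l)⟩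
  have h1 : a ᵥ* stdM n = Pi.single l 1 := by
    refine lc_injective hS hP.gram ?_
    rw [lc_vecMul, ← ha, lc_single, one_smul]
  have h2 := wall_dotProduct_vecMul n a c
  rw [h1, dotProduct_single, mul_one] at h2
  rw [h2, ha, mB_nrm_lc hF hT.gram]
  ring

theorem stdSet_secondType (hS : SimplexData gramP cogramP) (hF : SimplexData gramF cogramF)
    (hP : Frame cogramP P κ) : hSecondType 4 P (stdSet κ) := by
  rintro α β hα hβ hne - ⟨v, ⟨hv, ⟨_, ⟨n, rfl⟩, S, hSf, hSv⟩, hno⟩, hαβ⟩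
  obtain ⟨i, rfl⟩ := (hP.isFacet_iff hS α).1 hα
  obtain ⟨j, rfl⟩ := (hP.isFacet_iff hS β).1 hβ
  have hT := hP.std n
  obtain ⟨c, rfl⟩ := (hT.isFacet_iff hF S).1 hSf
  have hij : i ≠ j := fun h => hne (by rw [h])
  obtain ⟨p, q, hpq, hp, hq⟩ : ∃ p q : Fin 5, p ≠ q ∧ p ∉ ({i, j} : Set (Fin 5)) ∧
      q ∉ ({i, j} : Set (Fin 5)) := by
    simp only [Set.mem_insert_iff, Set.mem_singleton_iff]
    clear hne hβ hα hαβ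
    revert i j
    decide
  have hvk : ∀ l, l ≠ i → l ≠ j → mB v (κ l) = 0 := fun l hli hlj => by
    refine mB_eq_zero_of_face hS hP.gram hP.pos {i, j} hpq hp hq (fun x hx => ?_)
      (by simp [hli, hlj])
    obtain ⟨a, ha, h0, hxa⟩ := hx
    refine hαβ ⟨(hP.mem_facet hS i x).2 ⟨a, ha, ?_, hxa⟩, (hP.mem_facet hS j x).2 ⟨a, ha, ?_, hxa⟩⟩
    · rintro _ rfl; exact h0 _ (by simp)
    · rintro _ rfl; exact h0 _ (by simp)
  have hvs := eq_smul_nrm hF hT.gram (i := c) fun l hl => hT.mB_eq_zero_of_facet hF hSv hl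
  have hw : ∀ l, mB v (κ l) = 0 ↔ mat (wallsZ (stdTile n)) c l = 0 := fun l => by
    have hs : mB v (lc κ (stdM n c)) ≠ 0 := fun h => by
      rw [h, neg_zero, zero_smul] at hvs
      rw [hvs, mink_eq_mB, map_zero] at hv
      exact zero_ne_one hv
    rw [four_mul_mB_nrm_std hS hF hP]
    conv_lhs => rw [hvs]
    simp [hs]
  obtain ⟨m, hm⟩ := stdM_wall_zero n c i j fun l hi hj => (hw l).1 (hvk l hi hj)
  have hvm := eq_smul_nrm hS hP.gram (i := m) fun l hl => (hw l).2 (hm l hl)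
  refine hno ⟨_, hP.isFacet hS m, ?_⟩
  rw [hWall_eq_of_eq_smul hv hvm]
  exact inter_subset_right

theorem stdSet_decomp (hS : SimplexData gramP cogramP) (hF : SimplexData gramF cogramF)
    (hP : Frame cogramP P κ) (hT : Frame cogramF F φ) (hvol : hVol 4 P < ⊤) :
    hSTDecomp 4 P F (stdSet κ) := by
  refine ⟨⟨Set.finite_range _, Set.range_nonempty _, ?_, sUnion_stdSet hP, ?_, ?_⟩, ?_,
    stdSet_secondType hS hF hP⟩
  · rintro _ ⟨n, rfl⟩
    exact (hP.std n).isCoxPoly hF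
      ((hVol_mono (tile_subset hP (stdM_nonneg n))).trans_lt hvol)
  · rintro _ ⟨n, rfl⟩ _ ⟨m, rfl⟩ h
    exact interior_tile_disjoint hS hF hP fun hnm => h (by rw [hnm])
  · rintro _ ⟨n, rfl⟩ _ ⟨m, rfl⟩ h S hn hm
    exact stdSet_symmetric hS hF hP (fun hnm => h (by rw [hnm])) hn hm
  · rintro _ ⟨n, rfl⟩
    exact hT.congr_spanned hF (hP.std n)

end StandardDecomposition

section Counting

open scoped Matrix

variable {P F : Set (hypSet 4)} {κ κ' : Fin 5 → V5}

theorem tile_stdM_injective (hS : SimplexData gramP cogramP) (hF : SimplexData gramF cogramF)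
    (hP : Frame cogramP P κ) : Function.Injective fun n => tile κ (stdM n) := by
  intro n m h
  by_contra hne
  have hT := hP.std n
  obtain ⟨x, -, a, ha, hx⟩ := hT.exists_interior hF
  have hxn := (hT.mem_interior_of_eq hF hx).2 ha
  have hd := interior_tile_disjoint hS hF hP hne
  dsimp only at h
  rw [← h, inter_self] at hd
  exact Set.notMem_empty x (hd ▸ hxn)

theorem ncard_stdSet (hS : SimplexData gramP cogramP) (hF : SimplexData gramF cogramF)
    (hP : Frame cogramP P κ) : (stdSet κ).ncard = 10 := by
  rw [stdSet, ← image_univ, ncard_image_of_injective _ (tile_stdM_injective hS hF hP), ncard_univ,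
    Nat.card_eq_fintype_card, Fintype.card_fin]

theorem mem_closure_tile (hS : SimplexData gramP cogramP) (hF : SimplexData gramF cogramF)
    (hP : Frame cogramP P κ) (n : Fin 10) (i : Fin 5) {s : ℝ} (hs : 0 < s) :
    s • κ i ∈ closure (hCone 4 (tile κ (stdM n))) ↔
      ∀ c : Fin 5, 0 ≤ ((wallsZ (stdTile n)).getD c []).getD i 0 := by
  have hT := hP.std n
  have hi : s • κ i = lc κ (Pi.single i s) := (lc_single κ i s).symm
  have h1 : s • κ i ∈ closure (hCone 4 (tile κ (stdM n))) ↔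
      Pi.single i s ∈ coneC (stdM n) := by
    rw [hT.mem_closure_hCone hF, hi]
    constructor
    · rintro ⟨a, ha, h⟩
      exact ⟨a, ha, lc_injective hS hP.gram (by rw [h, lc_vecMul])⟩
    · rintro ⟨a, ha, h⟩
      exact ⟨a, ha, by rw [h, lc_vecMul]⟩
  rw [h1, mem_coneC_stdM_iff]
  refine forall_congr' fun c => ?_
  rw [dotProduct_single, mat_apply, mul_nonneg_iff_of_pos_right hs]
  exact Int.cast_nonneg_iff

theorem hTilesAt_stdSet (hS : SimplexData gramP cogramP) (hF : SimplexData gramF cogramF)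
    (hP : Frame cogramP P κ) (i : Fin 5) {s : ℝ} (hs : 0 < s) :
    hTilesAt 4 (stdSet κ) (s • κ i) = (Finset.univ.filter fun n : Fin 10 =>
      ∀ c : Fin 5, 0 ≤ ((wallsZ (stdTile n)).getD c []).getD i 0).card := by
  rw [hTilesAt, ← ncard_coe_finset,
    ← ncard_image_of_injective _ (tile_stdM_injective hS hF hP)]
  congr 1
  ext T
  constructor
  · rintro ⟨⟨n, rfl⟩, h⟩
    exact ⟨n, by simpa using (mem_closure_tile hS hF hP n i hs).1 h, rfl⟩
  · rintro ⟨n, hn, rfl⟩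
    exact ⟨⟨n, rfl⟩, (mem_closure_tile hS hF hP n i hs).2 (by simpa using hn)⟩

theorem cogramP_self (i : Fin 5) : cogramP i i = 0 ↔ i = 2 ∨ i = 3 ∨ i = 4 := by
  fin_cases i <;> simp [cogramP, mat_apply, formP]

theorem stdSet_counting (hS : SimplexData gramP cogramP) (hF : SimplexData gramF cogramF)
    (hP : Frame cogramP P κ) : (stdSet κ).ncard = 10 ∧
      ∃ w ∈ hIdealVerts 4 P, hTilesAt 4 (stdSet κ) w = 8 ∧
        ∀ w' ∈ hIdealVerts 4 P, w' ≠ w → hTilesAt 4 (stdSet κ) w' = 1 := by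
  have hs : ∀ i, 0 < (κ i 0)⁻¹ := fun i => inv_pos.2 (hP.pos i)
  refine ⟨ncard_stdSet hS hF hP, (κ 2 0)⁻¹ • κ 2, (hP.mem_hIdealVerts hS _).2
    ⟨2, (cogramP_self 2).2 (by simp), rfl⟩, ?_, fun w hw hne => ?_⟩
  · rw [hTilesAt_stdSet hS hF hP 2 (hs 2)]
    decide
  · obtain ⟨i, hi, rfl⟩ := (hP.mem_hIdealVerts hS w).1 hw
    rw [hTilesAt_stdSet hS hF hP i (hs i)]
    rcases (cogramP_self i).1 hi with rfl | rfl | rfl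
    · exact absurd rfl hne
    · decide
    · decide

theorem stdSet_equiv (hS : SimplexData gramP cogramP) (hP : Frame cogramP P κ)
    (hP' : Frame cogramP P κ') : hDecompEquiv 4 P (stdSet κ) (stdSet κ') := by
  obtain ⟨g, hg, h⟩ := exists_isom hS hP.gram hP.pos hP'.gram hP'.pos
  have key := image_eq_of_lc hS hP.gram hP'.gram hg h
  refine ⟨g, hg, ?_, ?_⟩
  · conv_rhs => rw [hP'.eq_spanned]
    rw [hP.eq_spanned]
    exact key {a | ∀ i, 0 ≤ a i}
  · rw [stdSet, ← range_comp]
    exact congrArg Set.range (funext fun n => key (coneC (stdM n)))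

end Counting

theorem statement13 (P F : Set ↥(hypSet 4)) (hF : IsH34 F) (hP : IsH94 P) :
    (∃ 𝒯, hSTDecomp 4 P F 𝒯) ∧
    (∀ 𝒯₁ 𝒯₂, hSTDecomp 4 P F 𝒯₁ → hSTDecomp 4 P F 𝒯₂ →
      hDecompEquiv 4 P 𝒯₁ 𝒯₂) ∧
    (∀ 𝒯, hSTDecomp 4 P F 𝒯 → 𝒯.ncard = 10 ∧
      ∃ w ∈ hIdealVerts 4 P, hTilesAt 4 𝒯 w = 8 ∧
        ∀ w' ∈ hIdealVerts 4 P, w' ≠ w → hTilesAt 4 𝒯 w' = 1) := by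
  obtain ⟨hSF, φ, hφ⟩ := exists_frameF hF
  obtain ⟨hSP, κ, hκ⟩ := exists_frameP hP
  have key := fun 𝒯 (h : hSTDecomp 4 P F 𝒯) => eq_stdSet hSP hSF hκ hφ h
  obtain ⟨-, hPc, -⟩ := hP
  obtain ⟨_, _, -, -, -, hvol, -⟩ := hPc.1
  refine ⟨⟨_, stdSet_decomp hSP hSF hκ hφ hvol⟩, fun 𝒯₁ 𝒯₂ h₁ h₂ => ?_, fun 𝒯 h => ?_⟩
  · obtain ⟨κ₁, hκ₁, rfl⟩ := key _ h₁
    obtain ⟨κ₂, hκ₂, rfl⟩ := key _ h₂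
    exact stdSet_equiv hSP hκ₁ hκ₂
  · obtain ⟨κ', hκ', rfl⟩ := key _ h
    exact stdSet_counting hSP hSF hκ'

end CD
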